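/- Let F be a 3-uniform hypergraph with π_⋅(F) > 0. If there exists a good vertex partition V(F) = A ∪ B ∪ C (i.e., F[A∪B], F[B∪C], F[C∪A] are (2,1)-type 3-graphs with respect to A∪B, B∪C, C∪A respectively, and F has no other edges), then at least one of π_⋅(F[A∪B]) > 0, π_⋅(F[B∪C]) > 0, π_⋅(F[C∪A]) > 0 holds. -/

import Mathlib

open Filter

/-- A 3-uniform hypergraph on vertex type `V`: a set of edges, each of size 3. -/
structure H3 (V : Type) [DecidableEq V] where
  edges : Finset (Finset V)
  card3 : ∀ e ∈ edges, e.card = 3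

namespace H3

variable {V W : Type} [DecidableEq V] [DecidableEq W]

/-- `H` contains a copy of `F`: an injection of vertices mapping edges to edges. -/
def contains (H : H3 V) (F : H3 W) : Prop :=
  ∃ f : W → V, Function.Injective f ∧ ∀ e ∈ F.edges, e.image f ∈ H.edges

/-- `H` is `F`-free. -/
def free (H : H3 V) (F : H3 W) : Prop := ¬ H.contains F

/-- The codegree of a pair of vertices: the number of edges containing both. -/
def codeg (H : H3 V) (u v : V) : ℕ :=
  (H.edges.filter fun e => u ∈ e ∧ v ∈ e).card

/-- The minimum codegree: the minimum of `codeg` over pairs of distinct vertices. -/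
noncomputable def minCodeg [Fintype V] (H : H3 V) : ℕ :=
  sInf {d | ∃ u v : V, u ≠ v ∧ H.codeg u v = d}

/-- `H` is uniformly `(d, η)`-dense: every vertex subset `U` spans at least
`d * C(|U|,3) - η * n^3` edges. -/
def uniformlyDense [Fintype V] (H : H3 V) (d η : ℝ) : Prop :=
  ∀ U : Finset V,
    d * (U.card.choose 3 : ℝ) - η * (Fintype.card V : ℝ) ^ 3
      ≤ ((H.edges.filter fun e => e ⊆ U).card : ℝ)

end H3

/-- The uniform Turán density `π_⋅(F)`. -/
noncomputable def uniformTuranDensity {W : Type} [DecidableEq W] (F : H3 W) : ℝ :=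
  sSup {d : ℝ | 0 ≤ d ∧ d ≤ 1 ∧
    ∀ η : ℝ, 0 < η → ∀ n₀ : ℕ, ∃ n, n₀ ≤ n ∧
      ∃ H : H3 (Fin n), H.free F ∧ H.uniformlyDense d η}

/-- The codegree Turán number `ex_co(n, F)`: the maximum minimum codegree of an
`n`-vertex `F`-free 3-graph. -/
noncomputable def exCodeg {W : Type} [DecidableEq W] (n : ℕ) (F : H3 W) : ℕ :=
  sSup {d | ∃ H : H3 (Fin n), H.free F ∧ H.minCodeg = d}

/-- The codegree Turán density `π_co(F) = lim_n ex_co(n,F)/n` (the limit exists,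
so it coincides with the limsup). -/
noncomputable def codegTuranDensity {W : Type} [DecidableEq W] (F : H3 W) : ℝ :=
  Filter.limsup (fun n : ℕ => (exCodeg n F : ℝ) / n) Filter.atTop

/-- The subhypergraph of `F` induced on the vertex subset `S` (modelled on the
same ambient vertex type; its edges are the edges of `F` contained in `S`). -/
def H3.restrict {V : Type} [DecidableEq V] (F : H3 V) (S : Finset V) : H3 V where
  edges := F.edges.filter fun e => e ⊆ S
  card3 := fun e he => F.card3 e (Finset.mem_filter.mp he).1

/-- Ramsey's theorem for two colours, for strictly increasing lists of length `q`. -/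
theorem exists_ramsey (q : ℕ) : ∀ a b : ℕ, ∃ N : ℕ, ∀ {ι : Type} [LinearOrder ι] (T : Finset ι),
    N ≤ T.card → ∀ P : List ι → Prop,
    (∃ A ⊆ T, a ≤ A.card ∧
      ∀ l : List ι, l.Pairwise (· < ·) → l.length = q → (∀ x ∈ l, x ∈ A) → P l) ∨
    (∃ B ⊆ T, b ≤ B.card ∧
      ∀ l : List ι, l.Pairwise (· < ·) → l.length = q → (∀ x ∈ l, x ∈ B) → ¬ P l) := by
  induction q with
  | zero =>
    intro a b
    refine ⟨max a b, fun T hT P => ?_⟩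
    by_cases h : P []
    · refine Or.inl ⟨T, subset_rfl, le_of_max_le_left hT, fun l _ hl _ => ?_⟩
      rwa [List.length_eq_zero_iff.1 hl]
    · refine Or.inr ⟨T, subset_rfl, le_of_max_le_right hT, fun l _ hl _ => ?_⟩
      rwa [List.length_eq_zero_iff.1 hl]
  | succ q ih =>
    intro a
    induction a with
    | zero =>
      intro b
      refine ⟨0, fun T _ P => Or.inl ⟨∅, by simp, by simp, fun l _ hl hx => ?_⟩⟩
      obtain ⟨y, l', rfl⟩ := List.exists_cons_of_length_eq_add_one hl
      exact absurd (hx y (by simp)) (by simp)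
    | succ a iha =>
      intro b
      induction b with
      | zero =>
        refine ⟨0, fun T _ P => Or.inr ⟨∅, by simp, by simp, fun l _ hl hx => ?_⟩⟩
        obtain ⟨y, l', rfl⟩ := List.exists_cons_of_length_eq_add_one hl
        exact absurd (hx y (by simp)) (by simp)
      | succ b ihb =>
        obtain ⟨Na, hNa⟩ := iha (b + 1)
        obtain ⟨Nb, hNb⟩ := ihb
        obtain ⟨N, hN⟩ := ih Na Nb
        have key : ∀ {ι : Type} [LinearOrder ι] (x : ι) (A A' : Finset ι) (P : List ι → Prop),
            A' ⊆ A → (∀ y ∈ A, x < y) →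
            (∀ l : List ι, l.Pairwise (· < ·) → l.length = q → (∀ y ∈ l, y ∈ A) → P (x :: l)) →
            (∀ l : List ι, l.Pairwise (· < ·) → l.length = q + 1 → (∀ y ∈ l, y ∈ A') → P l) →
            ∀ l : List ι, l.Pairwise (· < ·) → l.length = q + 1 →
              (∀ y ∈ l, y ∈ insert x A') → P l := by
          intro ι _ x A A' P hA hx h1 h2 l hs hl hm
          obtain ⟨y, l', rfl⟩ := List.exists_cons_of_length_eq_add_one hl
          rw [List.pairwise_cons] at hs
          have hxy : x ≤ y := by
            rcases Finset.mem_insert.1 (hm y (by simp)) with h | h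
            · exact h.ge
            · exact (hx y (hA h)).le
          have hl' : ∀ z ∈ l', z ∈ A' := fun z hz =>
            (Finset.mem_insert.1 (hm z (by simp [hz]))).resolve_left
              (hxy.trans_lt (hs.1 z hz)).ne'
          rcases Finset.mem_insert.1 (hm y (by simp)) with h | h
          · subst h
            exact h1 l' hs.2 (by simpa using hl) fun z hz => hA (hl' z hz)
          · refine h2 _ (List.pairwise_cons.2 hs) hl fun z hz => ?_
            rcases List.mem_cons.1 hz with rfl | hz
            · exact h
            · exact hl' z hz
        refine ⟨N + 1, fun {ι} _ T hT P => ?_⟩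
        have hne : T.Nonempty := Finset.card_pos.1 (by omega)
        set x := T.min' hne with hx
        have hxT : x ∈ T := Finset.min'_mem _ _
        have hlt : ∀ y ∈ T.erase x, x < y := fun y hy => Finset.min'_lt_of_mem_erase_min' _ _ hy
        have hins : ∀ A' ⊆ T.erase x, insert x A' ⊆ T ∧ (insert x A').card = A'.card + 1 := by
          intro A' hA'
          refine ⟨Finset.insert_subset hxT (hA'.trans (Finset.erase_subset _ _)), ?_⟩
          exact Finset.card_insert_of_notMem fun h => (hlt x (hA' h)).false
        rcases hN (T.erase x) (by rw [Finset.card_erase_of_mem hxT]; omega)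
          (fun l => P (x :: l)) with ⟨A, hA, hAc, hAP⟩ | ⟨A, hA, hAc, hAP⟩
        · rcases hNa A hAc P with ⟨A', hA', hc, h⟩ | ⟨B, hB, hc, h⟩
          · refine Or.inl ⟨insert x A', (hins A' (hA'.trans hA)).1, ?_, ?_⟩
            · rw [(hins A' (hA'.trans hA)).2]; omega
            · exact key x A A' P hA' (fun y hy => hlt y (hA hy)) hAP h
          · exact Or.inr ⟨B, hB.trans (hA.trans (Finset.erase_subset _ _)), hc, h⟩
        · rcases hNb A hAc P with ⟨A', hA', hc, h⟩ | ⟨B, hB, hc, h⟩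
          · exact Or.inl ⟨A', hA'.trans (hA.trans (Finset.erase_subset _ _)), hc, h⟩
          · refine Or.inr ⟨insert x B, (hins B (hB.trans hA)).1, ?_, ?_⟩
            · rw [(hins B (hB.trans hA)).2]; omega
            · exact key x A B (fun l => ¬ P l) hB (fun y hy => hlt y (hA hy)) hAP h

/-- If every `M₀`-subset of a huge set contains an increasing `q`-list with property `P`,
then `P` holds for all increasing `q`-lists of a large subset. -/
theorem exists_ramsey_of_exists (q M₀ M : ℕ) : ∃ N : ℕ, ∀ {ι : Type} [LinearOrder ι]
    (T : Finset ι), N ≤ T.card → ∀ P : List ι → Prop,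
    (∀ Q ⊆ T, Q.card = M₀ →
      ∃ l : List ι, l.Pairwise (· < ·) ∧ l.length = q ∧ (∀ x ∈ l, x ∈ Q) ∧ P l) →
    ∃ T' ⊆ T, M ≤ T'.card ∧
      ∀ l : List ι, l.Pairwise (· < ·) → l.length = q → (∀ x ∈ l, x ∈ T') → P l := by
  obtain ⟨N, hN⟩ := exists_ramsey q M M₀
  refine ⟨N, fun T hT P h => ?_⟩
  rcases hN T hT P with h1 | ⟨B, hB, hc, hn⟩
  · exact h1
  · obtain ⟨Q, hQ, hQc⟩ := Finset.exists_subset_card_eq hc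
    obtain ⟨l, hs, hl, hm, hP⟩ := h Q (hQ.trans hB) hQc
    exact absurd hP (hn l hs hl fun x hx => hQ (hm x hx))

/-- Two strictly increasing lists, one lying entirely below the other. -/
def SepLists {ι : Type} [LinearOrder ι] (l l' : List ι) : Prop :=
  (l ++ l').Pairwise (· < ·) ∨ (l' ++ l).Pairwise (· < ·)

theorem SepLists.sublist {ι : Type} [LinearOrder ι] {l l' k k' : List ι} (h : SepLists l l')
    (hk : k.Sublist l) (hk' : k'.Sublist l') : SepLists k k' :=
  h.imp (fun h => h.sublist (hk.append hk')) (fun h => h.sublist (hk'.append hk))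

theorem SepLists.left {ι : Type} [LinearOrder ι] {l l' : List ι} (h : SepLists l l') :
    l.Pairwise (· < ·) := by
  rcases h with h | h
  · exact h.sublist (List.sublist_append_left _ _)
  · exact h.sublist (List.sublist_append_right _ _)

theorem SepLists.right {ι : Type} [LinearOrder ι] {l l' : List ι} (h : SepLists l l') :
    l'.Pairwise (· < ·) := by
  rcases h with h | h
  · exact h.sublist (List.sublist_append_right _ _)
  · exact h.sublist (List.sublist_append_left _ _)

theorem SepLists.ne {ι : Type} [LinearOrder ι] {l l' : List ι} (h : SepLists l l') {x y : ι}
    (hx : x ∈ l) (hy : y ∈ l') : x ≠ y := by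
  rcases h with h | h
  · exact ((List.pairwise_append.1 h).2.2 x hx y hy).ne
  · exact ((List.pairwise_append.1 h).2.2 y hy x hx).ne'

/-- The analogue of `exists_ramsey_of_exists` for separated pairs of lists. -/
theorem exists_ramsey_sepLists (n₁ n₂ M₁ M₂ M : ℕ) : ∃ N : ℕ, ∀ {ι : Type} [LinearOrder ι]
    (T : Finset ι), N ≤ T.card → ∀ P : List ι → List ι → Prop,
    (∀ l₀ l₀' : List ι, SepLists l₀ l₀' → l₀.length = M₁ → l₀'.length = M₂ →
      (∀ x ∈ l₀, x ∈ T) → (∀ x ∈ l₀', x ∈ T) →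
      ∃ l l' : List ι, l.Sublist l₀ ∧ l'.Sublist l₀' ∧ l.length = n₁ ∧ l'.length = n₂ ∧ P l l') →
    ∃ T' ⊆ T, M ≤ T'.card ∧ ∀ l l' : List ι, SepLists l l' → l.length = n₁ → l'.length = n₂ →
      (∀ x ∈ l, x ∈ T') → (∀ x ∈ l', x ∈ T') → P l l' := by
  obtain ⟨N₁, hN₁⟩ := exists_ramsey_of_exists (n₁ + n₂) (M₁ + M₂) M
  obtain ⟨N, hN⟩ := exists_ramsey_of_exists (n₁ + n₂) (M₁ + M₂) N₁
  refine ⟨N, fun {ι} _ T hT P h => ?_⟩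
  obtain ⟨T₁, hT₁, hc₁, h₁⟩ := hN T hT (fun L => P (L.take n₁) (L.drop n₁)) (by
    intro Q hQ hQc
    have hs : (Q.sort (· ≤ ·)).Pairwise (· < ·) := (Finset.sortedLT_sort Q).pairwise
    rw [← List.take_append_drop M₁ (Q.sort (· ≤ ·))] at hs
    have hm : ∀ x ∈ Q.sort (· ≤ ·), x ∈ Q := fun x hx => by simpa using hx
    obtain ⟨l, l', hl, hl', e, e', hP⟩ := h _ _ (Or.inl hs) (by simp [hQc]) (by simp [hQc])
      (fun x hx => hQ (hm x (List.mem_of_mem_take hx)))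
      (fun x hx => hQ (hm x (List.mem_of_mem_drop hx)))
    refine ⟨l ++ l', hs.sublist (hl.append hl'), by simp [e, e'], fun x hx => hm x ?_, ?_⟩
    · rw [← List.take_append_drop M₁ (Q.sort (· ≤ ·))]
      exact (hl.append hl').subset hx
    · rw [← e]; simpa using hP)
  obtain ⟨T₂, hT₂, hc₂, h₂⟩ := hN₁ T₁ hc₁ (fun L => P (L.drop n₂) (L.take n₂)) (by
    intro Q hQ hQc
    have hs : (Q.sort (· ≤ ·)).Pairwise (· < ·) := (Finset.sortedLT_sort Q).pairwise
    rw [← List.take_append_drop M₂ (Q.sort (· ≤ ·))] at hs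
    have hm : ∀ x ∈ Q.sort (· ≤ ·), x ∈ Q := fun x hx => by simpa using hx
    obtain ⟨l, l', hl, hl', e, e', hP⟩ := h _ _ (Or.inr hs) (by simp [hQc]) (by simp [hQc])
      (fun x hx => hT₁ (hQ (hm x (List.mem_of_mem_drop hx))))
      (fun x hx => hT₁ (hQ (hm x (List.mem_of_mem_take hx))))
    refine ⟨l' ++ l, hs.sublist (hl'.append hl), by simp [e, e', add_comm],
      fun x hx => hm x ?_, ?_⟩
    · rw [← List.take_append_drop M₂ (Q.sort (· ≤ ·))]
      exact (hl'.append hl).subset hx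
    · rw [← e']; simpa using hP)
  refine ⟨T₂, hT₂.trans hT₁, hc₂, fun l l' hs e e' hm hm' => ?_⟩
  rcases hs with hs | hs
  · have := h₁ (l ++ l') hs (by simp [e, e']) (fun x hx => by
      rcases List.mem_append.1 hx with hx | hx
      · exact hT₂ (hm x hx)
      · exact hT₂ (hm' x hx))
    rw [← e] at this; simpa using this
  · have := h₂ (l' ++ l) hs (by simp [e, e', add_comm]) (fun x hx => by
      rcases List.mem_append.1 hx with hx | hx
      · exact hm' x hx
      · exact hm x hx)
    rw [← e'] at this; simpa using this

section

open scoped Classical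

/-- Among sufficiently many events of measure at least `δ`, some `r` intersect in a set of
measure bounded from below. -/
theorem exists_large_inter (δ : ℝ) (hδ : 0 < δ) (r : ℕ) : ∃ K : ℕ, ∃ γ : ℝ, 0 < γ ∧
    ∀ {β : Type} (B : Finset β) (E : Fin K → β → Prop),
      (∀ k, δ * B.card ≤ ((B.filter fun b => E k b).card : ℝ)) →
      ∃ S : Finset (Fin K), S.card = r ∧
        γ * B.card ≤ ((B.filter fun b => ∀ k ∈ S, E k b).card : ℝ) := by
  obtain ⟨K₀, hK₀⟩ := exists_nat_ge (2 * r / δ)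
  set K := max (K₀ + 1) r with hK
  have hKpos : (0 : ℝ) < K := by
    have : 0 < K := lt_of_lt_of_le (Nat.succ_pos _) (le_max_left _ _)
    exact_mod_cast this
  have hKr : 2 * r ≤ δ * K := by
    rw [div_le_iff₀ hδ] at hK₀
    have : (K₀ : ℝ) ≤ K := by
      have : K₀ ≤ K := (Nat.le_succ _).trans (le_max_left _ _)
      exact_mod_cast this
    nlinarith
  refine ⟨K, δ / 2 / 2 ^ K, by positivity, fun {β} B E hE => ?_⟩
  by_contra! hcon
  set Sb : β → Finset (Fin K) := fun b => Finset.univ.filter fun k => E k b with hSb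
  set G := B.filter fun b => r ≤ (Sb b).card with hG
  have hsum : δ * B.card * K ≤ ∑ b ∈ B, ((Sb b).card : ℝ) := by
    have h1 : ∑ k : Fin K, ((B.filter fun b => E k b).card : ℝ) = ∑ b ∈ B, ((Sb b).card : ℝ) := by
      simp only [hSb, Finset.card_filter, Nat.cast_sum]
      exact Finset.sum_comm
    rw [← h1]
    calc δ * B.card * K = ∑ k : Fin K, δ * B.card := by simp [mul_comm]
      _ ≤ _ := Finset.sum_le_sum fun k _ => hE k
  have hup : ∑ b ∈ B, ((Sb b).card : ℝ) ≤ K * G.card + r * B.card := by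
    have h2 : ∀ b ∈ B, ((Sb b).card : ℝ) ≤ (if r ≤ (Sb b).card then (K : ℝ) else 0) + r := by
      intro b _
      split_ifs with h
      · have : (Sb b).card ≤ K := by simpa using Finset.card_le_univ (Sb b)
        have : ((Sb b).card : ℝ) ≤ K := by exact_mod_cast this
        have := Nat.cast_nonneg (α := ℝ) r
        linarith
      · have : ((Sb b).card : ℝ) ≤ r := by exact_mod_cast (not_le.1 h).le
        linarith
    refine (Finset.sum_le_sum h2).trans (le_of_eq ?_)
    rw [Finset.sum_add_distrib, ← Finset.sum_filter]
    simp [hG, mul_comm]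
  have hGl : δ / 2 * B.card ≤ (G.card : ℝ) := by
    have hB := Nat.cast_nonneg (α := ℝ) B.card
    have : (δ / 2 * B.card) * K ≤ G.card * K := by nlinarith
    exact le_of_mul_le_mul_right this hKpos
  have hsub : G ⊆ (Finset.powersetCard r (Finset.univ : Finset (Fin K))).biUnion
      fun S => B.filter fun b => ∀ k ∈ S, E k b := by
    intro b hb
    rw [hG, Finset.mem_filter] at hb
    obtain ⟨S, hS, hSc⟩ := Finset.exists_subset_card_eq hb.2
    refine Finset.mem_biUnion.2 ⟨S, Finset.mem_powersetCard.2 ⟨Finset.subset_univ _, hSc⟩, ?_⟩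
    exact Finset.mem_filter.2 ⟨hb.1, fun k hk => (Finset.mem_filter.1 (hS hk)).2⟩
  have hne : (Finset.powersetCard r (Finset.univ : Finset (Fin K))).Nonempty := by
    rw [Finset.powersetCard_nonempty]
    simp [hK]
  have h3 : (G.card : ℝ) < δ / 2 * B.card := by
    calc (G.card : ℝ) ≤ ∑ S ∈ Finset.powersetCard r (Finset.univ : Finset (Fin K)),
          ((B.filter fun b => ∀ k ∈ S, E k b).card : ℝ) := by
          exact_mod_cast (Finset.card_le_card hsub).trans Finset.card_biUnion_le
      _ < ∑ S ∈ Finset.powersetCard r (Finset.univ : Finset (Fin K)),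
          δ / 2 / 2 ^ K * B.card :=
          Finset.sum_lt_sum_of_nonempty hne fun S hS => hcon S (Finset.mem_powersetCard.1 hS).2
      _ ≤ ∑ S : Finset (Fin K), δ / 2 / 2 ^ K * B.card :=
          Finset.sum_le_sum_of_subset_of_nonneg (Finset.subset_univ _)
            fun _ _ _ => by positivity
      _ = δ / 2 * B.card := by
          simp
          field_simp
  linarith

/-- For a word `w` in two letters and a list `l` of the same length, `R` holds between every
position carrying `true` and every later position carrying `false`. -/
def WordRel {ι : Type} (w : List Bool) (l : List ι) (R : ι → ι → Prop) : Prop :=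
  (w.zip l).Pairwise fun p q => p.1 = true → q.1 = false → R p.2 q.2

/-- Ramsey-type statement: dense events indexed by pairs contain every word pattern with
positive measure on a large index set. -/
def WordAlive (w : List Bool) : Prop :=
  ∀ δ : ℝ, 0 < δ → ∃ γ : ℝ, 0 < γ ∧ ∀ M : ℕ, ∃ N : ℕ, ∀ {ι β : Type} [LinearOrder ι]
    (T : Finset ι) (B : Finset β) (E : ι → ι → β → Prop), N ≤ T.card →
    (∀ i ∈ T, ∀ i' ∈ T, i < i' → δ * B.card ≤ ((B.filter fun b => E i i' b).card : ℝ)) →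
    ∃ T' ⊆ T, M ≤ T'.card ∧ ∀ l : List ι, l.Pairwise (· < ·) → l.length = w.length →
      (∀ x ∈ l, x ∈ T') →
      γ * B.card ≤ ((B.filter fun b => WordRel w l fun i i' => E i i' b).card : ℝ)

theorem wordAlive_of_forall {w : List Bool}
    (h : ∀ {ι : Type} (l : List ι) (R : ι → ι → Prop), l.length = w.length → WordRel w l R) :
    WordAlive w := by
  refine fun δ _ => ⟨1, one_pos, fun M => ⟨M, fun T B E hT _ => ⟨T, subset_rfl, hT, ?_⟩⟩⟩
  intro l _ hl _
  rw [Finset.filter_true_of_mem fun b _ => h l _ hl, one_mul]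

theorem WordAlive.cons_false {w : List Bool} (h : WordAlive w) : WordAlive (false :: w) := by
  intro δ hδ
  obtain ⟨γ, hγ, h⟩ := h δ hδ
  refine ⟨γ, hγ, fun M => ?_⟩
  obtain ⟨N, hN⟩ := h M
  refine ⟨N, fun T B E hT hE => ?_⟩
  obtain ⟨T', hT', hc, hl⟩ := hN T B E hT hE
  refine ⟨T', hT', hc, fun l hs hlen hm => ?_⟩
  obtain ⟨y, l', rfl⟩ := List.exists_cons_of_length_eq_add_one hlen
  refine (hl l' (List.pairwise_cons.1 hs).2 (by simpa using hlen)
    fun x hx => hm x (by simp [hx])).trans ?_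
  refine Nat.cast_le.2 (Finset.card_le_card (Finset.monotone_filter_right _ fun b hb h => ?_))
  simpa [WordRel] using h

theorem pairwise_lt_take_drop {ι : Type} [LinearOrder ι] {L : List ι} (hL : L.Pairwise (· < ·))
    {a i : ℕ} (hi : i < L.length) (hia : i < a) {y : ι} (hy : y ∈ L.drop a) : L[i] < y := by
  rw [← List.take_append_drop a L, List.pairwise_append] at hL
  exact hL.2.2 _ (List.mem_take_iff_getElem.2 ⟨i, by omega, rfl⟩) y hy

theorem WordAlive.cons_true_true {w : List Bool} (h : WordAlive (true :: w)) :
    WordAlive (true :: true :: w) := by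
  intro δ hδ
  obtain ⟨γ₀, hγ₀, h⟩ := h δ hδ
  obtain ⟨K, γ, hγ, hK⟩ := exists_large_inter γ₀ hγ₀ 2
  refine ⟨γ, hγ, fun M => ?_⟩
  obtain ⟨N₁, hN₁⟩ := exists_ramsey_of_exists (w.length + 2) (K + w.length) M
  obtain ⟨N, hN⟩ := h N₁
  refine ⟨N, fun {ι β} _ T B E hT hE => ?_⟩
  obtain ⟨T₁, hT₁, hc₁, hl₁⟩ := hN T B E hT hE
  obtain ⟨T', hT', hc, hl⟩ := hN₁ T₁ hc₁ (fun l => γ * B.card ≤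
    ((B.filter fun b => WordRel (true :: true :: w) l fun i i' => E i i' b).card : ℝ)) (by
      intro Q hQ hQc
      have hs : (Q.sort (· ≤ ·)).Pairwise (· < ·) := (Finset.sortedLT_sort Q).pairwise
      have hm : ∀ x ∈ Q.sort (· ≤ ·), x ∈ T₁ := fun x hx => hQ (by simpa using hx)
      have hm' : ∀ x ∈ Q.sort (· ≤ ·), x ∈ Q := fun x hx => by simpa using hx
      have hlen : (Q.sort (· ≤ ·)).length = K + w.length := by simp [hQc]
      set L := Q.sort (· ≤ ·)
      have hdrop : (L.drop K).Pairwise (· < ·) := hs.sublist (List.drop_sublist _ _)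
      have hcons : ∀ k : Fin K, ∀ y ∈ L.drop K, L[k] < y := fun k y hy =>
        pairwise_lt_take_drop hs (by omega) k.2 hy
      obtain ⟨S, hS, hSB⟩ := hK B (fun k b => WordRel (true :: w) (L[k] :: L.drop K)
        fun i i' => E i i' b) (fun k => hl₁ _ (List.pairwise_cons.2 ⟨hcons k, hdrop⟩)
          (by simp [hlen]) (by
            intro x hx
            rcases List.mem_cons.1 hx with rfl | hx
            · exact hm _ (List.getElem_mem _)
            · exact hm _ (List.mem_of_mem_drop hx)))
      obtain ⟨k, k', hkk, rfl⟩ : ∃ k k' : Fin K, k < k' ∧ S = {k, k'} := by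
        obtain ⟨x, y, hxy, rfl⟩ := Finset.card_eq_two.1 hS
        rcases lt_or_gt_of_ne hxy with h | h
        · exact ⟨x, y, h, rfl⟩
        · exact ⟨y, x, h, Finset.pair_comm _ _⟩
      refine ⟨L[k] :: L[k'] :: L.drop K, ?_, by simp [hlen], ?_, hSB.trans ?_⟩
      · refine List.pairwise_cons.2 ⟨fun y hy => ?_, List.pairwise_cons.2 ⟨hcons k', hdrop⟩⟩
        rcases List.mem_cons.1 hy with rfl | hy
        · exact List.pairwise_iff_getElem.1 hs _ _ _ _ hkk
        · exact hcons k y hy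
      · intro x hx
        rcases List.mem_cons.1 hx with rfl | hx
        · exact hm' _ (List.getElem_mem _)
        rcases List.mem_cons.1 hx with rfl | hx
        · exact hm' _ (List.getElem_mem _)
        · exact hm' _ (List.mem_of_mem_drop hx)
      · refine Nat.cast_le.2 (Finset.card_le_card
          (Finset.monotone_filter_right _ fun b hb h => ?_))
        have h1 := h k (by simp)
        have h2 := h k' (by simp)
        simp only [WordRel, List.zip_cons_cons, List.pairwise_cons, List.mem_cons] at h1 h2 ⊢
        refine ⟨fun q hq _ hf => ?_, h2⟩
        rcases hq with rfl | hq
        · simp at hf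
        · exact h1.1 q hq trivial hf)
  exact ⟨T', hT'.trans hT₁, hc, fun l hs hlen hm => hl l hs (by simpa using hlen) hm⟩

theorem WordAlive.cons_true_false {w : List Bool} (h : WordAlive (true :: w)) :
    WordAlive (true :: false :: w) := by
  by_cases hw : false ∈ w
  swap
  · refine fun δ _ => ⟨δ, ‹_›, fun M => ⟨M, fun T B E hT hE => ⟨T, subset_rfl, hT, ?_⟩⟩⟩
    intro l hs hlen hm
    obtain ⟨x, l, rfl⟩ := List.exists_cons_of_length_eq_add_one hlen
    obtain ⟨y, l, rfl⟩ := List.exists_cons_of_length_eq_add_one (Nat.succ_injective hlen)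
    refine (hE x (hm x (by simp)) y (hm y (by simp))
      ((List.pairwise_cons.1 hs).1 y (by simp))).trans ?_
    refine Nat.cast_le.2 (Finset.card_le_card (Finset.monotone_filter_right _ fun b hb h => ?_))
    have hz : ∀ q ∈ w.zip l, q.1 ≠ false := fun q hq hf =>
      hw (hf ▸ (List.of_mem_zip hq).1)
    simp only [WordRel, List.zip_cons_cons, List.pairwise_cons, List.mem_cons]
    refine ⟨fun q hq _ hf => ?_, by simp, ?_⟩
    · rcases hq with rfl | hq
      · exact h
      · exact absurd hf (hz q hq)
    · exact List.pairwise_of_forall_mem_list fun p _ q hq _ hf => absurd hf (hz q hq)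
  obtain ⟨p, hp, hwp⟩ := List.getElem_of_mem hw
  intro δ hδ
  obtain ⟨γ₀, hγ₀, h⟩ := h δ hδ
  obtain ⟨K, γ, hγ, hK⟩ := exists_large_inter γ₀ hγ₀ 2
  refine ⟨γ, hγ, fun M => ?_⟩
  obtain ⟨N₁, hN₁⟩ := exists_ramsey_of_exists (w.length + 2) (1 + K * w.length) M
  obtain ⟨N, hN⟩ := h N₁
  refine ⟨N, fun {ι β} _ T B E hT hE => ?_⟩
  obtain ⟨T₁, hT₁, hc₁, hl₁⟩ := hN T B E hT hE
  obtain ⟨T', hT', hc, hl⟩ := hN₁ T₁ hc₁ (fun l => γ * B.card ≤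
    ((B.filter fun b => WordRel (true :: false :: w) l fun i i' => E i i' b).card : ℝ)) (by
      intro Q hQ hQc
      have hs : (Q.sort (· ≤ ·)).Pairwise (· < ·) := (Finset.sortedLT_sort Q).pairwise
      have hm : ∀ x ∈ Q.sort (· ≤ ·), x ∈ T₁ := fun x hx => hQ (by simpa using hx)
      have hm' : ∀ x ∈ Q.sort (· ≤ ·), x ∈ Q := fun x hx => by simpa using hx
      have hlen : (Q.sort (· ≤ ·)).length = 1 + K * w.length := by simp [hQc]
      set L := Q.sort (· ≤ ·)
      set n := w.length
      set blk : ℕ → List ι := fun k => (L.drop (1 + k * n)).take n with hblk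
      have hidx : ∀ k : Fin K, 1 + k * n + n ≤ L.length := fun k => by
        have : (k + 1 : ℕ) * n ≤ K * n := Nat.mul_le_mul_right _ k.2
        rw [hlen]; linarith
      have hblklen : ∀ k : Fin K, (blk k).length = n := fun k => by
        have := hidx k
        simp only [hblk, List.length_take, List.length_drop]
        omega
      have hblksub : ∀ k : Fin K, (blk k).Pairwise (· < ·) := fun k =>
        hs.sublist ((List.take_sublist _ _).trans (List.drop_sublist _ _))
      have hmemL : ∀ k : Fin K, ∀ x ∈ blk k, x ∈ L := fun k x hx =>
        List.mem_of_mem_drop (List.mem_of_mem_take hx)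
      have h0 : 0 < L.length := by omega
      have hcons : ∀ k : Fin K, ∀ y ∈ blk k, L[0] < y := fun k y hy =>
        pairwise_lt_take_drop hs h0 (by omega : 0 < 1 + k * n) (List.mem_of_mem_take hy)
      obtain ⟨S, hS, hSB⟩ := hK B (fun k b => WordRel (true :: w) (L[0] :: blk k)
        fun i i' => E i i' b) (fun k => hl₁ _ (List.pairwise_cons.2 ⟨hcons k, hblksub k⟩)
          (by simp [hblklen, n]) (by
            intro x hx
            rcases List.mem_cons.1 hx with rfl | hx
            · exact hm _ (List.getElem_mem _)
            · exact hm _ (hmemL k x hx)))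
      obtain ⟨k, k', hkk, rfl⟩ : ∃ k k' : Fin K, k < k' ∧ S = {k, k'} := by
        obtain ⟨x, y, hxy, rfl⟩ := Finset.card_eq_two.1 hS
        rcases lt_or_gt_of_ne hxy with h | h
        · exact ⟨x, y, h, rfl⟩
        · exact ⟨y, x, h, Finset.pair_comm _ _⟩
      have hpk : p < (blk k).length := by rw [hblklen]; exact hp
      have hmemk : (blk k)[p] ∈ blk k := List.getElem_mem _
      have hlt : ∀ y ∈ blk k', (blk k)[p] < y := by
        intro y hy
        have e : (blk k)[p] = L[1 + k * n + p]'(by have := hidx k; omega) := by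
          simp [hblk]
        rw [e]
        refine pairwise_lt_take_drop hs _ ?_ (List.mem_of_mem_take hy)
        have : (k + 1 : ℕ) * n ≤ k' * n := Nat.mul_le_mul_right _ hkk
        linarith
      refine ⟨L[0] :: (blk k)[p] :: blk k', ?_, by simp [hblklen, n], ?_, hSB.trans ?_⟩
      · refine List.pairwise_cons.2 ⟨fun y hy => ?_, List.pairwise_cons.2 ⟨hlt, hblksub k'⟩⟩
        rcases List.mem_cons.1 hy with rfl | hy
        · exact hcons k _ hmemk
        · exact hcons k' y hy
      · intro x hx
        rcases List.mem_cons.1 hx with rfl | hx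
        · exact hm' _ (List.getElem_mem _)
        rcases List.mem_cons.1 hx with rfl | hx
        · exact hm' _ (hmemL k _ hmemk)
        · exact hm' _ (hmemL k' x hx)
      · refine Nat.cast_le.2 (Finset.card_le_card
          (Finset.monotone_filter_right _ fun b hb h => ?_))
        have h1 := h k (by simp)
        have h2 := h k' (by simp)
        simp only [WordRel, List.zip_cons_cons, List.pairwise_cons, List.mem_cons] at h1 h2 ⊢
        refine ⟨fun q hq _ hf => ?_, by simp, h2.2⟩
        rcases hq with rfl | hq
        · refine h1.1 (false, (blk k)[p]) ?_ trivial rfl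
          rw [List.mem_iff_getElem]
          exact ⟨p, by simpa using ⟨hp, hpk⟩, by simp [hwp]⟩
        · exact h2.1 q hq trivial hf)
  exact ⟨T', hT'.trans hT₁, hc, fun l hs hlen hm => hl l hs (by simpa using hlen) hm⟩

theorem wordAlive (w : List Bool) : WordAlive w := by
  suffices h : WordAlive w ∧ WordAlive (true :: w) from h.1
  induction w with
  | nil =>
    refine ⟨wordAlive_of_forall fun l R _ => by simp [WordRel], wordAlive_of_forall ?_⟩
    intro ι l R hl
    obtain ⟨y, l', rfl⟩ := List.exists_cons_of_length_eq_add_one hl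
    simp [WordRel]
  | cons x w ih =>
    cases x
    · exact ⟨ih.1.cons_false, ih.2.cons_true_false⟩
    · exact ⟨ih.2, ih.2.cons_true_true⟩

/-- Simultaneous version of `wordAlive` for several words, each with its own space of events. -/
theorem exists_wordRel_all (m : ℕ) (δ : ℝ) (hδ : 0 < δ) (ws : List (List Bool))
    (hws : ∀ w ∈ ws, w.length = m) :
    ∃ γ : ℝ, 0 < γ ∧ ∀ M : ℕ, ∃ N : ℕ, ∀ {ι β : Type} [LinearOrder ι] (T : Finset ι)
      (B : ι → Finset β) (E : ι → ι → ι → β → Prop) (js : List ι), N ≤ T.card →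
      (∀ j ∈ js, ∀ i ∈ T, ∀ i' ∈ T, i < i' →
        δ * (B j).card ≤ (((B j).filter fun b => E j i i' b).card : ℝ)) →
      ∃ T' ⊆ T, M ≤ T'.card ∧ ∀ l : List ι, l.Pairwise (· < ·) → l.length = m →
        (∀ x ∈ l, x ∈ T') → ∀ p ∈ ws.zip js, γ * (B p.2).card ≤
          (((B p.2).filter fun b => WordRel p.1 l fun i i' => E p.2 i i' b).card : ℝ) := by
  induction ws with
  | nil => exact ⟨1, one_pos, fun M => ⟨M, fun T B E js hT _ => ⟨T, subset_rfl, hT, by simp⟩⟩⟩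
  | cons w ws ih =>
    obtain ⟨γ₁, hγ₁, h₁⟩ := ih fun w hw => hws w (by simp [hw])
    obtain ⟨γ₂, hγ₂, h₂⟩ := wordAlive w δ hδ
    refine ⟨min γ₁ γ₂, lt_min hγ₁ hγ₂, fun M => ?_⟩
    obtain ⟨N₁, hN₁⟩ := h₁ M
    obtain ⟨N₂, hN₂⟩ := h₂ N₁
    refine ⟨max N₁ N₂, fun {ι β} _ T B E js hT hE => ?_⟩
    rcases js with _ | ⟨j, js⟩
    · obtain ⟨T₁, hT₁, hc₁, -⟩ := hN₁ T B E [] (le_of_max_le_left hT) (by simp)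
      exact ⟨T₁, hT₁, hc₁, by simp⟩
    obtain ⟨T₂, hT₂, hc₂, hl₂⟩ := hN₂ T (B j) (E j) (le_of_max_le_right hT)
      (hE j (by simp))
    obtain ⟨T₁, hT₁, hc₁, hl₁⟩ := hN₁ T₂ B E js hc₂ fun j hj i hi i' hi' =>
      hE j (by simp [hj]) i (hT₂ hi) i' (hT₂ hi')
    refine ⟨T₁, hT₁.trans hT₂, hc₁, fun l hs hlen hm p hp => ?_⟩
    rw [List.zip_cons_cons, List.mem_cons] at hp
    rcases hp with rfl | hp
    · refine le_trans ?_ (hl₂ l hs (by rw [hlen, hws w (by simp)]) fun x hx => hT₁ (hm x hx))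
      gcongr
      exact min_le_right _ _
    · refine le_trans ?_ (hl₁ l hs hlen hm p hp)
      gcongr
      exact min_le_left _ _

end

section Boxes

open Finset Fintype

open scoped BigOperators Classical

variable {ι V : Type}

/-- `X` is a sub-box of `Y` whose sides have relative size at least `ε`. -/
def SubBox (ε : ℝ) (X Y : ι → Finset V) : Prop := ∀ i, X i ⊆ Y i ∧ ε * (Y i).card ≤ (X i).card

theorem SubBox.refl (Y : ι → Finset V) {ε : ℝ} (hε : ε ≤ 1) : SubBox ε Y Y := fun _ =>
  ⟨subset_rfl, mul_le_of_le_one_left (Nat.cast_nonneg _) hε⟩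

theorem SubBox.trans {X Y Z : ι → Finset V} {ε δ : ℝ} (hε : 0 ≤ ε) (h : SubBox ε X Y)
    (h' : SubBox δ Y Z) : SubBox (ε * δ) X Z := fun i =>
  ⟨(h i).1.trans (h' i).1, by
    have h1 := (h i).2
    have h2 := mul_le_mul_of_nonneg_left (h' i).2 hε
    linarith⟩

theorem SubBox.mono {X Y : ι → Finset V} {ε δ : ℝ} (hε : ε ≤ δ) (h : SubBox δ X Y) :
    SubBox ε X Y := fun i =>
  ⟨(h i).1, (mul_le_mul_of_nonneg_right hε (Nat.cast_nonneg _)).trans (h i).2⟩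

theorem SubBox.nonempty {X Y : ι → Finset V} {ε : ℝ} (hε : 0 < ε) (h : SubBox ε X Y)
    (hY : ∀ i, (Y i).Nonempty) (i : ι) : (X i).Nonempty := by
  have h1 : (0 : ℝ) < (Y i).card := by exact_mod_cast (hY i).card_pos
  have h2 : (0 : ℝ) < (X i).card := (by positivity : 0 < ε * (Y i).card).trans_le (h i).2
  exact card_pos.1 (by exact_mod_cast h2)

theorem SubBox.piecewise {ε : ℝ} {Y₁ Y₂ U : ι → Finset V} [DecidableEq ι] (R : Finset ι)
    (h₁ : SubBox ε Y₁ U)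
    (h₂ : SubBox ε Y₂ U) : SubBox ε (R.piecewise Y₂ Y₁) U := fun i => by
  by_cases hi : i ∈ R
  · simpa [hi] using h₂ i
  · simpa [hi] using h₁ i

variable [Fintype ι] [DecidableEq ι]

/-- The average of `φ` over the box with sides `Y i`. -/
noncomputable abbrev boxAvg (Y : ι → Finset V) (φ : (ι → V) → ℝ) : ℝ := 𝔼 x ∈ piFinset Y, φ x

theorem boxAvg_swap (S : Finset ι) (Y Y' : ι → Finset V) (Φ : (ι → V) → (ι → V) → ℝ) :
    boxAvg Y (fun y => boxAvg Y' fun z => Φ y z) =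
      boxAvg (S.piecewise Y' Y) fun y => boxAvg (S.piecewise Y Y') fun z =>
        Φ (S.piecewise z y) (S.piecewise y z) := by
  simp only [boxAvg]
  rw [← expect_product', ← expect_product']
  have hmem : ∀ (Y Y' : ι → Finset V) (y z : ι → V), y ∈ piFinset Y → z ∈ piFinset Y' →
      S.piecewise z y ∈ piFinset (S.piecewise Y' Y) := by
    intro Y Y' y z hy hz
    rw [mem_piFinset] at *
    intro i
    by_cases h : i ∈ S <;> simp [h, hy i, hz i]
  have hinv : ∀ y z : ι → V, S.piecewise (S.piecewise y z) (S.piecewise z y) = y := by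
    intro y z
    ext i
    by_cases h : i ∈ S <;> simp [h]
  have hinvY : ∀ y z : ι → Finset V, S.piecewise (S.piecewise y z) (S.piecewise z y) = y := by
    intro y z
    ext1 i
    by_cases h : i ∈ S <;> simp [h]
  refine expect_nbij' (fun p => (S.piecewise p.2 p.1, S.piecewise p.1 p.2))
    (fun p => (S.piecewise p.2 p.1, S.piecewise p.1 p.2)) ?_ ?_ ?_ ?_ ?_
  · rintro ⟨y, z⟩ h
    rw [mem_product] at h ⊢
    exact ⟨hmem _ _ _ _ h.1 h.2, hmem _ _ _ _ h.2 h.1⟩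
  · rintro ⟨y, z⟩ h
    rw [mem_product] at h ⊢
    have h1 := hmem _ _ _ _ h.1 h.2
    have h2 := hmem _ _ _ _ h.2 h.1
    rw [hinvY] at h1 h2
    exact ⟨h1, h2⟩
  · rintro ⟨y, z⟩ -
    simp only [hinv]
  · rintro ⟨y, z⟩ -
    simp only [hinv]
  · rintro ⟨y, z⟩ -
    simp only [hinv]

theorem box_nonempty {Y : ι → Finset V} (hY : ∀ i, (Y i).Nonempty) : (piFinset Y).Nonempty :=
  piFinset_nonempty.2 hY

theorem boxAvg_const {Y : ι → Finset V} (hY : ∀ i, (Y i).Nonempty) (a : ℝ) :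
    boxAvg Y (fun _ => a) = a :=
  expect_const (box_nonempty hY) a

/-- A function depending only on the coordinates in `S` has the same average over boxes that
agree on `S`. -/
theorem boxAvg_congr_of_dependsOn (S : Finset ι) {Y Y' : ι → Finset V}
    (hY : ∀ i, (Y i).Nonempty) (hY' : ∀ i, (Y' i).Nonempty) (h : ∀ i ∈ S, Y i = Y' i)
    (φ : (ι → V) → ℝ) (hφ : ∀ x y : ι → V, (∀ i ∈ S, x i = y i) → φ x = φ y) :
    boxAvg Y φ = boxAvg Y' φ := by
  have e1 : S.piecewise Y' Y = Y := by
    ext1 i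
    by_cases hi : i ∈ S <;> simp [hi, h]
  have e2 : S.piecewise Y Y' = Y' := by
    ext1 i
    by_cases hi : i ∈ S <;> simp [hi, h]
  have := boxAvg_swap S Y Y' fun y _ => φ y
  rw [e1, e2] at this
  calc boxAvg Y φ = boxAvg Y fun y => boxAvg Y' fun _ => φ y := by
        simp only [boxAvg_const hY']
    _ = boxAvg Y fun y => boxAvg Y' fun z => φ z := by
        rw [this]
        refine expect_congr rfl fun y _ => expect_congr rfl fun z _ => hφ _ _ fun i hi => ?_
        simp [hi]
    _ = boxAvg Y' φ := boxAvg_const hY _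

theorem boxAvg_piecewise (S : Finset ι) {Y Y' : ι → Finset V}
    (hY : ∀ i, (Y i).Nonempty) (hY' : ∀ i, (Y' i).Nonempty) (φ : (ι → V) → ℝ) :
    boxAvg (S.piecewise Y' Y) φ =
      boxAvg Y fun y => boxAvg Y' fun z => φ (S.piecewise z y) := by
  have hne : ∀ i, (S.piecewise Y Y' i).Nonempty := fun i => by
    by_cases hi : i ∈ S <;> simp [hi, hY, hY']
  rw [boxAvg_swap S]
  refine expect_congr rfl fun y _ => ?_
  have : (fun z : ι → V => φ (S.piecewise (S.piecewise y z) (S.piecewise z y))) =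
      fun _ => φ y := by
    funext z
    congr 1
    ext i
    by_cases hi : i ∈ S <;> simp [hi]
  rw [this, boxAvg_const hne]

theorem boxAvg_resample (S : Finset ι) {Y : ι → Finset V}
    (hY : ∀ i, (Y i).Nonempty) (φ : (ι → V) → ℝ) :
    boxAvg Y φ = boxAvg Y fun y => boxAvg Y fun z => φ (S.piecewise z y) := by
  conv_lhs => rw [← S.piecewise_same Y]
  exact boxAvg_piecewise S hY hY φ

theorem boxAvg_prod {Y : ι → Finset V} (f : ι → V → ℝ) :
    boxAvg Y (fun x => ∏ i, f i (x i)) = ∏ i, 𝔼 v ∈ Y i, f i v := by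
  simp only [boxAvg, Finset.expect_eq_sum_div_card, ← prod_univ_sum, card_piFinset, Nat.cast_prod,
    prod_div_distrib]

theorem boxAvg_prod_mem {Y : ι → Finset V} (hY : ∀ i, (Y i).Nonempty) (J : Finset ι)
    (f : ι → V → ℝ) :
    boxAvg Y (fun x => ∏ i ∈ J, f i (x i)) = ∏ i ∈ J, 𝔼 v ∈ Y i, f i v := by
  have := boxAvg_prod (Y := Y) fun i v => if i ∈ J then f i v else 1
  simp only [Fintype.prod_ite_mem] at this
  rw [this, ← univ_inter J, ← Finset.prod_ite_mem]
  refine prod_congr rfl fun i _ => ?_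
  by_cases hi : i ∈ J <;> simp [hi, hY i]

theorem boxAvg_coord {Y : ι → Finset V} (hY : ∀ i, (Y i).Nonempty) (i : ι) (f : V → ℝ) :
    boxAvg Y (fun x => f (x i)) = 𝔼 v ∈ Y i, f v := by
  simpa using boxAvg_prod_mem hY {i} fun _ => f

theorem boxAvg_update {Y : ι → Finset V} (hY : ∀ i, (Y i).Nonempty) (i : ι) {A : Finset V}
    (hA : A.Nonempty) (φ : (ι → V) → ℝ) :
    boxAvg (Function.update Y i A) φ =
      𝔼 v ∈ A, boxAvg Y fun y => φ (Function.update y i v) := by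
  have e : Function.update Y i A = ({i} : Finset ι).piecewise (fun _ => A) Y := by
    rw [Finset.piecewise_singleton]
  rw [e, boxAvg_piecewise _ hY (fun _ => hA)]
  simp only [Finset.piecewise_singleton]
  simp only [boxAvg]
  rw [expect_comm]
  exact boxAvg_coord (Y := fun _ => A) (fun _ => hA) i
    fun v => 𝔼 y ∈ piFinset Y, φ (Function.update y i v)

theorem boxAvg_resample_coord {Y : ι → Finset V} (hY : ∀ i, (Y i).Nonempty) (i : ι)
    (φ : (ι → V) → ℝ) :
    boxAvg Y φ = 𝔼 v ∈ Y i, boxAvg Y fun y => φ (Function.update y i v) := by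
  conv_lhs => rw [← Function.update_eq_self i Y]
  exact boxAvg_update hY i (hY i) φ

theorem sum_box_split {Y : ι → Finset V} (i : ι) {A : Finset V} (hA : A ⊆ Y i)
    (φ : (ι → V) → ℝ) :
    ∑ x ∈ piFinset Y, φ x = ∑ x ∈ piFinset (Function.update Y i A), φ x +
      ∑ x ∈ piFinset (Function.update Y i (Y i \ A)), φ x := by
  rw [piFinset_update_eq_filter_piFinset_mem _ _ hA,
    piFinset_update_eq_filter_piFinset_mem _ _ sdiff_subset,
    ← sum_filter_add_sum_filter_not (piFinset Y) (fun x => x i ∈ A)]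
  congr 1
  refine sum_congr (filter_congr fun x hx => ?_) fun _ _ => rfl
  have := mem_piFinset.1 hx i
  simp [this]

theorem card_box_update_mul (Y : ι → Finset V) (i : ι) (A : Finset V) :
    (piFinset (Function.update Y i A)).card * (Y i).card = A.card * (piFinset Y).card := by
  simp only [card_piFinset]
  rw [← mul_prod_erase univ (fun j => (Function.update Y i A j).card) (mem_univ i),
    ← mul_prod_erase univ (fun j => (Y j).card) (mem_univ i)]
  have : ∏ j ∈ univ.erase i, (Function.update Y i A j).card = ∏ j ∈ univ.erase i, (Y j).card :=
    prod_congr rfl fun j hj => by rw [Function.update_of_ne (ne_of_mem_erase hj)]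
  rw [this, Function.update_self]
  ring

theorem SubBox.card_le {X Y : ι → Finset V} {ε : ℝ} (hε : 0 ≤ ε) (h : SubBox ε X Y) :
    ε ^ card ι * ((piFinset Y).card : ℝ) ≤ ((piFinset X).card : ℝ) := by
  simp only [card_piFinset, Nat.cast_prod]
  rw [← card_univ, ← prod_const, ← prod_mul_distrib]
  exact prod_le_prod (fun i _ => by positivity) fun i _ => (h i).2

theorem boxAvg_mul_card {Y : ι → Finset V} (φ : (ι → V) → ℝ) :
    boxAvg Y φ * (piFinset Y).card = ∑ x ∈ piFinset Y, φ x := by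
  rw [mul_comm, boxAvg, Finset.card_mul_expect]

theorem exists_lower_regular (ε κ : ℝ) (hε : 0 < ε) (hε1 : ε ≤ 1) (hκ : 0 ≤ κ)
    (φ : (ι → V) → ℝ) (hφ : ∀ x, 0 ≤ φ x) (k : ℕ) : ∀ U : ι → Finset V, boxAvg U φ ≤ k * κ →
    ∃ X, SubBox (ε ^ k) X U ∧ ∀ Y, SubBox ε Y X → boxAvg X φ - κ ≤ boxAvg Y φ := by
  induction k with
  | zero =>
    intro U hU
    refine ⟨U, SubBox.refl U (by simp), fun Y _ => ?_⟩
    have h0 : 0 ≤ boxAvg Y φ := expect_nonneg fun x _ => hφ x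
    simp only [Nat.cast_zero, zero_mul] at hU
    linarith
  | succ k ih =>
    intro U hU
    by_cases h : ∀ Y, SubBox ε Y U → boxAvg U φ - κ ≤ boxAvg Y φ
    · exact ⟨U, SubBox.refl U (pow_le_one₀ hε.le hε1), h⟩
    · push Not at h
      obtain ⟨Y, hY, hlt⟩ := h
      obtain ⟨X, hX, hXr⟩ := ih Y (by push_cast at hU; linarith)
      exact ⟨X, by simpa [pow_succ] using hX.trans (by positivity) hY, hXr⟩

theorem boxAvg_le_of_lower_regular (ε ε' κ : ℝ) (hε : 0 < ε) (hε1 : ε ≤ 1) (hε' : 0 < ε')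
    (hεε : ε' ≤ ε) (hκ : 0 ≤ κ) (φ : (ι → V) → ℝ) (hφ : ∀ x, 0 ≤ φ x) (hφ1 : ∀ x, φ x ≤ 1)
    (X : ι → Finset V) (hne : ∀ i, (X i).Nonempty)
    (hX : ∀ Y, SubBox ε' Y X → boxAvg X φ - κ ≤ boxAvg Y φ)
    (Z : ι → Finset V) (hZ : SubBox ε Z X) :
    boxAvg Z φ ≤ boxAvg X φ + (κ + Fintype.card ι * ε') / ε ^ Fintype.card ι := by
  set ρ := boxAvg X φ with hρ
  have hXpos : (0 : ℝ) < (piFinset X).card := by exact_mod_cast (box_nonempty hne).card_pos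
  have hρ1 : ρ ≤ 1 := expect_le (box_nonempty hne) fun x _ => hφ1 x
  have key : ∀ J : Finset ι, (ρ - κ) * ((piFinset X).card - (piFinset (J.piecewise Z X)).card) -
      J.card * ε' * (piFinset X).card + ∑ x ∈ piFinset (J.piecewise Z X), φ x ≤
      ∑ x ∈ piFinset X, φ x := by
    intro J
    induction J using Finset.induction_on with
    | empty => simp
    | insert i J hi ih =>
      set Q := J.piecewise Z X with hQ
      have hQi : Q i = X i := by simp [hQ, hi]
      have hQX : ∀ j, Q j ⊆ X j := fun j => by
        by_cases hj : j ∈ J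
        · simpa [hQ, hj] using (hZ j).1
        · simp [hQ, hj]
      have hZi : Z i ⊆ Q i := hQi ▸ (hZ i).1
      have e : (insert i J).piecewise Z X = Function.update Q i (Z i) :=
        Finset.piecewise_insert _ _ _ _
      rw [e, Finset.card_insert_of_notMem hi]
      set W := Function.update Q i (Q i \ Z i) with hW
      have hs := sum_box_split i hZi φ
      have hc := sum_box_split i hZi fun _ => (1 : ℝ)
      simp only [sum_const, nsmul_eq_mul, mul_one] at hc
      rw [← hW] at hs hc
      have hWs : (ρ - κ) * (piFinset W).card - ε' * (piFinset X).card ≤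
          ∑ x ∈ piFinset W, φ x := by
        by_cases hbig : ε' * (X i).card ≤ ((Q i \ Z i).card : ℝ)
        · have hWX : SubBox ε' W X := by
            intro j
            by_cases hj : j = i
            · subst hj
              rw [hW, Function.update_self]
              exact ⟨sdiff_subset.trans (hQX _), hbig⟩
            · rw [hW, Function.update_of_ne hj]
              refine ⟨hQX j, ?_⟩
              by_cases hjJ : j ∈ J
              · simpa [hQ, hjJ] using ((hZ.mono hεε) j).2
              · simpa [hQ, hjJ] using (SubBox.refl X (hεε.trans hε1) j).2
          have h1 := hX W hWX
          rw [← boxAvg_mul_card]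
          have : (0 : ℝ) ≤ (piFinset W).card := Nat.cast_nonneg _
          nlinarith [mul_pos hε' hXpos]
        · have h1 : ((piFinset W).card : ℝ) * (X i).card ≤ ε' * (piFinset X).card * (X i).card := by
            have h2 : ((piFinset W).card : ℝ) * (X i).card =
                (Q i \ Z i).card * (piFinset Q).card := by
              rw [← hQi]
              exact_mod_cast card_box_update_mul Q i (Q i \ Z i)
            have h3 : ((piFinset Q).card : ℝ) ≤ (piFinset X).card := by
              exact_mod_cast Finset.card_le_card (piFinset_subset _ _ hQX)
            have h4 : (0 : ℝ) ≤ (piFinset Q).card := Nat.cast_nonneg _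
            rw [h2]
            calc ((Q i \ Z i).card : ℝ) * (piFinset Q).card ≤
                  (ε' * (X i).card) * (piFinset X).card := by
                  apply mul_le_mul (not_le.1 hbig).le h3 h4 (by positivity)
              _ = _ := by ring
          have hXi : (0 : ℝ) < (X i).card := by exact_mod_cast (hne i).card_pos
          have h5 := le_of_mul_le_mul_right h1 hXi
          have h6 : 0 ≤ ∑ x ∈ piFinset W, φ x := sum_nonneg fun x _ => hφ x
          have h7 : (0 : ℝ) ≤ (piFinset W).card := Nat.cast_nonneg _
          nlinarith
      push_cast
      rw [hs] at ih
      have : ((piFinset Q).card : ℝ) = (piFinset (Function.update Q i (Z i))).card +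
        (piFinset W).card := hc
      rw [this] at ih
      nlinarith
  have h := key univ
  simp only [piecewise_univ] at h
  rw [← boxAvg_mul_card, ← boxAvg_mul_card, ← hρ, card_univ] at h
  have hZc := hZ.card_le hε.le
  have hZpos : (0 : ℝ) < (piFinset Z).card := lt_of_lt_of_le (by positivity) hZc
  have hpow : 0 < ε ^ Fintype.card ι := by positivity
  have h1 : (κ + Fintype.card ι * ε') * (piFinset X).card ≤
      (κ + Fintype.card ι * ε') / ε ^ Fintype.card ι * (piFinset Z).card := by
    rw [div_mul_eq_mul_div, le_div_iff₀ hpow]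
    have : 0 ≤ κ + Fintype.card ι * ε' := by positivity
    nlinarith
  refine le_of_mul_le_mul_right ?_ hZpos
  have : 0 ≤ κ * (piFinset Z).card := by positivity
  nlinarith

/-- Any bounded function can be made two-sided regular on a sub-box of bounded relative size. -/
theorem exists_regular (ι : Type) [Fintype ι] [DecidableEq ι] (ε κ : ℝ) (hε : 0 < ε)
    (hε1 : ε ≤ 1) (hκ : 0 < κ) :
    ∃ σ : ℝ, 0 < σ ∧ σ ≤ 1 ∧ ∀ {V : Type} (φ : (ι → V) → ℝ), (∀ x, 0 ≤ φ x) → (∀ x, φ x ≤ 1) →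
      ∀ U : ι → Finset V, (∀ i, (U i).Nonempty) → ∃ X, SubBox σ X U ∧
        ∀ Y, SubBox ε Y X → boxAvg X φ - κ ≤ boxAvg Y φ ∧ boxAvg Y φ ≤ boxAvg X φ + κ := by
  set n := Fintype.card ι
  set κ' := κ * ε ^ n / 2 with hκ'
  set ε' := min ε (κ * ε ^ n / (2 * (n + 1))) with hε'
  have hκ'0 : 0 < κ' := by positivity
  have hε'0 : 0 < ε' := lt_min hε (by positivity)
  have hε'ε : ε' ≤ ε := min_le_left _ _
  have hpow : ε ^ n ≤ 1 := pow_le_one₀ hε.le hε1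
  obtain ⟨k, hk⟩ := exists_nat_ge (1 / κ')
  refine ⟨ε' ^ k, by positivity, pow_le_one₀ hε'0.le (hε'ε.trans hε1),
    fun {V} φ hφ hφ1 U hU => ?_⟩
  obtain ⟨X, hX, hXr⟩ := exists_lower_regular ε' κ' hε'0 (hε'ε.trans hε1) hκ'0.le φ hφ k U (by
    have : boxAvg U φ ≤ 1 := expect_le (box_nonempty hU) fun x _ => hφ1 x
    rw [div_le_iff₀ hκ'0] at hk
    linarith)
  have hXne := hX.nonempty (by positivity) hU
  refine ⟨X, hX, fun Y hY => ⟨?_, ?_⟩⟩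
  · have := hXr Y (hY.mono hε'ε)
    have : κ' ≤ κ := by rw [hκ']; nlinarith
    linarith
  · have := boxAvg_le_of_lower_regular ε ε' κ' hε hε1 hε'0 hε'ε hκ'0.le φ hφ hφ1 X hXne hXr Y hY
    refine this.trans ?_
    gcongr
    rw [div_le_iff₀ (by positivity)]
    have h1 : n * ε' ≤ κ * ε ^ n / 2 := by
      calc n * ε' ≤ (n + 1) * (κ * ε ^ n / (2 * (n + 1))) := by
            gcongr
            · linarith
            · exact min_le_right _ _
        _ = κ * ε ^ n / 2 := by field_simp
    rw [hκ']
    linarith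

/-- Simultaneous (lower) regularisation of finitely many functions. -/
theorem exists_regular_all (ι : Type) [Fintype ι] [DecidableEq ι] {τ : Type} (S : Finset τ)
    (ε κ : ℝ) (hε : 0 < ε) (hε1 : ε ≤ 1) (hκ : 0 < κ) :
    ∃ σ : ℝ, 0 < σ ∧ σ ≤ 1 ∧ ∀ {V : Type} (φ : τ → (ι → V) → ℝ), (∀ t x, 0 ≤ φ t x) →
      (∀ t x, φ t x ≤ 1) → ∀ U : ι → Finset V, (∀ i, (U i).Nonempty) → ∃ X, SubBox σ X U ∧
        ∀ t ∈ S, ∀ Y, SubBox ε Y X → boxAvg X (φ t) - κ ≤ boxAvg Y (φ t) := by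
  induction S using Finset.induction_on with
  | empty =>
    exact ⟨1, one_pos, le_rfl, fun φ _ _ U _ => ⟨U, SubBox.refl U le_rfl, by simp⟩⟩
  | insert t S ht ih =>
    obtain ⟨σ₂, h₂, h₂', hσ₂⟩ := ih
    obtain ⟨σ₁, h₁, h₁', hσ₁⟩ := exists_regular ι (ε * σ₂) (κ / 2) (by positivity)
      (mul_le_one₀ hε1 h₂.le h₂') (by positivity)
    refine ⟨σ₂ * σ₁, by positivity, mul_le_one₀ h₂' h₁.le h₁', fun {V} φ hφ hφ1 U hU => ?_⟩
    obtain ⟨X₁, hX₁, hr₁⟩ := hσ₁ (φ t) (hφ t) (hφ1 t) U hU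
    obtain ⟨X, hX, hr⟩ := hσ₂ φ hφ hφ1 X₁ (hX₁.nonempty h₁ hU)
    refine ⟨X, hX.trans h₂.le hX₁, fun u hu Y hY => ?_⟩
    rcases Finset.mem_insert.1 hu with rfl | hu
    · have h3 := (hr₁ Y (hY.trans hε.le hX)).1
      have h4 := (hr₁ X (hX.mono (mul_le_of_le_one_left h₂.le hε1))).2
      linarith
    · exact hr u hu Y hY

theorem exists_subset_expect_le {V : Type} (f : V → ℝ) {s : ℕ} (hs : 0 < s) (U : Finset V)
    (hU : s ≤ U.card) : ∃ A ⊆ U, A.card = s ∧ 𝔼 v ∈ A, f v ≤ 𝔼 v ∈ U, f v := by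
  induction U using Finset.strongInduction with
  | H U ih =>
    rcases hU.eq_or_lt with h | h
    · exact ⟨U, subset_rfl, h.symm, le_rfl⟩
    · have hne : U.Nonempty := card_pos.1 (hs.trans h)
      obtain ⟨v, hv, hmax⟩ := exists_max_image U f hne
      obtain ⟨A, hA, hAc, hAf⟩ := ih (U.erase v) (erase_ssubset hv)
        (by rw [card_erase_of_mem hv]; omega)
      refine ⟨A, hA.trans (erase_subset _ _), hAc, hAf.trans ?_⟩
      have hc : ((U.erase v).card : ℝ) = U.card - 1 := by
        rw [card_erase_of_mem hv, Nat.cast_sub (by omega)]; simp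
      have hs1 : (1 : ℝ) < U.card := by exact_mod_cast (by omega : 1 < U.card)
      have hsum : ∑ x ∈ U, f x = f v + ∑ x ∈ U.erase v, f x := (add_sum_erase U f hv).symm
      have hle : ∑ x ∈ U.erase v, f x ≤ (U.card - 1) * f v := by
        rw [← hc, ← nsmul_eq_mul]
        exact sum_le_card_nsmul _ _ _ fun x hx => hmax x (mem_of_mem_erase hx)
      rw [Finset.expect_eq_sum_div_card, Finset.expect_eq_sum_div_card, hc, hsum,
        div_le_div_iff₀ (by linarith) (by linarith)]
      nlinarith

/-- Sides can be shrunk to a common size without increasing the average. -/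
theorem exists_subbox_boxAvg_le {s : ℕ} (hs : 0 < s) (U : ι → Finset V)
    (hU : ∀ i, s ≤ (U i).card) (φ : (ι → V) → ℝ) :
    ∃ X : ι → Finset V, (∀ i, X i ⊆ U i ∧ (X i).card = s) ∧ boxAvg X φ ≤ boxAvg U φ := by
  suffices h : ∀ J : Finset ι, ∃ X : ι → Finset V, (∀ i, X i ⊆ U i) ∧ (∀ i ∈ J, (X i).card = s) ∧
      (∀ i ∉ J, X i = U i) ∧ boxAvg X φ ≤ boxAvg U φ by
    obtain ⟨X, h1, h2, -, h3⟩ := h univ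
    exact ⟨X, fun i => ⟨h1 i, h2 i (mem_univ i)⟩, h3⟩
  intro J
  induction J using Finset.induction_on with
  | empty => exact ⟨U, fun _ => subset_rfl, by simp, by simp, le_rfl⟩
  | insert i J hi ih =>
    obtain ⟨X, h1, h2, h3, h4⟩ := ih
    have hXne : ∀ j, (X j).Nonempty := fun j => by
      refine card_pos.1 (hs.trans_le ?_)
      by_cases hj : j ∈ J
      · exact (h2 j hj).ge
      · rw [h3 j hj]; exact hU j
    obtain ⟨A, hA, hAc, hAf⟩ := exists_subset_expect_le
      (fun v => boxAvg X fun y => φ (Function.update y i v)) hs (X i) (by rw [h3 i hi]; exact hU i)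
    refine ⟨Function.update X i A, fun j => ?_, fun j hj => ?_, fun j hj => ?_, ?_⟩
    · by_cases hj : j = i
      · subst hj; simpa using hA.trans (h1 j)
      · simpa [Function.update_of_ne hj] using h1 j
    · by_cases hji : j = i
      · subst hji; simpa using hAc
      · simpa [Function.update_of_ne hji] using h2 j ((mem_insert.1 hj).resolve_left hji)
    · rw [mem_insert, not_or] at hj
      simpa [Function.update_of_ne hj.1] using h3 j hj.2
    · rw [boxAvg_update hXne i (card_pos.1 (hAc ▸ hs))]
      exact hAf.trans ((boxAvg_resample_coord hXne i φ).symm.le.trans h4)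

theorem sum_compl_box_le (h : (ι → V) → ℝ) {b : ℝ} (J : Finset ι) : ∀ Y W : ι → Finset V,
    (∀ Q : ι → Finset V, (∀ i, Q i ⊆ Y i) → ∑ z ∈ piFinset Q, h z ≤ b) →
    ∑ z ∈ piFinset Y, (if ∀ i ∈ J, z i ∈ W i then 0 else h z) ≤ J.card * b := by
  induction J using Finset.induction_on with
  | empty => intro Y W _; simp
  | insert i J hi ih =>
    intro Y W hQ
    rw [sum_box_split i (inter_subset_left : Y i ∩ W i ⊆ Y i), card_insert_of_notMem hi]
    have hsub : ∀ A ⊆ Y i, ∀ j, Function.update Y i A j ⊆ Y j := fun A hA j => by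
      by_cases hj : j = i
      · subst hj; simpa using hA
      · simp [Function.update_of_ne hj]
    have h1 := ih (Function.update Y i (Y i ∩ W i)) W fun Q hQ' =>
      hQ Q fun j => (hQ' j).trans (hsub _ inter_subset_left j)
    have h2 := hQ (Function.update Y i (Y i \ (Y i ∩ W i))) (hsub _ sdiff_subset)
    have e1 : ∑ z ∈ piFinset (Function.update Y i (Y i ∩ W i)),
        (if ∀ j ∈ insert i J, z j ∈ W j then 0 else h z) =
        ∑ z ∈ piFinset (Function.update Y i (Y i ∩ W i)),
        (if ∀ j ∈ J, z j ∈ W j then 0 else h z) := by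
      refine sum_congr rfl fun z hz => ?_
      have hzi := mem_piFinset.1 hz i
      rw [Function.update_self, mem_inter] at hzi
      simp [hzi.2]
    have e2 : ∑ z ∈ piFinset (Function.update Y i (Y i \ (Y i ∩ W i))),
        (if ∀ j ∈ insert i J, z j ∈ W j then 0 else h z) =
        ∑ z ∈ piFinset (Function.update Y i (Y i \ (Y i ∩ W i))), h z := by
      refine sum_congr rfl fun z hz => ?_
      have hzi := mem_piFinset.1 hz i
      rw [Function.update_self, sdiff_inter_self_left, Finset.mem_sdiff] at hzi
      simp [hzi.2]
    rw [e1, e2]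
    push_cast
    linarith

theorem sum_pow_one_sub_le {α : Type} (P : Finset α) (hP : P.Nonempty) (W : α → ι → Finset V)
    (U : ι → Finset V) (hU : ∀ i, (U i).Nonempty) {c ε : ℝ} (hc1 : c ≤ 1) (hε : 0 < ε)
    (hW : ∀ Y, SubBox ε Y U →
      c ≤ 𝔼 p ∈ P, boxAvg Y fun z => if ∀ i, z i ∈ W p i then (1 : ℝ) else 0) (k : ℕ) :
    ∃ s : ℕ, s = (∑ j ∈ range k, Fintype.card ι ^ j) ∧ ∀ Y : ι → Finset V, (∀ i, Y i ⊆ U i) →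
      ∑ z ∈ piFinset Y, (1 - 𝔼 p ∈ P, if ∀ i, z i ∈ W p i then (1 : ℝ) else 0) ^ k ≤
        (1 - c) ^ k * (piFinset Y).card + s * ε * (piFinset U).card := by
  set g : (ι → V) → ℝ := fun z => 𝔼 p ∈ P, if ∀ i, z i ∈ W p i then (1 : ℝ) else 0 with hg
  have hg0 : ∀ z, 0 ≤ g z := fun z => expect_nonneg fun p _ => by split_ifs <;> norm_num
  have hg1 : ∀ z, g z ≤ 1 := fun z => expect_le hP fun p _ => by split_ifs <;> norm_num
  refine ⟨_, rfl, ?_⟩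
  induction k with
  | zero => intro Y _; simp
  | succ k ih =>
    intro Y hY
    set s := ∑ j ∈ range k, Fintype.card ι ^ j with hs
    have hs' : ∑ j ∈ range (k + 1), Fintype.card ι ^ j = Fintype.card ι * s + 1 := by
      rw [sum_range_succ', pow_zero, hs, mul_sum]
      simp [pow_succ, mul_comm]
    rw [hs']
    have hUpos : (0 : ℝ) ≤ (piFinset U).card := Nat.cast_nonneg _
    have hYpos : (0 : ℝ) ≤ (piFinset Y).card := Nat.cast_nonneg _
    by_cases hbig : SubBox ε Y U
    · have hYne := hbig.nonempty hε hU
      have h1 : ∀ z, (1 - g z) ^ (k + 1) =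
          𝔼 p ∈ P, if ∀ i, z i ∈ W p i then 0 else (1 - g z) ^ k := by
        intro z
        have : 1 - g z = 𝔼 p ∈ P, if ∀ i, z i ∈ W p i then (0 : ℝ) else 1 := by
          rw [hg, sub_eq_iff_eq_add, ← expect_add_distrib]
          rw [expect_congr rfl (g := fun _ => (1 : ℝ)), Finset.expect_const hP]
          intro p _
          split_ifs <;> simp
        rw [pow_succ]
        nth_rewrite 2 [this]
        rw [mul_expect]
        refine expect_congr rfl fun p _ => ?_
        split_ifs <;> simp
      have h2 : ∀ p ∈ P, ∑ z ∈ piFinset Y, (if ∀ i, z i ∈ W p i then 0 else (1 - g z) ^ k) ≤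
          (1 - c) ^ k * ((piFinset Y).card - ∑ z ∈ piFinset Y, if ∀ i, z i ∈ W p i then 1 else 0) +
            Fintype.card ι * (s * ε * (piFinset U).card) := by
        intro p _
        have h3 := sum_compl_box_le (fun z => (1 - g z) ^ k - (1 - c) ^ k)
          (b := s * ε * (piFinset U).card) univ Y (W p) (by
            intro Q hQ
            have := ih Q fun i => (hQ i).trans (hY i)
            rw [sum_sub_distrib, sum_const, nsmul_eq_mul]
            linarith)
        have h4 : ∑ z ∈ piFinset Y, (if ∀ i, z i ∈ W p i then 0 else (1 - g z) ^ k) =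
            ∑ z ∈ piFinset Y, (if ∀ i ∈ univ, z i ∈ W p i then 0
              else ((1 - g z) ^ k - (1 - c) ^ k)) +
            (1 - c) ^ k * ((piFinset Y).card -
              ∑ z ∈ piFinset Y, if ∀ i, z i ∈ W p i then 1 else 0) := by
          have : ((piFinset Y).card : ℝ) = ∑ z ∈ piFinset Y, 1 := by simp
          rw [this, ← sum_sub_distrib, mul_sum, ← sum_add_distrib]
          refine sum_congr rfl fun z _ => ?_
          by_cases hz : ∀ i, z i ∈ W p i <;> simp [hz]
        rw [h4]
        rw [card_univ] at h3
        linarith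
      have h5 : ∑ z ∈ piFinset Y, (1 - g z) ^ (k + 1) =
          𝔼 p ∈ P, ∑ z ∈ piFinset Y, (if ∀ i, z i ∈ W p i then 0 else (1 - g z) ^ k) := by
        rw [expect_sum_comm]
        exact sum_congr rfl fun z _ => h1 z
      rw [h5]
      refine (expect_le_expect h2).trans ?_
      rw [expect_add_distrib, Finset.expect_const hP, ← mul_expect, expect_sub_distrib,
        Finset.expect_const hP]
      have h6 : c * (piFinset Y).card ≤
          𝔼 p ∈ P, ∑ z ∈ piFinset Y, if ∀ i, z i ∈ W p i then (1 : ℝ) else 0 := by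
        have := hW Y hbig
        calc c * (piFinset Y).card ≤ (𝔼 p ∈ P, boxAvg Y fun z =>
              if ∀ i, z i ∈ W p i then (1 : ℝ) else 0) * (piFinset Y).card := by gcongr
          _ = _ := by
              rw [expect_mul]
              exact expect_congr rfl fun p _ => boxAvg_mul_card _
      have h7 : (0 : ℝ) ≤ (1 - c) ^ k := pow_nonneg (by linarith) _
      have h8 : 0 ≤ ε * (piFinset U).card := by positivity
      push_cast
      rw [pow_succ]
      nlinarith
    · have h1 : ((piFinset Y).card : ℝ) ≤ ε * (piFinset U).card := by
        simp only [SubBox, not_forall] at hbig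
        obtain ⟨i, hi⟩ := hbig
        have hi' : ((Y i).card : ℝ) < ε * (U i).card := by
          by_contra hcon
          exact hi ⟨hY i, not_lt.1 hcon⟩
        have h2 : ((piFinset Y).card : ℝ) ≤ (piFinset (Function.update U i (Y i))).card := by
          refine Nat.cast_le.2 (card_le_card (piFinset_subset _ _ fun j => ?_))
          by_cases hj : j = i
          · subst hj; simp
          · simpa [Function.update_of_ne hj] using hY j
        have h3 : ((piFinset (Function.update U i (Y i))).card : ℝ) * (U i).card =
            (Y i).card * (piFinset U).card := by
          exact_mod_cast card_box_update_mul U i (Y i)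
        have h4 : (0 : ℝ) < (U i).card := by exact_mod_cast (hU i).card_pos
        refine le_of_mul_le_mul_right (a := ((U i).card : ℝ)) ?_ h4
        nlinarith
      have h2 : ∑ z ∈ piFinset Y, (1 - g z) ^ (k + 1) ≤ (piFinset Y).card := by
        rw [← nsmul_one, ← sum_const]
        exact sum_le_sum fun z _ => pow_le_one₀ (by linarith [hg1 z]) (by linarith [hg0 z])
      have h3 : 0 ≤ (1 - c) ^ (k + 1) * (piFinset Y).card :=
        mul_nonneg (pow_nonneg (by linarith) _) hYpos
      have h4 : 0 ≤ Fintype.card ι * s * ε * (piFinset U).card := by positivity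
      push_cast
      linarith

/-- If a family of boxes covers all large boxes with average density `c`, then almost every point
is covered with density at least `c / 2`. -/
theorem exists_card_low_cover_le (ι : Type) [Fintype ι] [DecidableEq ι] (c κ : ℝ) (hc : 0 < c)
    (hc1 : c ≤ 1) (hκ : 0 < κ) : ∃ ε : ℝ, 0 < ε ∧ ∀ {α V : Type} (P : Finset α),
      P.Nonempty → ∀ (W : α → ι → Finset V) (U : ι → Finset V), (∀ i, (U i).Nonempty) →
      (∀ Y, SubBox ε Y U →
        c ≤ 𝔼 p ∈ P, boxAvg Y fun z => if ∀ i, z i ∈ W p i then (1 : ℝ) else 0) →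
      (((piFinset U).filter fun z =>
        (𝔼 p ∈ P, if ∀ i, z i ∈ W p i then (1 : ℝ) else 0) < c / 2).card : ℝ) ≤
        κ * (piFinset U).card := by
  have hc2 : 0 < 1 - c / 2 := by linarith
  obtain ⟨k, hk⟩ := exists_pow_lt_of_lt_one (half_pos hκ) (by linarith : 1 - c / 2 < 1)
  set s := ∑ j ∈ range k, Fintype.card ι ^ j with hs
  refine ⟨κ / 2 * (1 - c / 2) ^ k / (s + 1), by positivity, fun P hP W U hU hW => ?_⟩
  obtain ⟨_, rfl, h⟩ := sum_pow_one_sub_le P hP W U hU hc1 (by positivity) hW k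
  have h := h U fun _ => subset_rfl
  set g := fun z : ι → _ => 𝔼 p ∈ P, if ∀ i, z i ∈ W p i then (1 : ℝ) else 0 with hg
  have hg1 : ∀ z, g z ≤ 1 := fun z => expect_le hP fun p _ => by split_ifs <;> norm_num
  have h1 : (1 - c / 2) ^ k * ((piFinset U).filter fun z => g z < c / 2).card ≤
      ∑ z ∈ piFinset U, (1 - g z) ^ k := by
    rw [mul_comm, ← nsmul_eq_mul, ← sum_const]
    refine le_trans (sum_le_sum fun z hz => ?_) (sum_le_sum_of_subset_of_nonneg
      (filter_subset _ _) fun z _ _ => pow_nonneg (by linarith [hg1 z]) _)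
    exact pow_le_pow_left₀ hc2.le (by linarith [(mem_filter.1 hz).2]) _
  have h2 : (1 - c) ^ k ≤ (1 - c / 2) ^ k * (κ / 2) := by
    calc (1 - c) ^ k ≤ ((1 - c / 2) * (1 - c / 2)) ^ k :=
          pow_le_pow_left₀ (by linarith) (by nlinarith) _
      _ = (1 - c / 2) ^ k * (1 - c / 2) ^ k := mul_pow _ _ _
      _ ≤ _ := by gcongr
  have h3 : (s : ℝ) * (κ / 2 * (1 - c / 2) ^ k / (s + 1)) ≤ (1 - c / 2) ^ k * (κ / 2) := by
    rw [mul_div_assoc', div_le_iff₀ (by positivity)]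
    have : 0 < (1 - c / 2) ^ k * (κ / 2) := by positivity
    nlinarith
  have hpos : 0 < (1 - c / 2) ^ k := by positivity
  have hUpos : (0 : ℝ) ≤ (piFinset U).card := Nat.cast_nonneg _
  refine le_of_mul_le_mul_left (h1.trans (h.trans ?_)) hpos
  nlinarith

theorem boxAvg_prescribed (S R : Finset ι) (hSR : Disjoint S R) (U : ι → Finset V)
    (W : (ι → V) → ι → Finset V) (hdep : ∀ x y : ι → V, (∀ i ∈ S, x i = y i) → W x = W y)
    (hout : ∀ x, ∀ i ∉ R, W x i = U i) {Y₁ Y₂ : ι → Finset V}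
    (hY₁ : ∀ i, (Y₁ i).Nonempty) (hY₂ : ∀ i, (Y₂ i).Nonempty) (h₁ : ∀ i, Y₁ i ⊆ U i)
    (h₂ : ∀ i, Y₂ i ⊆ U i) :
    boxAvg (R.piecewise Y₂ Y₁) (fun x => if ∀ i, x i ∈ W x i then (1 : ℝ) else 0) =
      boxAvg Y₁ fun y => boxAvg Y₂ fun z => if ∀ i, z i ∈ W y i then (1 : ℝ) else 0 := by
  rw [boxAvg_piecewise R hY₁ hY₂]
  refine expect_congr rfl fun y hy => expect_congr rfl fun z hz => ?_
  have hWy : W (R.piecewise z y) = W y := hdep _ _ fun i hi =>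
    Finset.piecewise_eq_of_notMem _ _ _ (Finset.disjoint_left.1 hSR hi)
  rw [hWy]
  congr 1
  refine propext (forall_congr' fun i => ?_)
  by_cases hi : i ∈ R
  · simp [hi]
  · simp [hi, hout _ i hi, h₁ i (mem_piFinset.1 hy i), h₂ i (mem_piFinset.1 hz i)]

theorem card_filter_ge_of_expect {α : Type} (P : Finset α) (m : α → ℝ) (hm : ∀ p ∈ P, m p ≤ 1)
    {c : ℝ} (hc : 0 ≤ c) (h : c ≤ 𝔼 p ∈ P, m p) :
    c / 2 * P.card ≤ ((P.filter fun p => c / 2 ≤ m p).card : ℝ) := by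
  rcases P.eq_empty_or_nonempty with rfl | hP
  · simp
  have hPpos : (0 : ℝ) < P.card := by exact_mod_cast hP.card_pos
  rw [Finset.expect_eq_sum_div_card, le_div_iff₀ hPpos] at h
  have h1 : ∑ p ∈ P, m p ≤ ∑ p ∈ P, ((if c / 2 ≤ m p then 1 else 0) + c / 2) := by
    refine sum_le_sum fun p hp => ?_
    split_ifs with hcp
    · linarith [hm p hp]
    · linarith
  rw [sum_add_distrib, sum_boole, sum_const, nsmul_eq_mul] at h1
  linarith

/-- Three cyclically arranged families of prescribed boxes have a common solution. -/
theorem exists_cyclic_solution (ι : Type) [Fintype ι] [DecidableEq ι] (c : ℝ) (hc : 0 < c)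
    (hc1 : c ≤ 1) : ∃ ε : ℝ, 0 < ε ∧ ε ≤ 1 ∧ ∀ {V : Type} (U : ι → Finset V),
      (∀ i, (U i).Nonempty) → ∀ (S : Fin 3 → Finset ι) (W : Fin 3 → (ι → V) → ι → Finset V),
      (∀ κ, Disjoint (S κ) (S (κ + 1))) → (∀ κ x i, W κ x i ⊆ U i) →
      (∀ κ x y, (∀ i ∈ S κ, x i = y i) → W κ x = W κ y) →
      (∀ κ x, ∀ i ∉ S (κ + 1), W κ x i = U i) →
      (∀ κ, ∀ Y, SubBox ε Y U →
        c ≤ boxAvg Y fun x => if ∀ i, x i ∈ W κ x i then (1 : ℝ) else 0) →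
      ∃ x ∈ piFinset U, ∀ κ i, x i ∈ W κ x i := by
  obtain ⟨ε₀, hε₀, H⟩ := exists_card_low_cover_le ι c (c / 4) hc hc1 (by positivity)
  refine ⟨min ε₀ (c / 2), lt_min hε₀ (by positivity), (min_le_right _ _).trans (by linarith),
    fun {V} U hU S W hdisj hsub hdep hout hW => ?_⟩
  set ε := min ε₀ (c / 2) with hε
  have hεpos : 0 < ε := lt_min hε₀ (by positivity)
  have hε1 : ε ≤ 1 := (min_le_right _ _).trans (by linarith)
  have fact : ∀ κ, ∀ Y₁ Y₂, SubBox ε Y₁ U → SubBox ε Y₂ U →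
      c ≤ boxAvg Y₁ fun y => boxAvg Y₂ fun z => if ∀ i, z i ∈ W κ y i then (1 : ℝ) else 0 := by
    intro κ Y₁ Y₂ h₁ h₂
    rw [← boxAvg_prescribed (S κ) (S (κ + 1)) (hdisj κ) U (W κ) (hdep κ) (hout κ)
      (h₁.nonempty hεpos hU) (h₂.nonempty hεpos hU) (fun i => (h₁ i).1) (fun i => (h₂ i).1)]
    exact hW κ _ (h₁.piecewise _ h₂)
  have hUU : SubBox ε U U := SubBox.refl U hε1
  have hUpos : (0 : ℝ) < (piFinset U).card := by exact_mod_cast (box_nonempty hU).card_pos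
  have hG := card_filter_ge_of_expect (piFinset U)
    (fun y => boxAvg U fun z => if ∀ i, z i ∈ W 2 y i then (1 : ℝ) else 0)
    (fun y _ => expect_le (box_nonempty hU) fun z _ => by split_ifs <;> norm_num)
    hc.le (fact 2 U U hUU hUU)
  have hL := H (piFinset U) (box_nonempty hU) (W 1) U hU fun Y hY =>
    fact 1 U Y hUU (hY.mono (min_le_left _ _))
  obtain ⟨x₂, hx₂, hx₂G, hx₂L⟩ : ∃ x ∈ piFinset U,
      (c / 2 ≤ boxAvg U fun z => if ∀ i, z i ∈ W 2 x i then (1 : ℝ) else 0) ∧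
      c / 2 ≤ 𝔼 p ∈ piFinset U, if ∀ i, x i ∈ W 1 p i then (1 : ℝ) else 0 := by
    by_contra! hcon
    have h1 := hG.trans ((Nat.cast_le (α := ℝ).2 (card_le_card fun x hx =>
      mem_filter.2 ⟨(mem_filter.1 hx).1,
        hcon x (mem_filter.1 hx).1 (mem_filter.1 hx).2⟩)).trans hL)
    nlinarith
  set X := W 2 x₂ with hX
  have hXU : SubBox ε X U := by
    refine fun i => ⟨hsub 2 x₂ i, ?_⟩
    have h1 : c / 2 * (piFinset U).card ≤ ((piFinset X).card : ℝ) := by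
      have h2 := mul_le_mul_of_nonneg_right hx₂G hUpos.le
      rw [boxAvg_mul_card, sum_boole] at h2
      refine h2.trans (Nat.cast_le.2 (card_le_card fun z hz => ?_))
      exact mem_piFinset.2 (mem_filter.1 hz).2
    have h2 : ((piFinset X).card : ℝ) ≤ (piFinset (Function.update U i (X i))).card := by
      refine Nat.cast_le.2 (card_le_card (piFinset_subset _ _ fun j => ?_))
      by_cases hj : j = i
      · subst hj; simp
      · simpa [Function.update_of_ne hj] using hsub 2 x₂ j
    have h3 : ((piFinset (Function.update U i (X i))).card : ℝ) * (U i).card =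
        (X i).card * (piFinset U).card := by
      exact_mod_cast card_box_update_mul U i (X i)
    have h4 : (0 : ℝ) < (U i).card := by exact_mod_cast (hU i).card_pos
    have h5 : ε ≤ c / 2 := min_le_right _ _
    refine le_of_mul_le_mul_right (a := ((piFinset U).card : ℝ)) ?_ hUpos
    rw [← h3]
    calc ε * (U i).card * (piFinset U).card ≤ c / 2 * (U i).card * (piFinset U).card := by gcongr
      _ = c / 2 * (piFinset U).card * (U i).card := by ring
      _ ≤ _ := by gcongr; exact h1.trans h2
  have hXne := hXU.nonempty hεpos hU
  have hL₀ := H (piFinset X) (box_nonempty hXne) (W 0) U hU fun Y hY =>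
    fact 0 X Y hXU (hY.mono (min_le_left _ _))
  obtain ⟨x₁, hx₁, hx₁U, hx₁L⟩ : ∃ x ∈ piFinset U, (∀ i, x₂ i ∈ W 1 x i) ∧
      c / 2 ≤ 𝔼 p ∈ piFinset X, if ∀ i, x i ∈ W 0 p i then (1 : ℝ) else 0 := by
    by_contra! hcon
    have h1 := mul_le_mul_of_nonneg_right hx₂L hUpos.le
    rw [boxAvg_mul_card, sum_boole] at h1
    have h2 := Nat.cast_le (α := ℝ).2 (card_le_card (s := (piFinset U).filter
      fun x => ∀ i, x₂ i ∈ W 1 x i) fun x hx => mem_filter.2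
        ⟨(mem_filter.1 hx).1, hcon x (mem_filter.1 hx).1 (mem_filter.1 hx).2⟩)
    nlinarith
  obtain ⟨x₀, hx₀, hx₀W⟩ : ∃ x ∈ piFinset X, ∀ i, x₁ i ∈ W 0 x i := by
    by_contra! hcon
    rw [expect_eq_zero fun p hp => if_neg (by push Not; exact hcon p hp)] at hx₁L
    linarith
  have hx₀U : ∀ i, x₀ i ∈ U i := fun i => hsub 2 x₂ i (mem_piFinset.1 hx₀ i)
  have d0 : Disjoint (S 0) (S 1) := hdisj 0
  have d1 : Disjoint (S 1) (S 2) := hdisj 1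
  have d2 : Disjoint (S 2) (S 0) := hdisj 2
  set x : ι → V := (S 0).piecewise x₀ ((S 1).piecewise x₁ x₂) with hx
  have e0 : ∀ i ∈ S 0, x i = x₀ i := fun i hi => by simp [hx, hi]
  have e1 : ∀ i ∈ S 1, x i = x₁ i := fun i hi => by
    simp [hx, hi, Finset.disjoint_right.1 d0 hi]
  have e2 : ∀ i ∈ S 2, x i = x₂ i := fun i hi => by
    simp [hx, Finset.disjoint_right.1 d1 hi, Finset.disjoint_left.1 d2 hi]
  have hxU : ∀ i, x i ∈ U i := fun i => by
    by_cases h0 : i ∈ S 0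
    · rw [e0 i h0]; exact hx₀U i
    by_cases h1 : i ∈ S 1
    · rw [e1 i h1]; exact mem_piFinset.1 hx₁ i
    · simpa [hx, h0, h1] using mem_piFinset.1 hx₂ i
  refine ⟨x, mem_piFinset.2 hxU, fun κ i => ?_⟩
  fin_cases κ
  · change x i ∈ W 0 x i
    rw [hdep 0 x x₀ e0]
    by_cases hi : i ∈ S 1
    · rw [e1 i hi]; exact hx₀W i
    · rw [hout 0 _ i hi]; exact hxU i
  · change x i ∈ W 1 x i
    rw [hdep 1 x x₁ e1]
    by_cases hi : i ∈ S 2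
    · rw [e2 i hi]; exact hx₁U i
    · rw [hout 1 _ i hi]; exact hxU i
  · change x i ∈ W 2 x i
    rw [hdep 2 x x₂ e2]
    by_cases hi : i ∈ S 0
    · rw [e0 i hi]; exact mem_piFinset.1 hx₀ i
    · rw [hout 2 _ i hi]; exact hxU i

/-- `φ` has average at least `c` on every sub-box of `X` of relative size at least `ε`. -/
def HeredDense (ε c : ℝ) (X : ι → Finset V) (φ : (ι → V) → ℝ) : Prop :=
  ∀ Y, SubBox ε Y X → c ≤ boxAvg Y φ

theorem HeredDense.subBox {ε δ ε' c : ℝ} {X Z : ι → Finset V} {φ : (ι → V) → ℝ}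
    (h : HeredDense ε c X φ) (hδ : 0 ≤ ε') (hZ : SubBox δ Z X) (hε : ε ≤ ε' * δ) :
    HeredDense ε' c Z φ := fun Y hY => h Y ((hY.trans hδ hZ).mono hε)

theorem boxAvg_ge_of_subBox {X Y : ι → Finset V} {β : ℝ} (hβ : 0 < β)
    (hX : ∀ i, (X i).Nonempty) (h : SubBox β Y X) {φ : (ι → V) → ℝ} (hφ : ∀ x, 0 ≤ φ x) :
    β ^ card ι * boxAvg Y φ ≤ boxAvg X φ := by
  have hXpos : (0 : ℝ) < (piFinset X).card := by exact_mod_cast (box_nonempty hX).card_pos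
  have h0 : 0 ≤ boxAvg Y φ := expect_nonneg fun x _ => hφ x
  refine le_of_mul_le_mul_right (a := ((piFinset X).card : ℝ)) ?_ hXpos
  rw [boxAvg_mul_card φ]
  calc β ^ card ι * boxAvg Y φ * (piFinset X).card
      = boxAvg Y φ * (β ^ card ι * (piFinset X).card) := by ring
    _ ≤ boxAvg Y φ * (piFinset Y).card := by gcongr; exact h.card_le hβ.le
    _ = ∑ x ∈ piFinset Y, φ x := boxAvg_mul_card φ
    _ ≤ _ := sum_le_sum_of_subset_of_nonneg (piFinset_subset _ _ fun i => (h i).1)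
        fun x _ _ => hφ x

/-- In a box where few vertices of side `i` have small degree to side `j`. -/
theorem card_low_degree_lt {X : ι → Finset V} (hX : ∀ i, (X i).Nonempty) {i j : ι} (hij : i ≠ j)
    (Γ : V → V → Prop) {ε β : ℝ} (hε : 0 < ε) (hε1 : ε ≤ 1)
    (h : HeredDense ε β X fun y => if Γ (y i) (y j) then 1 else 0) :
    ((X i).filter fun a => (((X j).filter (Γ a)).card : ℝ) < β * (X j).card).card ≤
      ε * (X i).card := by
  set Bad := (X i).filter fun a => (((X j).filter (Γ a)).card : ℝ) < β * (X j).card with hBad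
  by_contra! hcon
  have hXi : (0 : ℝ) < (X i).card := by exact_mod_cast (hX i).card_pos
  have hXj : (0 : ℝ) < (X j).card := by exact_mod_cast (hX j).card_pos
  have hne : Bad.Nonempty := by
    rw [← card_pos]
    exact_mod_cast (by positivity : (0 : ℝ) < ε * (X i).card).trans hcon
  have hY : SubBox ε (Function.update X i Bad) X := fun k => by
    by_cases hk : k = i
    · subst hk
      simpa using ⟨filter_subset _ _, hcon.le⟩
    · simpa [Function.update_of_ne hk] using mul_le_of_le_one_left (Nat.cast_nonneg _) hε1
  have h1 := h _ hY
  rw [boxAvg_update hX i hne] at h1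
  have h2 : ∀ v ∈ Bad, boxAvg X (fun y => if Γ (Function.update y i v i)
      (Function.update y i v j) then (1 : ℝ) else 0) < β := by
    intro v hv
    simp only [Function.update_self, Function.update_of_ne hij.symm]
    rw [boxAvg_coord hX j fun w => if Γ v w then (1 : ℝ) else 0, Finset.expect_eq_sum_div_card,
      sum_boole, div_lt_iff₀ hXj]
    exact (mem_filter.1 hv).2
  rw [Finset.expect_eq_sum_div_card,
    le_div_iff₀ (by exact_mod_cast hne.card_pos : (0 : ℝ) < Bad.card)] at h1
  have h3 := sum_lt_sum_of_nonempty hne h2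
  rw [sum_const, nsmul_eq_mul] at h3
  linarith

/-- Counting lemma for cliques: if all pairs of sides are hereditarily dense then the density of
cliques is bounded below. -/
theorem exists_clique_count (ι : Type) [Fintype ι] [DecidableEq ι] (β : ℝ) (hβ : 0 < β)
    (hβ1 : β ≤ 1) (k : ℕ) :
    ∃ ε c : ℝ, 0 < ε ∧ ε ≤ 1 ∧ 0 < c ∧ ∀ {V : Type} (l : List ι), l.length = k → l.Nodup →
      ∀ (X : ι → Finset V), (∀ i, (X i).Nonempty) → ∀ Γ : ι → ι → V → V → Prop,
      (l.Pairwise fun i j => HeredDense ε β X fun y => if Γ i j (y i) (y j) then 1 else 0) →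
      c ≤ boxAvg X fun x => if l.Pairwise fun i j => Γ i j (x i) (x j) then 1 else 0 := by
  induction k with
  | zero =>
    refine ⟨1, 1, one_pos, le_rfl, one_pos, fun l hl _ X hX Γ _ => ?_⟩
    rw [List.length_eq_zero_iff.1 hl]
    simp [boxAvg_const hX]
  | succ k ih =>
    obtain ⟨ε', c', hε', hε'1, hc', ih⟩ := ih
    refine ⟨min (ε' * β) (1 / (2 * (k + 1))), c' * β ^ card ι / 2, by positivity,
      (min_le_left _ _).trans (mul_le_one₀ hε'1 hβ.le hβ1), by positivity,
      fun {V} l hl hnd X hX Γ hΓ => ?_⟩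
    set ε := min (ε' * β) (1 / (2 * ((k : ℝ) + 1))) with hε
    have hεpos : 0 < ε := by positivity
    have hε1 : ε ≤ 1 := (min_le_left _ _).trans (mul_le_one₀ hε'1 hβ.le hβ1)
    obtain ⟨i₀, l, rfl⟩ := List.exists_cons_of_length_eq_add_one hl
    rw [List.pairwise_cons] at hΓ
    rw [List.nodup_cons] at hnd
    rw [List.length_cons, add_left_inj] at hl
    set bad := fun j => (X i₀).filter fun a =>
      (((X j).filter (Γ i₀ j a)).card : ℝ) < β * (X j).card with hbad
    set Bad := l.toFinset.biUnion bad with hBad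
    have hXi : (0 : ℝ) < (X i₀).card := by exact_mod_cast (hX i₀).card_pos
    have hBadc : (Bad.card : ℝ) ≤ (X i₀).card / 2 := by
      have h1 : (Bad.card : ℝ) ≤ ∑ j ∈ l.toFinset, ((bad j).card : ℝ) := by
        exact_mod_cast card_biUnion_le
      have h2 : ∑ j ∈ l.toFinset, ((bad j).card : ℝ) ≤ ∑ j ∈ l.toFinset, ε * (X i₀).card :=
        sum_le_sum fun j hj => card_low_degree_lt hX
          (fun h => hnd.1 (by rw [h]; exact List.mem_toFinset.1 hj)) _ hεpos hε1
          (hΓ.1 j (List.mem_toFinset.1 hj))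
      rw [sum_const, nsmul_eq_mul, List.toFinset_card_of_nodup hnd.2, hl] at h2
      have h3 : (k : ℝ) * ε ≤ 1 / 2 := by
        calc (k : ℝ) * ε ≤ (k + 1) * (1 / (2 * ((k : ℝ) + 1))) := by
              gcongr
              · linarith
              · exact min_le_right _ _
          _ = 1 / 2 := by field_simp
      nlinarith
    rw [boxAvg_resample_coord hX i₀]
    have hgood : ∀ a ∈ X i₀, (if a ∈ Bad then 0 else c' * β ^ card ι) ≤
        boxAvg X fun y => if (i₀ :: l).Pairwise fun i j => Γ i j (Function.update y i₀ a i)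
          (Function.update y i₀ a j) then (1 : ℝ) else 0 := by
      intro a ha
      split_ifs with haB
      · exact expect_nonneg fun x _ => by split_ifs <;> norm_num
      set Y : ι → Finset V := fun j => if j ∈ l then (X j).filter (Γ i₀ j a) else X j with hY
      have hYX : SubBox β Y X := fun j => by
        by_cases hj : j ∈ l
        · simp only [hY, hj, if_true]
          refine ⟨filter_subset _ _, ?_⟩
          by_contra! hcon
          exact haB (mem_biUnion.2 ⟨j, List.mem_toFinset.2 hj, mem_filter.2 ⟨ha, hcon⟩⟩)
        · simpa [hY, hj] using mul_le_of_le_one_left (Nat.cast_nonneg _) hβ1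
      have h1 := ih l hl hnd.2 Y (hYX.nonempty hβ hX) Γ (hΓ.2.imp fun h =>
        h.subBox hε'.le hYX (min_le_left _ _))
      refine le_trans ?_ (boxAvg_ge_of_subBox hβ hX hYX fun x => by split_ifs <;> norm_num)
      rw [mul_comm]
      gcongr
      refine h1.trans (expect_le_expect fun y hy => ?_)
      split_ifs with h2 h3
      · exact le_rfl
      · refine absurd (List.pairwise_cons.2 ⟨fun j hj => ?_, ?_⟩) h3
        · have hji : j ≠ i₀ := fun h => hnd.1 (h ▸ hj)
          have := mem_piFinset.1 hy j
          simp only [hY, hj, if_true] at this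
          rw [Function.update_self, Function.update_of_ne hji]
          exact (mem_filter.1 this).2
        · refine h2.imp_of_mem fun {i j} hi hj h => ?_
          rwa [Function.update_of_ne fun e => hnd.1 (by rwa [e] at hi),
            Function.update_of_ne fun e => hnd.1 (by rwa [e] at hj)]
      · norm_num
      · norm_num
    refine le_trans ?_ (expect_le_expect hgood)
    rw [Finset.expect_eq_sum_div_card, le_div_iff₀ hXi]
    have h4 : ∑ a ∈ X i₀, (if a ∈ Bad then 0 else c' * β ^ card ι) =
        (((X i₀).card : ℝ) - Bad.card) * (c' * β ^ card ι) := by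
      rw [← sum_filter_add_sum_filter_not (X i₀) (· ∈ Bad)]
      have hsub : Bad ⊆ X i₀ := biUnion_subset.2 fun j _ => filter_subset _ _
      rw [Finset.sum_congr rfl fun a ha => if_pos (mem_filter.1 ha).2,
        Finset.sum_congr rfl fun a ha => if_neg (mem_filter.1 ha).2, filter_notMem_eq_sdiff]
      simp [card_sdiff_of_subset hsub, Nat.cast_sub (card_le_card hsub)]
    rw [h4]
    have : 0 < c' * β ^ card ι := by positivity
    nlinarith
theorem boxAvg_forall_mem {X : ι → Finset V} (hX : ∀ i, (X i).Nonempty) (S : Finset ι)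
    (R : (ι → V) → ι → V → Prop) (hR : ∀ x y : ι → V, (∀ i ∉ S, x i = y i) → R x = R y)
    (P : (ι → V) → Prop) (hP : ∀ x, P x ↔ ∀ j ∈ S, R x j (x j)) :
    boxAvg X (fun x => if P x then (1 : ℝ) else 0) =
      boxAvg X fun x => ∏ j ∈ S, 𝔼 v ∈ X j, if R x j v then (1 : ℝ) else 0 := by
  rw [boxAvg_resample S hX]
  refine expect_congr rfl fun y _ => ?_
  rw [← boxAvg_prod_mem hX S fun j v => if R y j v then (1 : ℝ) else 0]
  refine expect_congr rfl fun z _ => ?_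
  have hRy : R (S.piecewise z y) = R y :=
    hR _ _ fun i hi => Finset.piecewise_eq_of_notMem _ _ _ hi
  have key : P (S.piecewise z y) ↔ ∀ j ∈ S, R y j (z j) := (hP _).trans
    (forall₂_congr fun j hj => by rw [hRy, Finset.piecewise_eq_of_mem _ _ _ hj])
  by_cases h : P (S.piecewise z y)
  · rw [if_pos h, Finset.prod_eq_one fun j hj => if_pos (key.1 h j hj)]
  · rw [if_neg h]
    obtain ⟨j, hj, hjR⟩ : ∃ j ∈ S, ¬R y j (z j) := by
      by_contra! hc
      exact h (key.2 hc)
    exact (Finset.prod_eq_zero hj (if_neg hjR)).symm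

/-- The vertex `x j`, for `j` in `l'`, realises the corresponding word of `ws` over the vertices
indexed by `l`. -/
def PatternHolds (E : V → V → V → Prop) (ws : List (List Bool)) (l l' : List ι) (x : ι → V) :
    Prop :=
  ∀ p ∈ ws.zip l', WordRel p.1 l fun i i' => E (x i) (x i') (x p.2)

theorem mem_of_mem_zip_replicate {α β : Type} {a : α} {m : ℕ} {l : List β} {p : α × β}
    (h : p ∈ (List.replicate m a).zip l) : p.1 = a ∧ p.2 ∈ l :=
  ⟨List.eq_of_mem_replicate (List.of_mem_zip h).1, (List.of_mem_zip h).2⟩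

theorem mem_zip_replicate {α β : Type} {a : α} {m : ℕ} {l : List β} (hl : l.length ≤ m) {b : β}
    (hb : b ∈ l) : (a, b) ∈ (List.replicate m a).zip l := by
  obtain ⟨i, hi, rfl⟩ := List.getElem_of_mem hb
  refine List.mem_iff_getElem.2 ⟨i, by simp; omega, by simp⟩

theorem patternHolds_book {κ V : Type} {E : V → V → V → Prop} {m : ℕ} {a a' : κ} {l : List κ}
    (hl : l.length ≤ m) {x : κ → V} :
    PatternHolds E (List.replicate m [true, false]) [a, a'] l x ↔
      ∀ j ∈ l, E (x a) (x a') (x j) := by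
  constructor
  · intro h j hj
    simpa [WordRel] using h _ (mem_zip_replicate hl hj)
  · intro h p hp
    obtain ⟨h1, h2⟩ := mem_of_mem_zip_replicate hp
    rw [h1]
    simpa [WordRel] using h _ h2

/-- If many triples containing a given pair are dense, then some book over that pair is dense. -/
theorem exists_book_dense (δ : ℝ) (hδ : 0 < δ) (m : ℕ) : ∃ K : ℕ, ∃ β : ℝ, 0 < β ∧
    ∀ {ι V : Type} [Fintype ι] [DecidableEq ι] (E : V → V → V → Prop) (X : ι → Finset V),
      (∀ i, (X i).Nonempty) → ∀ (a a' : ι) (js : List ι), js.length = K → js.Nodup → a ∉ js →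
      a' ∉ js → (∀ j ∈ js, δ ≤ boxAvg X fun x => if E (x a) (x a') (x j) then 1 else 0) →
      ∃ l : List ι, l.Sublist js ∧ l.length = m ∧ β ≤ boxAvg X fun x =>
        if PatternHolds E (List.replicate m [true, false]) [a, a'] l x then 1 else 0 := by
  obtain ⟨K, γ, hγ, hK⟩ := exists_large_inter (δ / 2) (half_pos hδ) m
  refine ⟨K, γ * (δ / 2) ^ m, by positivity,
    fun {ι V} _ _ E X hX a a' js hjs hnd ha ha' h => ?_⟩
  subst hjs
  have hXpos : (0 : ℝ) < (piFinset X).card := by exact_mod_cast (box_nonempty hX).card_pos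
  set f : (ι → V) → ι → ℝ := fun x j => 𝔼 v ∈ X j, if E (x a) (x a') v then (1 : ℝ) else 0 with hf
  have hf0 : ∀ x j, 0 ≤ f x j := fun x j => expect_nonneg fun v _ => by split_ifs <;> norm_num
  have hf1 : ∀ x j, f x j ≤ 1 := fun x j => expect_le (hX j) fun v _ => by split_ifs <;> norm_num
  have hfE : ∀ (S : Finset ι) (P : (ι → V) → Prop), a ∉ S → a' ∉ S →
      (∀ x, P x ↔ ∀ j ∈ S, E (x a) (x a') (x j)) →
      boxAvg X (fun x => if P x then (1 : ℝ) else 0) =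
        boxAvg X fun x => ∏ j ∈ S, f x j := fun S P h1 h2 =>
    boxAvg_forall_mem hX S (fun x _ v => E (x a) (x a') v) (fun x y hxy => by
      rw [hxy a h1, hxy a' h2]) P
  obtain ⟨S, hSc, hS⟩ := hK (piFinset X) (fun k x => δ / 2 ≤ f x (js.get k)) (by
    intro k
    refine card_filter_ge_of_expect (piFinset X) (fun x => f x (js.get k)) (fun x _ => hf1 _ _)
      hδ.le ?_
    have hk : js.get k ∈ js := List.get_mem _ _
    have := hfE {js.get k} (fun x => E (x a) (x a') (x (js.get k)))
      (by simpa using fun h : a = js.get k => ha (h ▸ hk))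
      (by simpa using fun h : a' = js.get k => ha' (h ▸ hk)) (by simp)
    simp only [prod_singleton] at this
    exact (h _ hk).trans_eq this)
  set J := S.image js.get with hJ
  have hJjs : ∀ j ∈ J, j ∈ js := fun j hj => by
    obtain ⟨k, -, rfl⟩ := mem_image.1 hj
    exact List.get_mem _ _
  have hJc : J.card = m := by
    rw [hJ, card_image_of_injective _ (List.nodup_iff_injective_get.1 hnd), hSc]
  have hlJ : ∀ j, j ∈ js.filter (· ∈ J) ↔ j ∈ J := fun j => by
    simp only [List.mem_filter, decide_eq_true_eq, and_iff_right_iff_imp]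
    exact hJjs j
  have hlen : (js.filter (· ∈ J)).length = m := by
    rw [← hJc, ← List.toFinset_card_of_nodup (hnd.filter _)]
    congr 1
    ext j
    rw [List.mem_toFinset, hlJ]
  refine ⟨js.filter (· ∈ J), List.filter_sublist, hlen, ?_⟩
  rw [hfE J _ (fun h => ha (hJjs _ h)) (fun h => ha' (hJjs _ h)) (fun x => by
    simp only [patternHolds_book hlen.le, hlJ]), boxAvg,
    Finset.expect_eq_sum_div_card, le_div_iff₀ hXpos]
  calc γ * (δ / 2) ^ m * (piFinset X).card = γ * (piFinset X).card * (δ / 2) ^ m := by ring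
    _ ≤ ((piFinset X).filter fun x => ∀ k ∈ S, δ / 2 ≤ f x (js.get k)).card * (δ / 2) ^ m := by
        gcongr
    _ = ∑ x ∈ (piFinset X).filter fun x => ∀ k ∈ S, δ / 2 ≤ f x (js.get k), (δ / 2) ^ m := by
        rw [sum_const, nsmul_eq_mul]
    _ ≤ ∑ x ∈ (piFinset X).filter fun x => ∀ k ∈ S, δ / 2 ≤ f x (js.get k), ∏ j ∈ J, f x j := by
        refine sum_le_sum fun x hx => ?_
        rw [← hJc, ← prod_const]
        refine prod_le_prod (fun _ _ => by positivity) fun j hj => ?_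
        obtain ⟨k, hk, rfl⟩ := mem_image.1 hj
        exact (mem_filter.1 hx).2 k hk
    _ ≤ _ := sum_le_sum_of_subset_of_nonneg (filter_subset _ _)
        fun x _ _ => prod_nonneg fun j _ => hf0 x j
theorem WordRel.congr {κ : Type} {w : List Bool} {l : List κ} {R R' : κ → κ → Prop}
    (h : ∀ i ∈ l, ∀ i' ∈ l, (R i i' ↔ R' i i')) : WordRel w l R ↔ WordRel w l R' := by
  refine List.Pairwise.iff_of_mem fun {p q} hp hq => ?_
  rw [h _ (List.of_mem_zip hp).2 _ (List.of_mem_zip hq).2]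

theorem exists_sublist_of_subset {κ : Type} [DecidableEq κ] {l : List κ} (hl : l.Nodup)
    {T : Finset κ} {m : ℕ}
    (hT : T ⊆ l.toFinset) (hm : m ≤ T.card) :
    ∃ l' : List κ, l'.Sublist l ∧ l'.length = m ∧ ∀ x ∈ l', x ∈ T := by
  obtain ⟨Q, hQ, rfl⟩ := exists_subset_card_eq hm
  refine ⟨l.filter (· ∈ Q), List.filter_sublist, ?_, fun x hx => ?_⟩
  · rw [← List.toFinset_card_of_nodup (hl.filter _)]
    congr 1
    ext j
    simp only [List.mem_toFinset, List.mem_filter, decide_eq_true_eq, and_iff_right_iff_imp]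
    exact fun hj => List.mem_toFinset.1 (hT (hQ hj))
  · simp only [List.mem_filter, decide_eq_true_eq] at hx
    exact hQ hx.2

theorem pairwise_of_lt {κ : Type} [LinearOrder κ] {l : List κ} (hl : l.Pairwise (· < ·))
    {R : κ → κ → Prop} (h : l.Pairwise R) {i i' : κ} (hi : i ∈ l) (hi' : i' ∈ l) (hii : i < i') :
    R i i' := by
  obtain ⟨p, hp, rfl⟩ := List.getElem_of_mem hi
  obtain ⟨q, hq, rfl⟩ := List.getElem_of_mem hi'
  rw [List.pairwise_iff_getElem] at h hl
  refine h p q hp hq ?_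
  by_contra! hqp
  rcases hqp.eq_or_lt with rfl | hqp
  · exact lt_irrefl _ hii
  · exact lt_asymm hii (hl _ _ hq hp hqp)

theorem patternHolds_iff {κ V : Type} {E : V → V → V → Prop} {ws : List (List Bool)}
    {l l' : List κ} {x : κ → V} : PatternHolds E ws l l' x ↔ ∀ j ∈ l', ∀ w,
      (w, j) ∈ ws.zip l' → WordRel w l fun i i' => E (x i) (x i') (x j) := by
  constructor
  · intro h j _ w hw
    exact h _ hw
  · rintro h ⟨w, j⟩ hp
    exact h j (List.of_mem_zip hp).2 w hp

theorem eq_of_mem_zip_nodup {α κ : Type} {ws : List α} {l : List κ} (hl : l.Nodup) {w w' : α}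
    {j : κ} (h : (w, j) ∈ ws.zip l) (h' : (w', j) ∈ ws.zip l) : w = w' := by
  obtain ⟨p, hp, hpe⟩ := List.getElem_of_mem h
  obtain ⟨q, hq, hqe⟩ := List.getElem_of_mem h'
  simp only [List.getElem_zip, Prod.mk.injEq] at hpe hqe
  rw [List.length_zip, lt_min_iff] at hp hq
  obtain rfl : p = q := (hl.getElem_inj_iff (hi := hp.2) (hj := hq.2)).1 (hpe.2.trans hqe.2.symm)
  exact hpe.1.symm.trans hqe.1

/-- If all books over pairs from a long list are dense then some pattern is dense. -/
theorem exists_pattern_dense (m : ℕ) (β : ℝ) (hβ : 0 < β) (hβ1 : β ≤ 1) (ws : List (List Bool))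
    (hws : ∀ w ∈ ws, w.length = m) :
    ∃ N₁ : ℕ, ∀ N : ℕ, ∃ ε c : ℝ, 0 < ε ∧ ε ≤ 1 ∧ 0 < c ∧
      ∀ {V : Type} (E : V → V → V → Prop) (X : Fin N → Finset V), (∀ i, (X i).Nonempty) →
      ∀ l₀ l₀' : List (Fin N), SepLists l₀ l₀' → l₀.length = N₁ → l₀'.length = m →
      (l₀.Pairwise fun i i' => HeredDense ε β X fun x =>
        if PatternHolds E (List.replicate m [true, false]) [i, i'] l₀' x then 1 else 0) →
      ∃ l : List (Fin N), l.Sublist l₀ ∧ l.length = m ∧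
        c ≤ boxAvg X fun x => if PatternHolds E ws l l₀' x then 1 else 0 := by
  obtain ⟨γ₀, hγ₀, hγ⟩ := exists_wordRel_all m (β / 2) (half_pos hβ) ws hws
  obtain ⟨N₁, hN₁⟩ := hγ m
  set γ := min γ₀ 1 with hγdef
  have hγpos : 0 < γ := lt_min hγ₀ one_pos
  refine ⟨N₁, fun N => ?_⟩
  obtain ⟨ε, c₀, hε, hε1, hc₀, hcl⟩ := exists_clique_count (Fin N) (β / 2) (half_pos hβ)
    (by linarith) N₁
  refine ⟨ε, c₀ * γ ^ m / 2 ^ (N₁ + 1), hε, hε1, by positivity,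
    fun {V} E X hX l₀ l₀' hsep hl₀ hl₀' h => ?_⟩
  have hs := hsep.left
  have hnd : l₀.Nodup := hs.imp fun h => h.ne
  have hnd' : l₀'.Nodup := hsep.right.imp fun h => h.ne
  set f : V → V → Fin N → ℝ := fun u u' j => 𝔼 v ∈ X j, if E u u' v then (1 : ℝ) else 0 with hf
  have hf0 : ∀ u u' j, 0 ≤ f u u' j := fun _ _ j => expect_nonneg fun v _ => by
    split_ifs <;> norm_num
  have hf1 : ∀ u u' j, f u u' j ≤ 1 := fun _ _ j => expect_le (hX j) fun v _ => by
    split_ifs <;> norm_num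
  obtain ⟨Γ, hΓ⟩ : ∃ Γ : V → V → Prop, ∀ u u', Γ u u' ↔ ∀ j ∈ l₀', β / 2 ≤ f u u' j :=
    ⟨_, fun _ _ => Iff.rfl⟩
  have hclq := hcl l₀ hl₀ hnd X hX (fun _ _ => Γ) (by
    refine h.imp_of_mem fun {i i'} hi hi' hb Y hY => ?_
    have hine : ∀ j ∈ l₀', i ≠ j ∧ i' ≠ j := fun j hj => ⟨hsep.ne hi hj, hsep.ne hi' hj⟩
    set Y' : Fin N → Finset V := ({i, i'} : Finset (Fin N)).piecewise Y X with hY'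
    have hY'X : SubBox ε Y' X := (SubBox.refl X hε1).piecewise _ hY
    have hYne := hY.nonempty hε hX
    have hY'ne := hY'X.nonempty hε hX
    rw [boxAvg_congr_of_dependsOn {i, i'} hYne hY'ne (fun k hk => by rw [hY',
      Finset.piecewise_eq_of_mem _ _ _ hk]) _ (fun x y hxy => by
        rw [hxy i (by simp), hxy i' (by simp)])]
    have h1 := hb Y' hY'X
    rw [boxAvg_forall_mem hY'ne l₀'.toFinset (fun x _ v => E (x i) (x i') v) (fun x y hxy => by
      rw [hxy i fun hi => (hine _ (List.mem_toFinset.1 hi)).1 rfl,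
        hxy i' fun hi => (hine _ (List.mem_toFinset.1 hi)).2 rfl]) _ fun x => by
        simp only [patternHolds_book hl₀'.le, List.mem_toFinset]] at h1
    have h2 : boxAvg Y' (fun x => ∏ j ∈ l₀'.toFinset, 𝔼 v ∈ Y' j,
        if E (x i) (x i') v then (1 : ℝ) else 0) ≤
        boxAvg Y' fun x => (if Γ (x i) (x i') then 1 else 0) + β / 2 := by
      refine expect_le_expect fun x _ => ?_
      have e : ∏ j ∈ l₀'.toFinset, 𝔼 v ∈ Y' j, (if E (x i) (x i') v then (1 : ℝ) else 0) =
          ∏ j ∈ l₀'.toFinset, f (x i) (x i') j := by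
        refine Finset.prod_congr rfl fun j hj => ?_
        have hj' := hine j (List.mem_toFinset.1 hj)
        rw [hY', Finset.piecewise_eq_of_notMem _ _ _ (by simp [hj'.1.symm, hj'.2.symm])]
      rw [e]
      split_ifs with hG
      · have := prod_le_one (s := l₀'.toFinset) (f := fun j => f (x i) (x i') j)
          (fun j _ => hf0 _ _ j) fun j _ => hf1 _ _ j
        linarith
      · simp only [hΓ, not_forall, not_le, exists_prop] at hG
        obtain ⟨j, hj, hjf⟩ := hG
        rw [← mul_prod_erase _ _ (List.mem_toFinset.2 hj)]
        have := prod_le_one (s := l₀'.toFinset.erase j) (f := fun j => f (x i) (x i') j)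
          (fun j _ => hf0 _ _ j) fun j _ => hf1 _ _ j
        have := mul_le_of_le_one_right (hf0 (x i) (x i') j) this
        linarith
    have h3 : boxAvg Y' (fun x => (if Γ (x i) (x i') then (1 : ℝ) else 0) + β / 2) =
        boxAvg Y' (fun x => if Γ (x i) (x i') then (1 : ℝ) else 0) + β / 2 := by
      rw [boxAvg, expect_add_distrib, Finset.expect_const (box_nonempty hY'ne)]
    linarith)
  set L := l₀.sublists.toFinset.filter fun l => l.length = m with hL
  have hLc : (L.card : ℝ) ≤ 2 ^ N₁ := by
    have h1 : L.card ≤ l₀.sublists.length := (card_filter_le _ _).trans (List.toFinset_card_le _)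
    rw [List.length_sublists, hl₀] at h1
    exact_mod_cast h1
  have hpat : ∀ l ∈ L, boxAvg X (fun x => if PatternHolds E ws l l₀' x then (1 : ℝ) else 0) =
      boxAvg X fun x => ∏ j ∈ l₀'.toFinset, 𝔼 v ∈ X j, if ∀ w, (w, j) ∈ ws.zip l₀' →
        WordRel w l fun i i' => E (x i) (x i') v then (1 : ℝ) else 0 := by
    intro l hl
    have hsub : l.Sublist l₀ := by simpa using (mem_filter.1 hl).1
    refine boxAvg_forall_mem hX l₀'.toFinset (fun x j v => ∀ w, (w, j) ∈ ws.zip l₀' →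
        WordRel w l fun i i' => E (x i) (x i') v) (fun x y hxy => ?_) _ fun x => by
        simp only [patternHolds_iff, List.mem_toFinset]
    funext j v
    refine propext (forall₂_congr fun w _ => WordRel.congr fun i hi i' hi' => ?_)
    rw [hxy i fun h => hsep.ne (hsub.subset hi) (List.mem_toFinset.1 h) rfl,
      hxy i' fun h => hsep.ne (hsub.subset hi') (List.mem_toFinset.1 h) rfl]
  have hsum : c₀ * γ ^ m ≤
      ∑ l ∈ L, boxAvg X fun x => if PatternHolds E ws l l₀' x then (1 : ℝ) else 0 := by
    rw [Finset.sum_congr rfl hpat, ← expect_sum_comm]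
    calc c₀ * γ ^ m ≤ (boxAvg X fun x =>
          if l₀.Pairwise fun i j => Γ (x i) (x j) then (1 : ℝ) else 0) * γ ^ m := by gcongr
      _ ≤ _ := by
        rw [boxAvg, expect_mul]
        refine expect_le_expect fun x hx => ?_
        have hnn : ∀ l ∈ L, 0 ≤ ∏ j ∈ l₀'.toFinset, 𝔼 v ∈ X j, (if ∀ w, (w, j) ∈ ws.zip l₀' →
            WordRel w l fun i i' => E (x i) (x i') v then (1 : ℝ) else 0) :=
          fun l _ => prod_nonneg fun j _ => expect_nonneg fun v _ => by split_ifs <;> norm_num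
        split_ifs with hx
        swap
        · rw [zero_mul]
          exact sum_nonneg hnn
        obtain ⟨T', hT', hT'c, hT'w⟩ := hN₁ l₀.toFinset X (fun _ i i' v => E (x i) (x i') v) l₀'
          (by rw [List.toFinset_card_of_nodup hnd, hl₀]) (by
            intro j hj i hi i' hi' hii
            have h1 := (hΓ _ _).1 (pairwise_of_lt hs hx (List.mem_toFinset.1 hi)
              (List.mem_toFinset.1 hi') hii) j hj
            simp only [hf] at h1
            have hXj : (0 : ℝ) < (X j).card := by exact_mod_cast (hX j).card_pos
            rwa [Finset.expect_eq_sum_div_card, sum_boole, le_div_iff₀ hXj] at h1)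
        obtain ⟨l, hll, hlm, hlT⟩ := exists_sublist_of_subset hnd hT' hT'c
        have hlL : l ∈ L := by simpa [hL] using ⟨hll, hlm⟩
        refine le_trans ?_ (single_le_sum hnn hlL)
        rw [one_mul, ← hl₀', ← List.toFinset_card_of_nodup hnd', ← prod_const]
        refine prod_le_prod (fun _ _ => hγpos.le) fun j hj => ?_
        have hXj : (0 : ℝ) < (X j).card := by exact_mod_cast (hX j).card_pos
        by_cases hw : ∃ w, (w, j) ∈ ws.zip l₀'
        · obtain ⟨w, hw⟩ := hw
          rw [Finset.expect_eq_sum_div_card, sum_boole, le_div_iff₀ hXj]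
          have h1 := hT'w l (hs.sublist hll) hlm hlT _ hw
          refine (mul_le_mul_of_nonneg_right (min_le_left _ _) hXj.le).trans (h1.trans ?_)
          refine Nat.cast_le.2 (card_le_card (monotone_filter_right _ fun v _ hv w' hw' => ?_))
          rwa [eq_of_mem_zip_nodup hnd' hw' hw]
        · rw [expect_congr rfl (g := fun _ => (1 : ℝ)) fun v _ => if_pos fun w hw' =>
            absurd ⟨w, hw'⟩ hw, Finset.expect_const (hX j)]
          exact min_le_right _ _
  by_contra! hcon
  have h1 : ∑ l ∈ L, boxAvg X (fun x => if PatternHolds E ws l l₀' x then (1 : ℝ) else 0) ≤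
      ∑ l ∈ L, c₀ * γ ^ m / 2 ^ (N₁ + 1) := sum_le_sum fun l hl => by
    have hl' := mem_filter.1 hl
    exact (hcon l (by simpa using hl'.1) hl'.2).le
  rw [sum_const, nsmul_eq_mul] at h1
  have hpos : 0 < c₀ * γ ^ m := by positivity
  have h2 : (L.card : ℝ) * (c₀ * γ ^ m / 2 ^ (N₁ + 1)) ≤ 2 ^ N₁ * (c₀ * γ ^ m / 2 ^ (N₁ + 1)) := by
    gcongr
  have h3 : (2 : ℝ) ^ N₁ * (c₀ * γ ^ m / 2 ^ (N₁ + 1)) = c₀ * γ ^ m / 2 := by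
    rw [pow_succ]
    field_simp
  linarith
theorem cube_le_choose_three {m : ℕ} (hm : 3 ≤ m) : (m : ℝ) ^ 3 ≤ 48 * (m.choose 3 : ℝ) := by
  have h : m.choose 3 * 6 = m * (m - 1) * (m - 2) := by
    have := Nat.descFactorial_eq_factorial_mul_choose m 3
    simp [Nat.descFactorial, Nat.factorial] at this
    nlinarith
  have h' : (m.choose 3 : ℝ) * 6 = m * (m - 1) * (m - 2) := by
    have := congrArg (Nat.cast (R := ℝ)) h
    push_cast [Nat.cast_sub (by omega : 1 ≤ m), Nat.cast_sub (by omega : 2 ≤ m)] at this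
    exact this
  have hm' : (3 : ℝ) ≤ m := by exact_mod_cast hm
  nlinarith [mul_nonneg (by linarith : (0 : ℝ) ≤ m) (mul_nonneg (by linarith : (0 : ℝ) ≤ m - 3)
    (by linarith : (0 : ℝ) ≤ 7 * m - 3))]

/-- Among many disjoint large parts of a uniformly dense 3-graph, some three span a positive
proportion of edges. -/
theorem exists_dense_triple (d : ℝ) (hd : 0 < d) : ∃ M₀ : ℕ, ∀ {ι V : Type} [Fintype ι]
    [DecidableEq ι] [Fintype V] [DecidableEq V] (H : H3 V) (η : ℝ) (s : ℕ) (X : ι → Finset V),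
    0 < s → (∀ i, s ≤ (X i).card) → (∀ i j, i ≠ j → Disjoint (X i) (X j)) →
    η * (card V : ℝ) ^ 3 ≤ s ^ 3 → H.uniformlyDense d η → ∀ T : Finset ι, T.card = M₀ →
    ∃ Q ⊆ T, Q.card = 3 ∧ d / 96 ≤ boxAvg X fun x => if Q.image x ∈ H.edges then 1 else 0 := by
  obtain ⟨M₀, hM₀⟩ := exists_nat_gt (max 3 (192 / d))
  have hM3 : (3 : ℝ) < M₀ := (le_max_left _ _).trans_lt hM₀
  have hMd : 192 < d * M₀ := by
    have := (le_max_right _ _).trans_lt hM₀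
    rwa [div_lt_iff₀' hd] at this
  refine ⟨M₀, fun {ι V} _ _ _ _ H η s X₀ hs hX₀ hdisj₀ hη hH T hT => ?_⟩
  by_contra! hcon
  obtain ⟨X, hX, hXle⟩ := exists_subbox_boxAvg_le hs X₀ hX₀ fun x =>
    ∑ Q ∈ T.powersetCard 3, if Q.image x ∈ H.edges then (1 : ℝ) else 0
  have hdisj : ∀ i j, i ≠ j → Disjoint (X i) (X j) := fun i j hij =>
    (hdisj₀ i j hij).mono (hX i).1 (hX j).1
  have hXne : ∀ i, (X i).Nonempty := fun i => card_pos.1 ((hX i).2 ▸ hs)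
  have hs' : (0 : ℝ) < s := by exact_mod_cast hs
  have hupper : boxAvg X (fun x => ∑ Q ∈ T.powersetCard 3,
      if Q.image x ∈ H.edges then (1 : ℝ) else 0) ≤ (M₀ : ℝ) ^ 3 * (d / 96) := by
    refine hXle.trans ?_
    rw [boxAvg, expect_sum_comm]
    refine (sum_le_sum (g := fun _ => d / 96) fun Q hQ => ?_).trans ?_
    · rw [mem_powersetCard] at hQ
      exact (hcon Q hQ.1 hQ.2).le
    · rw [sum_const, card_powersetCard, hT, nsmul_eq_mul]
      gcongr
      exact_mod_cast Nat.choose_le_pow M₀ 3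
  set U := T.biUnion X with hU
  have hUc : U.card = M₀ * s := by
    rw [hU, card_biUnion fun i _ j _ hij => hdisj i j hij, Finset.sum_congr rfl fun i _ => (hX i).2,
      sum_const, hT, smul_eq_mul]
  have hg : ∀ v : V, ∃ i : Option ι, v ∈ U → ∃ k, i = some k ∧ k ∈ T ∧ v ∈ X k := fun v => by
    by_cases hv : v ∈ U
    · obtain ⟨k, hk⟩ := mem_biUnion.1 hv
      exact ⟨some k, fun _ => ⟨k, rfl, hk⟩⟩
    · exact ⟨none, fun h => absurd h hv⟩
  have hTne : T.Nonempty := card_pos.1 (by rw [hT]; exact_mod_cast (by linarith : (0 : ℝ) < M₀))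
  obtain ⟨i₀, hi₀⟩ := hTne
  obtain ⟨g, hg⟩ : ∃ g : V → ι, ∀ v ∈ U, g v ∈ T ∧ v ∈ X (g v) := by
    choose g hg using hg
    refine ⟨fun v => (g v).getD i₀, fun v hv => ?_⟩
    obtain ⟨k, hk, h⟩ := hg v hv
    simpa [hk] using h
  set A := H.edges.filter fun e => e ⊆ U with hA
  have htr : ((A.filter fun e : Finset V => Set.InjOn g (e : Set V)).card : ℝ) ≤
      (M₀ : ℝ) ^ 3 * (d / 96) * s ^ 3 := by
    have h1 : ∀ e ∈ A.filter (fun e : Finset V => Set.InjOn g (e : Set V)),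
        (1 / (s : ℝ)) ^ 3 ≤ boxAvg X fun x =>
        ∏ i ∈ e.image g, if x i ∈ e then (1 : ℝ) else 0 := by
      intro e he
      obtain ⟨heA, hinj⟩ := mem_filter.1 he
      obtain ⟨heH, heU⟩ := mem_filter.1 heA
      have hc : (e.image g).card = 3 := by rw [card_image_of_injOn hinj, H.card3 e heH]
      rw [boxAvg_prod_mem hXne (e.image g) fun i v => if v ∈ e then (1 : ℝ) else 0, ← hc,
        ← prod_const]
      refine prod_le_prod (fun _ _ => by positivity) fun i hi => ?_
      obtain ⟨v, hv, rfl⟩ := mem_image.1 hi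
      rw [Finset.expect_eq_sum_div_card, sum_boole, (hX _).2]
      gcongr
      exact_mod_cast card_pos.2 ⟨v, mem_filter.2 ⟨(hg v (heU hv)).2, hv⟩⟩
    have h2 : ((A.filter fun e : Finset V => Set.InjOn g (e : Set V)).card : ℝ) *
        (1 / (s : ℝ)) ^ 3 ≤
        (M₀ : ℝ) ^ 3 * (d / 96) := by
      refine le_trans ?_ hupper
      rw [← nsmul_eq_mul, ← sum_const]
      refine (sum_le_sum h1).trans ?_
      rw [← expect_sum_comm]
      refine expect_le_expect fun x hx => ?_
      rw [mem_piFinset] at hx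
      have hprod : ∀ e : Finset V, ∏ i ∈ e.image g, (if x i ∈ e then (1 : ℝ) else 0) =
          if ∀ i ∈ e.image g, x i ∈ e then 1 else 0 := fun e => by
        by_cases h : ∀ i ∈ e.image g, x i ∈ e
        · rw [if_pos h, Finset.prod_eq_one fun i hi => if_pos (h i hi)]
        · rw [if_neg h]
          push Not at h
          obtain ⟨i, hi, hie⟩ := h
          exact Finset.prod_eq_zero hi (if_neg hie)
      simp only [hprod]
      rw [sum_boole, sum_boole]
      refine Nat.cast_le.2 (card_le_card_of_injOn (fun e => e.image g) ?_ ?_)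
      all_goals
        have hkey : ∀ e ∈ (A.filter fun e : Finset V => Set.InjOn g (e : Set V)).filter
            fun e => ∀ i ∈ e.image g, x i ∈ e, (e.image g).card = 3 ∧ (e.image g).image x = e := by
          intro e he
          obtain ⟨he', hall⟩ := mem_filter.1 he
          obtain ⟨heA, hinj⟩ := mem_filter.1 he'
          obtain ⟨heH, heU⟩ := mem_filter.1 heA
          have hc : (e.image g).card = 3 := by rw [card_image_of_injOn hinj, H.card3 e heH]
          refine ⟨hc, eq_of_subset_of_card_le (image_subset_iff.2 hall) ?_⟩
          rw [card_image_of_injective, hc, H.card3 e heH]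
          intro i j hij
          by_contra hne
          exact disjoint_left.1 (hdisj i j hne) (hx i) (by rw [hij]; exact hx j)
      · intro e he
        have hk := hkey e he
        obtain ⟨he', hall⟩ := mem_filter.1 he
        obtain ⟨heA, hinj⟩ := mem_filter.1 he'
        obtain ⟨heH, heU⟩ := mem_filter.1 heA
        simp only [coe_filter, Set.mem_ofPred_eq, mem_powersetCard]
        refine ⟨⟨image_subset_iff.2 fun v hv => (hg v (heU hv)).1, hk.1⟩, ?_⟩
        rw [hk.2]
        exact heH
      · intro e he e' he' hee
        rw [← (hkey e he).2, ← (hkey e' he').2]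
        simp only at hee
        rw [hee]
    rw [one_div, inv_pow, ← div_eq_mul_inv, div_le_iff₀ (by positivity)] at h2
    exact h2
  have hnt : ((A.filter fun e : Finset V => ¬Set.InjOn g (e : Set V)).card : ℝ) ≤
      (M₀ : ℝ) ^ 2 * s ^ 3 := by
    have h1 : A.filter (fun e : Finset V => ¬Set.InjOn g (e : Set V)) ⊆
        (T.biUnion fun i => X i ×ˢ X i ×ˢ U).image
        fun p => {p.1, p.2.1, p.2.2} := by
      intro e he
      obtain ⟨heA, hinj⟩ := mem_filter.1 he
      obtain ⟨heH, heU⟩ := mem_filter.1 heA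
      simp only [Set.InjOn, not_forall, mem_coe] at hinj
      obtain ⟨a, ha, b, hb, hab, hne⟩ := hinj
      have hc : ((e.erase a).erase b).card = 1 := by
        rw [card_erase_of_mem (mem_erase.2 ⟨fun h => hne h.symm, hb⟩), card_erase_of_mem ha,
          H.card3 e heH]
      obtain ⟨c, hc⟩ := card_eq_one.1 hc
      have hce : c ∈ (e.erase a).erase b := by rw [hc]; simp
      refine mem_image.2 ⟨(a, b, c), mem_biUnion.2 ⟨g a, (hg a (heU ha)).1, ?_⟩, ?_⟩
      · simp only [mem_product]
        exact ⟨(hg a (heU ha)).2, hab ▸ (hg b (heU hb)).2,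
          heU (mem_of_mem_erase (mem_of_mem_erase hce))⟩
      · rw [← insert_erase ha, ← insert_erase (mem_erase.2 ⟨fun h => hne h.symm, hb⟩), hc]
    have h2 := (card_le_card h1).trans (card_image_le.trans card_biUnion_le)
    simp only [card_product, (hX _).2, hUc, sum_const, hT, smul_eq_mul] at h2
    calc ((A.filter fun e : Finset V => ¬Set.InjOn g (e : Set V)).card : ℝ)
        ≤ ((M₀ * (s * (s * (M₀ * s))) : ℕ) : ℝ) := by
          exact_mod_cast h2
      _ = _ := by push_cast; ring
  have hlow := hH U
  have hsplit : (A.card : ℝ) = (A.filter fun e : Finset V => Set.InjOn g (e : Set V)).card +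
      (A.filter fun e : Finset V => ¬Set.InjOn g (e : Set V)).card := by
    exact_mod_cast (card_filter_add_card_filter_not (s := A)
      (fun e : Finset V => Set.InjOn g (e : Set V))).symm
  have hM3' : 3 ≤ M₀ := by exact_mod_cast hM3.le
  have hch := cube_le_choose_three (m := U.card) (by rw [hUc]; nlinarith)
  have hch2 : (M₀ : ℝ) ^ 3 * s ^ 3 ≤ 48 * (U.card.choose 3 : ℝ) := by
    refine le_trans (le_of_eq ?_) hch
    rw [hUc]
    push_cast
    ring
  have hs3 : (0 : ℝ) < (s : ℝ) ^ 3 := by positivity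
  have h5 : d / 48 * ((M₀ : ℝ) ^ 3 * s ^ 3) ≤ d * (U.card.choose 3 : ℝ) := by nlinarith
  have h6 : (d / 96 * (M₀ : ℝ) ^ 3) * s ^ 3 ≤ ((M₀ : ℝ) ^ 2 + 1) * s ^ 3 := by nlinarith
  have h7 := le_of_mul_le_mul_right h6 hs3
  nlinarith [mul_pos (by linarith : (0 : ℝ) < M₀) (by linarith : (0 : ℝ) < M₀)]
theorem HeredDense.mono {ε ε' c c' : ℝ} {X : ι → Finset V} {φ : (ι → V) → ℝ}
    (h : HeredDense ε c X φ) (hε : ε ≤ ε') (hc : c' ≤ c) : HeredDense ε' c' X φ :=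
  fun Y hY => hc.trans (h Y (hY.mono hε))

/-- In a sufficiently regular box with many dense triples there are three blocks of `m` coordinates
such that consecutive blocks, in cyclic order, carry hereditarily dense copies of the prescribed
patterns. -/
theorem exists_dense_blocks (δ : ℝ) (hδ : 0 < δ) (m M₀ : ℕ) (ws : Fin 3 → List (List Bool))
    (hws : ∀ k, ∀ w ∈ ws k, w.length = m) :
    ∃ N : ℕ, ∃ κ c ε₁ : ℝ, 0 < κ ∧ 0 < c ∧ c ≤ 1 ∧ 0 < ε₁ ∧ ε₁ ≤ 1 ∧
      ∀ {V : Type} (E : V → V → V → Prop) (X : Fin N → Finset V) (ε : ℝ), ε ≤ ε₁ →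
      (∀ i, (X i).Nonempty) → (∀ a b c, E a b c → E b c a) →
      (∀ T : Finset (Fin N), T.card = M₀ → ∃ l : List (Fin N), l.Pairwise (· < ·) ∧ l.length = 3 ∧
        (∀ i ∈ l, i ∈ T) ∧ ∀ i j k, l = [i, j, k] →
        δ ≤ boxAvg X fun x => if E (x i) (x j) (x k) then 1 else 0) →
      (∀ w, w = List.replicate m [true, false] ∨ (∃ k, w = ws k) → ∀ l l' : List (Fin N),
        l.Pairwise (· < ·) → l'.Pairwise (· < ·) →
        HeredDense ε ((boxAvg X fun x => if PatternHolds E w l l' x then 1 else 0) - κ) X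
          fun x => if PatternHolds E w l l' x then 1 else 0) →
      ∃ P : Fin 3 → List (Fin N), (∀ k, (P k).length = m) ∧ (∀ k, SepLists (P k) (P (k + 1))) ∧
        ∀ k, HeredDense ε c X fun x =>
          if PatternHolds E (ws k) (P k) (P (k + 1)) x then 1 else 0 := by
  obtain ⟨K, β₀, hβ₀, hbook⟩ := exists_book_dense δ hδ m
  set β := min β₀ 1 with hβ
  have hβpos : 0 < β := lt_min hβ₀ one_pos
  have hβ1 : β ≤ 1 := min_le_right _ _
  choose N₁ hN₁ using fun k => exists_pattern_dense m (β / 2) (half_pos hβpos) (by linarith) (ws k)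
    (hws k)
  obtain ⟨R₂, hR₂⟩ := exists_ramsey_sepLists m m (N₁ 2) m (3 * m)
  obtain ⟨R₁, hR₁⟩ := exists_ramsey_sepLists m m (N₁ 1) m R₂
  obtain ⟨R₀, hR₀⟩ := exists_ramsey_sepLists m m (N₁ 0) m R₁
  obtain ⟨Rb, hRb⟩ := exists_ramsey_sepLists 2 m 2 K R₀
  obtain ⟨N, hN⟩ := exists_ramsey_of_exists 3 M₀ Rb
  choose εk ck hεk hεk1 hck hpat using fun k => hN₁ k N
  set ε₁ := min (εk 0) (min (εk 1) (εk 2)) with hε₁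
  have hε₁k : ∀ k, ε₁ ≤ εk k := by
    intro k
    fin_cases k
    · exact min_le_left _ _
    · exact (min_le_right _ _).trans (min_le_left _ _)
    · exact (min_le_right _ _).trans (min_le_right _ _)
  set c := min 1 (min (ck 0) (min (ck 1) (ck 2))) / 2 with hc
  have hck2 : ∀ k, 2 * c ≤ ck k := by
    have e : 2 * c = min 1 (min (ck 0) (min (ck 1) (ck 2))) := by rw [hc]; ring
    intro k
    rw [e]
    fin_cases k
    · exact (min_le_right _ _).trans (min_le_left _ _)
    · exact (min_le_right _ _).trans ((min_le_right _ _).trans (min_le_left _ _))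
    · exact (min_le_right _ _).trans ((min_le_right _ _).trans (min_le_right _ _))
  have hcpos : 0 < c := half_pos (lt_min one_pos (lt_min (hck 0) (lt_min (hck 1) (hck 2))))
  have hc1 : c ≤ 1 := by
    have : min 1 (min (ck 0) (min (ck 1) (ck 2))) ≤ 1 := min_le_left _ _
    linarith
  refine ⟨N, min (β / 2) c, c, ε₁, lt_min (by linarith) hcpos, hcpos, hc1,
    lt_min (hεk 0) (lt_min (hεk 1) (hεk 2)), (hε₁k 0).trans (hεk1 0),
    fun {V} E X ε hε hX hE hedge hreg => ?_⟩
  obtain ⟨Te, -, hTec, hTe⟩ := hN (univ : Finset (Fin N)) (by simp)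
    (fun l => ∀ i j k, l = [i, j, k] →
    δ ≤ boxAvg X fun x => if E (x i) (x j) (x k) then 1 else 0) fun Q _ hQ => hedge Q hQ
  obtain ⟨Tb, hTbe, hTbc, hTb⟩ := hRb Te hTec (fun l l' => β ≤ boxAvg X fun x =>
      if PatternHolds E (List.replicate m [true, false]) l l' x then 1 else 0) (by
    intro l₀ l₀' hsep h2 hK hl₀ hl₀'
    obtain ⟨a, a', rfl⟩ := List.length_eq_two.1 h2
    obtain ⟨l, hl, hlm, hlβ⟩ := hbook E X hX a a' l₀' hK (hsep.right.imp fun h => h.ne)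
      (fun h => hsep.ne (by simp) h rfl) (fun h => hsep.ne (by simp) h rfl) (by
      intro j hj
      have h3 : SepLists [a, a'] [j] := hsep.sublist (List.Sublist.refl _)
        (List.singleton_sublist.2 hj)
      have ha : a ∈ Te := hl₀ _ (by simp)
      have ha' : a' ∈ Te := hl₀ _ (by simp)
      have hj' : j ∈ Te := hl₀' _ hj
      rcases h3 with h3 | h3
      · exact hTe [a, a', j] h3 rfl (by simp [ha, ha', hj']) _ _ _ rfl
      · have h4 := hTe [j, a, a'] h3 rfl (by simp [ha, ha', hj']) _ _ _ rfl
        refine h4.trans (expect_le_expect fun x _ => ?_)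
        split_ifs with h5 h6
        · exact le_rfl
        · exact absurd (hE _ _ _ h5) h6
        · exact zero_le_one
        · exact le_rfl)
    exact ⟨[a, a'], l, List.Sublist.refl _, hl, rfl, hlm, (min_le_left _ _).trans hlβ⟩)
  have hD : ∀ k (T : Finset (Fin N)), T ⊆ Tb → ∀ l₀ l₀' : List (Fin N), SepLists l₀ l₀' →
      l₀.length = N₁ k → l₀'.length = m → (∀ x ∈ l₀, x ∈ T) → (∀ x ∈ l₀', x ∈ T) →
      ∃ l l' : List (Fin N), l.Sublist l₀ ∧ l'.Sublist l₀' ∧ l.length = m ∧ l'.length = m ∧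
        ck k ≤ boxAvg X fun x => if PatternHolds E (ws k) l l' x then 1 else 0 := by
    intro k T hT l₀ l₀' hsep hl₀ hl₀' hm hm'
    obtain ⟨l, hl, hlm, hlc⟩ := hpat k E X hX l₀ l₀' hsep hl₀ hl₀' (by
      rw [List.pairwise_iff_forall_sublist]
      intro i i' hii
      have h1 := hsep.sublist hii (List.Sublist.refl l₀')
      have h2 := hTb [i, i'] l₀' h1 rfl hl₀' (fun x hx => hT (hm x (hii.subset hx)))
        fun x hx => hT (hm' x hx)
      refine (hreg _ (Or.inl rfl) [i, i'] l₀' h1.left h1.right).mono (hε.trans (hε₁k k)) ?_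
      have h3 : min (β / 2) c ≤ β / 2 := min_le_left _ _
      linarith)
    exact ⟨l, l₀', hl, List.Sublist.refl _, hlm, hl₀', hlc⟩
  obtain ⟨T₀, hT₀, hT₀c, h₀⟩ := hR₀ Tb hTbc _ (hD 0 Tb subset_rfl)
  obtain ⟨T₁, hT₁, hT₁c, h₁⟩ := hR₁ T₀ hT₀c _ (hD 1 T₀ hT₀)
  obtain ⟨T₂, hT₂, hT₂c, h₂⟩ := hR₂ T₁ hT₁c _ (hD 2 T₁ (hT₁.trans hT₀))
  have hall : ∀ k, ∀ l l' : List (Fin N), SepLists l l' → l.length = m → l'.length = m →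
      (∀ x ∈ l, x ∈ T₂) → (∀ x ∈ l', x ∈ T₂) →
      HeredDense ε c X fun x => if PatternHolds E (ws k) l l' x then 1 else 0 := by
    intro k l l' hsep hl hl' hlT hlT'
    have h3 : ck k ≤ boxAvg X fun x => if PatternHolds E (ws k) l l' x then 1 else 0 := by
      fin_cases k
      · exact h₀ l l' hsep hl hl' (fun x hx => hT₁ (hT₂ (hlT x hx)))
          fun x hx => hT₁ (hT₂ (hlT' x hx))
      · exact h₁ l l' hsep hl hl' (fun x hx => hT₂ (hlT x hx)) fun x hx => hT₂ (hlT' x hx)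
      · exact h₂ l l' hsep hl hl' hlT hlT'
    refine (hreg _ (Or.inr ⟨k, rfl⟩) l l' hsep.left hsep.right).mono le_rfl ?_
    have h4 : min (β / 2) c ≤ c := min_le_right _ _
    have h5 := hck2 k
    linarith
  obtain ⟨Q, hQ, hQc⟩ := exists_subset_card_eq hT₂c
  obtain ⟨P₀, P₁, P₂, hP, e₀, e₁, e₂⟩ : ∃ P₀ P₁ P₂ : List (Fin N), P₀ ++ (P₁ ++ P₂) =
      Q.sort (· ≤ ·) ∧ P₀.length = m ∧ P₁.length = m ∧ P₂.length = m :=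
    ⟨(Q.sort (· ≤ ·)).take m, ((Q.sort (· ≤ ·)).drop m).take m, ((Q.sort (· ≤ ·)).drop m).drop m,
      by rw [List.take_append_drop, List.take_append_drop], by simp [hQc]; omega,
      by simp [hQc]; omega, by simp [hQc]; omega⟩
  have hs : (P₀ ++ (P₁ ++ P₂)).Pairwise (· < ·) := hP ▸ (Finset.sortedLT_sort Q).pairwise
  have hm : ∀ x ∈ P₀ ++ (P₁ ++ P₂), x ∈ T₂ := fun x hx => hQ (by rw [hP] at hx; simpa using hx)
  have s01 : SepLists P₀ P₁ := Or.inl (hs.sublist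
    ((List.sublist_append_left P₁ P₂).append_left P₀))
  have s12 : SepLists P₁ P₂ := Or.inl (hs.sublist (List.sublist_append_right _ _))
  have s20 : SepLists P₂ P₀ := Or.inr (hs.sublist
    ((List.sublist_append_right P₁ P₂).append_left P₀))
  have m0 : ∀ x ∈ P₀, x ∈ T₂ := fun x hx => hm x (by simp [hx])
  have m1 : ∀ x ∈ P₁, x ∈ T₂ := fun x hx => hm x (by simp [hx])
  have m2 : ∀ x ∈ P₂, x ∈ T₂ := fun x hx => hm x (by simp [hx])
  refine ⟨![P₀, P₁, P₂], ?_, ?_, ?_⟩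
  · intro k
    fin_cases k <;> assumption
  · intro k
    fin_cases k <;> assumption
  · intro k
    fin_cases k
    · exact hall 0 _ _ s01 e₀ e₁ m0 m1
    · exact hall 1 _ _ s12 e₁ e₂ m1 m2
    · exact hall 2 _ _ s20 e₂ e₀ m2 m0
theorem sort_toFinset_of_pairwise {κ : Type} [LinearOrder κ] {l : List κ}
    (hl : l.Pairwise (· < ·)) : l.toFinset.sort (· ≤ ·) = l :=
  (List.toFinset_sort (· ≤ ·) (hl.imp fun h => h.ne)).2 (hl.imp fun h => h.le)

theorem exists_disjoint_parts {n N q : ℕ} (h : N * q ≤ n) : ∃ U : Fin N → Finset (Fin n),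
    (∀ i, (U i).card = q) ∧ ∀ i j, i ≠ j → Disjoint (U i) (U j) := by
  have hinj : Function.Injective fun p : Fin N × Fin q => Fin.castLE h (finProdFinEquiv p) :=
    (Fin.castLE_injective h).comp finProdFinEquiv.injective
  refine ⟨fun i => univ.image fun k => Fin.castLE h (finProdFinEquiv (i, k)), fun i => ?_,
    fun i j hij => ?_⟩
  · rw [card_image_of_injective, card_univ, Fintype.card_fin]
    intro k k' hk
    exact (Prod.mk.inj (hinj hk)).2
  · rw [disjoint_left]
    intro v hv hv'
    obtain ⟨k, -, rfl⟩ := mem_image.1 hv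
    obtain ⟨k', -, hk⟩ := mem_image.1 hv'
    exact hij (Prod.mk.inj (hinj hk)).1.symm

/-- Three blocks of vertices of a uniformly dense 3-graph realise arbitrary prescribed patterns
between consecutive blocks, in cyclic order. -/
theorem exists_cyclic_pattern (d : ℝ) (hd : 0 < d) (m : ℕ) (s : Fin 3 → Fin m → Fin m → Bool) :
    ∃ η : ℝ, 0 < η ∧ ∃ n₀ : ℕ, ∀ n, n₀ ≤ n → ∀ H : H3 (Fin n), H.uniformlyDense d η →
      ∃ y : Fin 3 → Fin m → Fin n, (∀ k k' i i', y k i = y k' i' → k = k' ∧ i = i') ∧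
        ∀ k i i' j, i < i' → s k i j = true → s k i' j = false →
          ({y k i, y k i', y (k + 1) j} : Finset (Fin n)) ∈ H.edges := by
  obtain ⟨M₀, hM₀⟩ := exists_dense_triple d hd
  obtain ⟨ws, hws⟩ : ∃ ws : Fin 3 → List (List Bool),
      ∀ k, ws k = List.ofFn fun j => List.ofFn fun i => s k i j := ⟨_, fun _ => rfl⟩
  obtain ⟨N, κ, c, ε₁, hκ, hc, hc1, hε₁, hε₁1, hblocks⟩ := exists_dense_blocks (d / 96)
    (by positivity) m M₀ ws (by
      intro k w hw
      rw [hws, List.mem_ofFn] at hw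
      obtain ⟨j, rfl⟩ := hw
      simp)
  obtain ⟨ε₂, hε₂, hε₂1, hcyc⟩ := exists_cyclic_solution (Fin N) c hc hc1
  set ε := min ε₁ ε₂ with hε
  have hεpos : 0 < ε := lt_min hε₁ hε₂
  have hε1 : ε ≤ 1 := (min_le_left _ _).trans hε₁1
  set L : Finset (List (Fin N)) := univ.image fun Q : Finset (Fin N) => Q.sort (· ≤ ·) with hL
  have hmemL : ∀ l : List (Fin N), l.Pairwise (· < ·) → l ∈ L := fun l hl =>
    mem_image.2 ⟨l.toFinset, mem_univ _, sort_toFinset_of_pairwise hl⟩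
  obtain ⟨σ, hσ, hσ1, hreg⟩ := exists_regular_all (Fin N)
    ((insert (List.replicate m [true, false]) (univ.image ws)) ×ˢ L ×ˢ L) ε κ hεpos hε1 hκ
  refine ⟨(σ / (2 * (N + 1))) ^ 3, by positivity, N + 1, fun n hn H hH => ?_⟩
  set q := n / (N + 1) with hq
  have hqpos : 0 < q := Nat.div_pos hn N.succ_pos
  have hNq : (N + 1) * q ≤ n := Nat.mul_div_le _ _
  obtain ⟨U, hUc, hUd⟩ := exists_disjoint_parts (n := n) (N := N) (q := q) (by nlinarith)
  obtain ⟨E, hE⟩ : ∃ E : Fin n → Fin n → Fin n → Prop,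
      ∀ a b c, E a b c ↔ ({a, b, c} : Finset (Fin n)) ∈ H.edges := ⟨_, fun _ _ _ => Iff.rfl⟩
  obtain ⟨X, hXU, hX⟩ := hreg (V := Fin n)
    (fun t x => if PatternHolds E t.1 t.2.1 t.2.2 x then (1 : ℝ) else 0)
    (fun t x => by split_ifs <;> norm_num) (fun t x => by split_ifs <;> norm_num) U
    (fun i => card_pos.1 ((hUc i).symm ▸ hqpos))
  have hXne : ∀ i, (X i).Nonempty := hXU.nonempty hσ fun i => card_pos.1 ((hUc i).symm ▸ hqpos)
  have hXd : ∀ i j, i ≠ j → Disjoint (X i) (X j) := fun i j hij =>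
    (hUd i j hij).mono (hXU i).1 (hXU j).1
  have hqR : (0 : ℝ) < q := by exact_mod_cast hqpos
  have hs : 0 < ⌈σ * q⌉₊ := Nat.ceil_pos.2 (by positivity)
  have hsX : ∀ i, ⌈σ * (q : ℝ)⌉₊ ≤ (X i).card := fun i => Nat.ceil_le.2 (by
    have := (hXU i).2
    rwa [hUc] at this)
  have hn2 : (n : ℝ) ≤ 2 * (N + 1) * q := by
    have h1 : n < (N + 1) * (q + 1) := Nat.lt_mul_div_succ n N.succ_pos
    have h2 : n ≤ 2 * (N + 1) * q := by nlinarith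
    exact_mod_cast h2
  have hη : (σ / (2 * (N + 1))) ^ 3 * (Fintype.card (Fin n) : ℝ) ^ 3 ≤
      (⌈σ * (q : ℝ)⌉₊ : ℝ) ^ 3 := by
    rw [Fintype.card_fin, ← mul_pow]
    refine pow_le_pow_left₀ (by positivity) ((?_ : _ ≤ σ * (q : ℝ)).trans (Nat.le_ceil _)) 3
    rw [div_mul_eq_mul_div, div_le_iff₀ (by positivity)]
    nlinarith
  obtain ⟨P, hPl, hPs, hPd⟩ := hblocks E X ε (min_le_left _ _) hXne (by
      intro a b c h
      rw [hE] at h ⊢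
      rwa [show ({b, c, a} : Finset (Fin n)) = {a, b, c} by
        ext; simp only [mem_insert, mem_singleton]; tauto])
    (by
      intro T hT
      obtain ⟨Q, hQT, hQc, hQ⟩ := hM₀ H _ _ X hs hsX hXd hη hH T hT
      refine ⟨Q.sort (· ≤ ·), (Finset.sortedLT_sort Q).pairwise, by simp [hQc],
        fun i hi => hQT (by simpa using hi), fun i j k hl => ?_⟩
      have hQe : Q = {i, j, k} := by
        ext v
        rw [← Finset.mem_sort (· ≤ ·), hl]
        simp
      refine hQ.trans (expect_le_expect fun x _ => ?_)
      have h1 : Q.image x ∈ H.edges ↔ E (x i) (x j) (x k) := by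
        rw [hE, hQe, image_insert, image_insert, image_singleton]
      simp only [h1, le_refl])
    (by
      intro w hw l l' hl hl' Y hY
      refine hX (w, l, l') (mem_product.2 ⟨?_, mem_product.2 ⟨hmemL l hl, hmemL l' hl'⟩⟩) Y hY
      rcases hw with rfl | ⟨k, rfl⟩
      · exact mem_insert_self _ _
      · exact mem_insert_of_mem (mem_image_of_mem _ (mem_univ k)))
  obtain ⟨x, hx, hxW⟩ := hcyc X hXne (fun k => (P k).toFinset)
    (fun k x j => (X j).filter fun v => ∀ w, (w, j) ∈ (ws k).zip (P (k + 1)) →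
      WordRel w (P k) fun i i' => E (x i) (x i') v)
    (fun k => disjoint_left.2 fun i hi hi' =>
      (hPs k).ne (List.mem_toFinset.1 hi) (List.mem_toFinset.1 hi') rfl)
    (fun k x j => filter_subset _ _)
    (fun k x y hxy => by
      funext j
      refine filter_congr fun v _ => forall₂_congr fun w _ => WordRel.congr fun i hi i' hi' => ?_
      rw [hxy i (List.mem_toFinset.2 hi), hxy i' (List.mem_toFinset.2 hi')])
    (fun k x j hj => filter_true_of_mem fun v _ w hw =>
      absurd (List.mem_toFinset.2 (List.of_mem_zip hw).2) hj)
    (fun k Y hY => by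
      refine (hPd k Y (hY.mono (min_le_right _ _))).trans_eq (expect_congr rfl fun x hx => ?_)
      rw [mem_piFinset] at hx
      have h1 : PatternHolds E (ws k) (P k) (P (k + 1)) x ↔ ∀ j, x j ∈ (X j).filter fun v =>
          ∀ w, (w, j) ∈ (ws k).zip (P (k + 1)) → WordRel w (P k) fun i i' => E (x i) (x i') v := by
        constructor
        · intro h j
          exact mem_filter.2 ⟨(hY j).1 (hx j), fun w hw => h _ hw⟩
        · rintro h ⟨w, j⟩ hp
          exact (mem_filter.1 (h j)).2 w hp
      by_cases h : PatternHolds E (ws k) (P k) (P (k + 1)) x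
      · rw [if_pos h, if_pos (h1.1 h)]
      · rw [if_neg h, if_neg fun h' => h (h1.2 h')])
  rw [mem_piFinset] at hx
  have hxinj : ∀ i j, x i = x j → i = j := fun i j hij => by
    by_contra hne
    exact disjoint_left.1 (hXd i j hne) (hx i) (hij ▸ hx j)
  have hPne : ∀ k k', k ≠ k' → ∀ i ∈ P k, ∀ j ∈ P k', i ≠ j := by
    intro k k' hkk i hi j hj
    have h : k' = k + 1 ∨ k = k' + 1 := by
      have h' : ∀ k k' : Fin 3, k ≠ k' → k' = k + 1 ∨ k = k' + 1 := by decide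
      exact h' k k' hkk
    rcases h with rfl | rfl
    · exact (hPs k).ne hi hj
    · exact ((hPs k').ne hj hi).symm
  have hlt : ∀ k (i : Fin m), (i : ℕ) < (P k).length := fun k i => by rw [hPl]; exact i.2
  refine ⟨fun k i => x ((P k)[(i : ℕ)]'(hlt k i)), fun k k' i i' h => ?_,
    fun k i i' j hii hsi hsi' => ?_⟩
  · have h1 := hxinj _ _ h
    have hk : k = k' := by
      by_contra hne
      exact hPne k k' hne _ (List.getElem_mem _) _ (List.getElem_mem _) h1
    subst hk
    have hnd : (P k).Nodup := (hPs k).left.imp fun h => h.ne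
    exact ⟨rfl, Fin.ext ((hnd.getElem_inj_iff).1 h1)⟩
  · rw [← hE]
    have h1 := (mem_filter.1 (hxW k ((P (k + 1))[(j : ℕ)]'(hlt (k + 1) j)))).2
      (List.ofFn fun i => s k i j) (List.mem_iff_getElem.2 ⟨j, by simp [hws, hPl], by simp [hws]⟩)
    have h2 := List.pairwise_iff_getElem.1 h1 i i' (by simp [hPl]) (by simp [hPl]) hii
    simp only [List.getElem_zip, List.getElem_ofFn] at h2
    exact h2 hsi hsi'

end Boxes

section Host

open Finset Fintype

open scoped BigOperators Classical

/-- A kernel with almost orthogonal columns has small bilinear forms. -/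
theorem abs_bilinear_le {W : Type} [Fintype W] (k : W → W → ℝ) (hk : ∀ p q, |k p q| ≤ 1)
    (bad : W → W → Prop) (θ : ℝ)
    (hbad : (((univ : Finset (W × W)).filter fun r => bad r.1 r.2).card : ℝ) ≤
      θ * (card W : ℝ) ^ 2)
    (horth : ∀ q q', ¬bad q q' → ∑ p, k p q * k p q' = 0) (u v : W → ℝ) (hu : ∀ p, |u p| ≤ 1)
    (hv : ∀ p, |v p| ≤ 1) :
    |∑ p, ∑ q, k p q * (u p * v q)| ≤ √θ * (card W : ℝ) ^ 2 := by
  have e : ∑ p, ∑ q, k p q * (u p * v q) = ∑ p, u p * ∑ q, k p q * v q := by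
    refine Finset.sum_congr rfl fun p _ => ?_
    rw [mul_sum]
    exact Finset.sum_congr rfl fun q _ => by ring
  have h1 : ∑ p, u p ^ 2 ≤ (card W : ℝ) := by
    refine (sum_le_sum (g := fun _ => (1 : ℝ)) fun p _ => ?_).trans (by simp)
    exact (sq_le_one_iff_abs_le_one _).2 (hu p)
  have h2 : ∑ p, (∑ q, k p q * v q) ^ 2 ≤ θ * (card W : ℝ) ^ 3 := by
    have e2 : ∑ p, (∑ q, k p q * v q) ^ 2 =
        ∑ r : W × W, v r.1 * v r.2 * ∑ p, k p r.1 * k p r.2 := by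
      simp only [sq, Fintype.sum_mul_sum]
      simp only [← Fintype.sum_prod_type']
      rw [Fintype.sum_prod_type, Finset.sum_comm]
      refine Finset.sum_congr rfl fun r _ => ?_
      rw [mul_sum]
      exact Finset.sum_congr rfl fun q _ => by ring
    rw [e2]
    calc ∑ r : W × W, v r.1 * v r.2 * ∑ p, k p r.1 * k p r.2
        ≤ ∑ r : W × W, if bad r.1 r.2 then (card W : ℝ) else 0 := by
          refine sum_le_sum fun r _ => ?_
          split_ifs with h
          · refine (le_abs_self _).trans ?_
            rw [abs_mul, abs_mul]
            have h3 : |∑ p, k p r.1 * k p r.2| ≤ (card W : ℝ) := by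
              refine (abs_sum_le_sum_abs _ _).trans ?_
              refine (sum_le_sum (g := fun _ => (1 : ℝ)) fun p _ => ?_).trans (by simp)
              rw [abs_mul]
              exact mul_le_one₀ (hk _ _) (abs_nonneg _) (hk _ _)
            exact (mul_le_of_le_one_left (abs_nonneg _)
              (mul_le_one₀ (hv _) (abs_nonneg _) (hv _))).trans h3
          · rw [horth _ _ h, mul_zero]
      _ = (((univ : Finset (W × W)).filter fun r => bad r.1 r.2).card : ℝ) * card W := by
          rw [← sum_filter, sum_const, nsmul_eq_mul]
      _ ≤ θ * (card W : ℝ) ^ 2 * card W := by gcongr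
      _ = _ := by ring
  rw [e]
  refine abs_le_of_sq_le_sq' ?_ (by positivity) |> abs_le.2
  calc (∑ p, u p * ∑ q, k p q * v q) ^ 2
      ≤ (∑ p, u p ^ 2) * ∑ p, (∑ q, k p q * v q) ^ 2 := sum_mul_sq_le_sq_mul_sq _ _ _
    _ ≤ (card W : ℝ) * (θ * (card W : ℝ) ^ 3) :=
        mul_le_mul h1 h2 (sum_nonneg fun _ _ => sq_nonneg _) (by positivity)
    _ = θ * ((card W : ℝ) ^ 2) ^ 2 := by ring
    _ ≤ (√θ * (card W : ℝ) ^ 2) ^ 2 := by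
        rw [mul_pow]
        gcongr
        rcases le_total 0 θ with h | h
        · rw [Real.sq_sqrt h]
        · exact h.trans (sq_nonneg _)

theorem sum_orthogonal {p : ℕ} [Fact p.Prime] (g : ZMod p → ℝ) (hg : ∑ r, g r = 0)
    {c c' : ZMod p} (hc : c ≠ c') (d d' : ZMod p) :
    ∑ x : ZMod p × ZMod p, g (x.2 + d - x.1 * c) * g (x.2 + d' - x.1 * c') = 0 := by
  have hinj : Function.Injective fun x : ZMod p × ZMod p =>
      (x.2 + d - x.1 * c, x.2 + d' - x.1 * c') := by
    rintro ⟨a, b⟩ ⟨a', b'⟩ h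
    obtain ⟨h1, h2⟩ := Prod.mk.inj h
    have h3 : (a - a') * (c' - c) = 0 := by linear_combination h1 - h2
    obtain h4 | h4 := mul_eq_zero.1 h3
    · obtain rfl := sub_eq_zero.1 h4
      have : b = b' := by linear_combination h1
      rw [this]
    · exact absurd (sub_eq_zero.1 h4).symm hc
  have h := (Finite.injective_iff_bijective.1 hinj).sum_comp
    fun y : ZMod p × ZMod p => g y.1 * g y.2
  rw [h, Fintype.sum_prod_type]
  simp only [← mul_sum, hg, mul_zero, sum_const_zero]

/-- The residue modulo three of the canonical representative. -/
def residueThree {p : ℕ} (r : ZMod p) : Fin 3 := ⟨r.val % 3, Nat.mod_lt _ (by norm_num)⟩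

theorem quarter_le_card_mod_three {p : ℕ} [NeZero p] (hp : 8 ≤ p) (κ : Fin 3) :
    (p : ℝ) / 4 ≤ ((univ : Finset (ZMod p)).filter
      fun r => residueThree r = κ).card := by
  have h1 : p / 3 ≤ ((univ : Finset (ZMod p)).filter fun r => residueThree r = κ).card := by
    have hval : ∀ i < p / 3, ((3 * i + κ : ℕ) : ZMod p).val = 3 * i + κ := fun i hi =>
      ZMod.val_cast_of_lt (by omega)
    rw [← card_range (p / 3)]
    refine card_le_card_of_injOn (fun i => ((3 * i + κ : ℕ) : ZMod p)) (fun i hi => ?_)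
      fun i hi j hj hij => ?_
    · rw [coe_range, Set.mem_Iio] at hi
      simp only [coe_filter, mem_univ, true_and, Set.mem_ofPred_eq, residueThree,
        Fin.ext_iff, hval i hi]
      omega
    · rw [coe_range, Set.mem_Iio] at hi hj
      have := congrArg ZMod.val hij
      simp only [hval i hi, hval j hj] at this
      omega
  have h2 : p ≤ 4 * ((univ : Finset (ZMod p)).filter fun r => residueThree r = κ).card := by omega
  have h3 : (p : ℝ) ≤
      4 * (((univ : Finset (ZMod p)).filter fun r => residueThree r = κ).card : ℝ) := by
    exact_mod_cast h2
  linarith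

/-- There are arbitrarily large vertex sets with a layering into small layers and a quasirandom
symmetric colouring of the pairs by three colours. -/
theorem exists_quasirandom_colouring (ε : ℝ) (hε : 0 < ε) (n₀ : ℕ) :
    ∃ n, n₀ ≤ n ∧ ∃ (t : Fin n → ℕ) (χ : Fin n → Fin n → Fin 3) (α : Fin 3 → ℝ),
      (∀ a b, χ a b = χ b a) ∧ (∀ κ, 1 / 4 ≤ α κ ∧ α κ ≤ 1) ∧
      (((univ : Finset (Fin n × Fin n)).filter fun r => t r.1 = t r.2).card : ℝ) ≤
        ε * (n : ℝ) ^ 2 ∧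
      ∀ κ (J : ℕ → ℕ → ℝ), (∀ i j, |J i j| ≤ 1) → ∀ u v : Fin n → ℝ, (∀ p, |u p| ≤ 1) →
        (∀ p, |v p| ≤ 1) → |∑ p, ∑ q, J (t p) (t q) * ((if χ p q = κ then 1 else 0) - α κ) *
          (u p * v q)| ≤ ε * (n : ℝ) ^ 2 := by
  obtain ⟨m, hm⟩ := exists_nat_gt (max (1 / ε) (1 / ε ^ 2))
  have hm1 : 1 / ε < m := (le_max_left _ _).trans_lt hm
  have hm2 : 1 / ε ^ 2 < m := (le_max_right _ _).trans_lt hm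
  obtain ⟨p, hpm, hp⟩ := Nat.exists_infinite_primes (max (max 8 n₀) m)
  have hp8 : 8 ≤ p := (le_max_left _ _).trans ((le_max_left _ _).trans hpm)
  have hpn : n₀ ≤ p := (le_max_right _ _).trans ((le_max_left _ _).trans hpm)
  have hpm' : m ≤ p := (le_max_right _ _).trans hpm
  have hmpos : (0 : ℝ) < m := (by positivity : (0 : ℝ) < 1 / ε).trans hm1
  have hm0 : 0 < m := by exact_mod_cast hmpos
  have : Fact p.Prime := ⟨hp⟩
  have hpR : (0 : ℝ) < p := by exact_mod_cast hp.pos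
  set W := Fin m × ZMod p × ZMod p with hW
  set n := Fintype.card W with hn
  have hncard : n = m * (p * p) := by simp [hn, hW, ZMod.card]
  have e : Fin n ≃ W := (Fintype.equivFin W).symm
  set α : Fin 3 → ℝ := fun κ =>
    (((univ : Finset (ZMod p)).filter fun r => residueThree r = κ).card : ℝ) / p with hα
  have hα1 : ∀ κ, α κ ≤ 1 := fun κ => by
    rw [hα, div_le_one hpR]
    have := card_le_univ ((univ : Finset (ZMod p)).filter fun r => residueThree r = κ)
    rw [ZMod.card] at this
    exact_mod_cast this
  have hα0 : ∀ κ, 1 / 4 ≤ α κ := fun κ => by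
    rw [hα, le_div_iff₀ hpR]
    have := quarter_le_card_mod_three hp8 κ
    linarith
  set col : W → W → ZMod p := fun x y => x.2.2 + y.2.2 - x.2.1 * y.2.1 with hcol
  refine ⟨n, ?_, fun a => ((e a).1 : ℕ), fun a b => residueThree (col (e a) (e b)), α, ?_,
    fun κ => ⟨hα0 κ, hα1 κ⟩, ?_, ?_⟩
  · rw [hncard]
    nlinarith
  · intro a b
    simp only [hcol]
    congr 1
    ring
  · have h1 : ((univ : Finset (Fin n × Fin n)).filter
        fun r => ((e r.1).1 : ℕ) = ((e r.2).1 : ℕ)).card ≤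
        (univ : Finset (Fin n × ZMod p × ZMod p)).card := by
      refine card_le_card_of_injOn (fun r => (r.1, (e r.2).2)) (fun _ _ => by simp) ?_
      rintro ⟨a, b⟩ h ⟨a', b'⟩ h' hh
      simp only [coe_filter, mem_univ, true_and, Set.mem_ofPred_eq] at h h'
      obtain ⟨h2, h3⟩ := Prod.mk.inj hh
      simp only at h2 h3
      subst h2
      have : e b = e b' := Prod.ext (Fin.ext (h.symm.trans h')) h3
      rw [e.injective this]
    have h2 : (((univ : Finset (Fin n × Fin n)).filter
        fun r => ((e r.1).1 : ℕ) = ((e r.2).1 : ℕ)).card : ℝ) ≤ n * (p * p) := by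
      refine (Nat.cast_le.2 h1).trans (le_of_eq ?_)
      simp [ZMod.card]
    refine h2.trans ?_
    have h3 : (1 : ℝ) ≤ ε * m := by
      rw [div_lt_iff₀' hε] at hm1
      exact hm1.le
    have h4 : (n : ℝ) = m * (p * p) := by exact_mod_cast hncard
    calc (n : ℝ) * (p * p) ≤ n * (p * p) * (ε * m) := le_mul_of_one_le_right (by positivity) h3
      _ = ε * (n : ℝ) ^ 2 := by rw [h4]; ring
  · intro κ J hJ u v hu hv
    set g : ZMod p → ℝ := fun r => (if residueThree r = κ then 1 else 0) - α κ with hg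
    have hg0 : ∑ r, g r = 0 := by
      simp only [hg, sum_sub_distrib, sum_boole, sum_const, card_univ, ZMod.card, nsmul_eq_mul, hα]
      field_simp
      simp
    have hg1 : ∀ r, |g r| ≤ 1 := fun r => by
      have h1 := hα0 κ
      have h2 := hα1 κ
      rw [abs_le]
      simp only [hg]
      split_ifs <;> constructor <;> linarith
    have hb := abs_bilinear_le (fun x y : W => J x.1 y.1 * g (col x y)) (fun x y => by
        rw [abs_mul]
        exact mul_le_one₀ (hJ _ _) (abs_nonneg _) (hg1 _))
      (fun x y => x.2.1 = y.2.1) (1 / p) (by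
        have h1 : ((univ : Finset (W × W)).filter fun r => r.1.2.1 = r.2.2.1).card ≤
            (univ : Finset (W × Fin m × ZMod p)).card := by
          refine card_le_card_of_injOn (fun r => (r.1, r.2.1, r.2.2.2)) (fun _ _ => by simp) ?_
          rintro ⟨a, b, c, d⟩ h ⟨a', b', c', d'⟩ h' hh
          simp only [coe_filter, mem_univ, true_and, Set.mem_ofPred_eq] at h h'
          simp only [Prod.mk.injEq] at hh
          obtain ⟨rfl, rfl, rfl⟩ := hh
          rw [h] at h'
          rw [h']
        have h2 : ((univ : Finset (W × Fin m × ZMod p)).card : ℝ) = 1 / p * (card W : ℝ) ^ 2 := by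
          simp only [hW, card_univ, Fintype.card_prod, ZMod.card, Fintype.card_fin]
          push_cast
          field_simp
        rw [← h2, Nat.cast_le]
        convert h1)
      (fun y y' hyy => by
        rw [Fintype.sum_prod_type]
        refine Finset.sum_eq_zero fun i _ => ?_
        have h1 := sum_orthogonal g hg0 hyy y.2.2 y'.2.2
        rw [← mul_zero (J i y.1 * J i y'.1), ← h1, mul_sum]
        exact Finset.sum_congr rfl fun x _ => by ring)
      (fun x => u (e.symm x)) (fun x => v (e.symm x)) (fun _ => hu _) fun _ => hv _
    have hs : ∑ x : W, ∑ y : W, J x.1 y.1 * g (col x y) * (u (e.symm x) * v (e.symm y)) =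
        ∑ a, ∑ b, J (e a).1 (e b).1 * g (col (e a) (e b)) * (u a * v b) := by
      rw [← e.sum_comp]
      refine Finset.sum_congr rfl fun a _ => ?_
      rw [← e.sum_comp]
      simp only [Equiv.symm_apply_apply]
    rw [hs] at hb
    refine hb.trans ?_
    gcongr
    rw [Real.sqrt_le_left hε.le, div_le_iff₀ hpR]
    rw [div_lt_iff₀' (by positivity)] at hm2
    have : (m : ℝ) ≤ p := by exact_mod_cast hpm'
    nlinarith [sq_nonneg ε]

theorem abs_sum_mul_le {n : ℕ} (c X : Fin n → ℝ) {K : ℝ} (hc : ∀ r, |c r| ≤ 1)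
    (hX : ∀ r, |X r| ≤ K) : |∑ r, c r * X r| ≤ K * n := by
  refine (abs_sum_le_sum_abs _ _).trans ?_
  refine (sum_le_sum (g := fun _ => K) fun r _ => ?_).trans ?_
  · rw [abs_mul]
    exact (mul_le_of_le_one_left (abs_nonneg _) (hc r)).trans (hX r)
  · rw [Finset.sum_const, card_univ, Fintype.card_fin, nsmul_eq_mul, mul_comm]

/-- Counting ordered triples with a prescribed colour pattern in a quasirandom colouring. -/
theorem abs_sum_pattern_sub_le {n : ℕ} (t : Fin n → ℕ) (f : Fin 3 → Fin n → Fin n → ℝ)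
    (α : Fin 3 → ℝ) (ε : ℝ) (hf : ∀ κ p q, |f κ p q| ≤ 1) (hα : ∀ κ, |α κ| ≤ 1)
    (hq : ∀ κ (J : ℕ → ℕ → ℝ), (∀ i j, |J i j| ≤ 1) → ∀ u v : Fin n → ℝ, (∀ p, |u p| ≤ 1) →
      (∀ p, |v p| ≤ 1) →
      |∑ p, ∑ q, J (t p) (t q) * (f κ p q - α κ) * (u p * v q)| ≤ ε * (n : ℝ) ^ 2)
    (w : Fin n → ℝ) (hw : ∀ p, |w p| ≤ 1) (I : ℕ → ℕ → ℝ) (hI : ∀ i j, |I i j| ≤ 1) :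
    |∑ p, ∑ q, ∑ r, w p * w q * w r * I (t p) (t q) * I (t q) (t r) *
        (f 0 p q * f 1 p r * f 2 q r) -
      α 0 * α 1 * α 2 * ∑ p, ∑ q, ∑ r, w p * w q * w r * I (t p) (t q) * I (t q) (t r)| ≤
      3 * ε * (n : ℝ) ^ 3 := by
  have hm : ∀ {a b : ℝ}, |a| ≤ 1 → |b| ≤ 1 → |a * b| ≤ 1 := fun {a b} ha hb => by
    rw [abs_mul]
    exact mul_le_one₀ ha (abs_nonneg _) hb
  have h1 := abs_sum_mul_le w (fun r => ∑ p, ∑ q, I (t p) (t q) * (f 0 p q - α 0) *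
    ((w p * f 1 p r) * (w q * I (t q) (t r) * f 2 q r))) hw fun r =>
      hq 0 I hI _ _ (fun p => hm (hw _) (hf _ _ _)) fun q => hm (hm (hw _) (hI _ _)) (hf _ _ _)
  have h2 := abs_sum_mul_le (fun q => α 0 * w q) (fun q => ∑ p, ∑ r, (1 : ℝ) * (f 1 p r - α 1) *
    ((w p * I (t p) (t q)) * (w r * I (t q) (t r) * f 2 q r))) (fun q => hm (hα _) (hw _)) fun q =>
      hq 1 (fun _ _ => 1) (by simp) _ _ (fun p => hm (hw _) (hI _ _))
        fun r => hm (hm (hw _) (hI _ _)) (hf _ _ _)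
  have h3 := abs_sum_mul_le (fun p => α 0 * α 1 * w p) (fun p => ∑ q, ∑ r,
    I (t q) (t r) * (f 2 q r - α 2) * ((w q * I (t p) (t q)) * w r))
      (fun p => hm (hm (hα _) (hα _)) (hw _)) fun p =>
      hq 2 I hI _ _ (fun q => hm (hw _) (hI _ _)) hw
  have e1 : ∑ r, w r * (∑ p, ∑ q, I (t p) (t q) * (f 0 p q - α 0) *
      ((w p * f 1 p r) * (w q * I (t q) (t r) * f 2 q r))) =
      ∑ p, ∑ q, ∑ r, w r * (I (t p) (t q) * (f 0 p q - α 0) *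
      ((w p * f 1 p r) * (w q * I (t q) (t r) * f 2 q r))) := by
    simp only [mul_sum]
    rw [Finset.sum_comm]
    exact Finset.sum_congr rfl fun p _ => Finset.sum_comm
  have e2 : ∑ q, α 0 * w q * (∑ p, ∑ r, (1 : ℝ) * (f 1 p r - α 1) *
      ((w p * I (t p) (t q)) * (w r * I (t q) (t r) * f 2 q r))) =
      ∑ p, ∑ q, ∑ r, α 0 * w q * ((1 : ℝ) * (f 1 p r - α 1) *
      ((w p * I (t p) (t q)) * (w r * I (t q) (t r) * f 2 q r))) := by
    simp only [mul_sum]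
    rw [Finset.sum_comm]
  rw [e1] at h1
  rw [e2] at h2
  simp only [mul_sum] at h3 ⊢
  rw [abs_le] at h1 h2 h3 ⊢
  have key : ∑ p, ∑ q, ∑ r, w p * w q * w r * I (t p) (t q) * I (t q) (t r) *
        (f 0 p q * f 1 p r * f 2 q r) -
      ∑ p, ∑ q, ∑ r, α 0 * α 1 * α 2 * (w p * w q * w r * I (t p) (t q) * I (t q) (t r)) =
      ∑ p, ∑ q, ∑ r, w r * (I (t p) (t q) * (f 0 p q - α 0) *
      ((w p * f 1 p r) * (w q * I (t q) (t r) * f 2 q r))) +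
      ∑ p, ∑ q, ∑ r, α 0 * w q * ((1 : ℝ) * (f 1 p r - α 1) *
      ((w p * I (t p) (t q)) * (w r * I (t q) (t r) * f 2 q r))) +
      ∑ p, ∑ q, ∑ r, α 0 * α 1 * w p *
        (I (t q) (t r) * (f 2 q r - α 2) * ((w q * I (t p) (t q)) * w r)) := by
    simp only [← sum_sub_distrib, ← sum_add_distrib]
    refine Finset.sum_congr rfl fun p _ => Finset.sum_congr rfl fun q _ =>
      Finset.sum_congr rfl fun r _ => ?_
    ring
  rw [key]
  constructor <;> linarith [h1.1, h1.2, h2.1, h2.2, h3.1, h3.2]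

theorem sorted_triple_injOn {X : Type} [DecidableEq X] (t : X → ℕ) :
    Set.InjOn (fun r : X × X × X => ({r.1, r.2.1, r.2.2} : Finset X))
      {r | t r.1 < t r.2.1 ∧ t r.2.1 < t r.2.2} := by
  rintro ⟨a, b, c⟩ ⟨h1, h2⟩ ⟨a', b', c'⟩ ⟨h1', h2'⟩ h
  simp only at h1 h2 h1' h2' h
  have ha : a ∈ ({a', b', c'} : Finset X) := h ▸ by simp
  have hb : b ∈ ({a', b', c'} : Finset X) := h ▸ by simp
  have hc : c ∈ ({a', b', c'} : Finset X) := h ▸ by simp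
  simp only [Finset.mem_insert, Finset.mem_singleton] at ha hb hc
  rcases ha with rfl | rfl | rfl <;> rcases hb with rfl | rfl | rfl <;>
    rcases hc with rfl | rfl | rfl <;> first | rfl | omega

/-- The ordered triples in `U` from three different layers. -/
noncomputable def transversals {n : ℕ} (t : Fin n → ℕ) (U : Finset (Fin n)) :
    Finset (Fin n × Fin n × Fin n) :=
  univ.filter fun r => (r.1 ∈ U ∧ r.2.1 ∈ U ∧ r.2.2 ∈ U) ∧ t r.1 < t r.2.1 ∧ t r.2.1 < t r.2.2

theorem choose_three_le_card_transversals {n : ℕ} (t : Fin n → ℕ) (U : Finset (Fin n)) :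
    U.card.choose 3 ≤ (transversals t U).card +
      ((univ : Finset (Fin n × Fin n)).filter fun r => t r.1 = t r.2).card * n := by
  have hsub : U.powersetCard 3 ⊆
      (transversals t U).image (fun r => ({r.1, r.2.1, r.2.2} : Finset (Fin n))) ∪
      (((univ : Finset (Fin n × Fin n)).filter fun r => t r.1 = t r.2) ×ˢ
        (univ : Finset (Fin n))).image fun r => {r.1.1, r.1.2, r.2} := by
    intro s hs
    obtain ⟨hsU, hs3⟩ := mem_powersetCard.1 hs
    obtain ⟨a, b, c, hab, hac, hbc, rfl⟩ := card_eq_three.1 hs3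
    have haU : a ∈ U := hsU (by simp)
    have hbU : b ∈ U := hsU (by simp)
    have hcU : c ∈ U := hsU (by simp)
    rw [mem_union, mem_image, mem_image]
    have hr : ∀ x y z : Fin n, ({x, y, z} : Finset (Fin n)) = {a, b, c} → t x = t y →
        ∃ r ∈ ((univ : Finset (Fin n × Fin n)).filter fun r => t r.1 = t r.2) ×ˢ
          (univ : Finset (Fin n)), ({r.1.1, r.1.2, r.2} : Finset (Fin n)) = {a, b, c} :=
      fun x y z h hxy => ⟨((x, y), z), by simp [hxy], h⟩
    have hl : ∀ x y z : Fin n, ({x, y, z} : Finset (Fin n)) = {a, b, c} → x ∈ U → y ∈ U → z ∈ U →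
        t x < t y → t y < t z → ∃ r ∈ transversals t U,
          ({r.1, r.2.1, r.2.2} : Finset (Fin n)) = {a, b, c} :=
      fun x y z h hx hy hz hxy hyz => ⟨(x, y, z), by simp [transversals, *], h⟩
    have p1 : ({a, c, b} : Finset (Fin n)) = {a, b, c} := by ext; simp; tauto
    have p2 : ({b, a, c} : Finset (Fin n)) = {a, b, c} := by ext; simp; tauto
    have p3 : ({b, c, a} : Finset (Fin n)) = {a, b, c} := by ext; simp; tauto
    have p4 : ({c, a, b} : Finset (Fin n)) = {a, b, c} := by ext; simp; tauto
    have p5 : ({c, b, a} : Finset (Fin n)) = {a, b, c} := by ext; simp; tauto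
    rcases lt_trichotomy (t a) (t b) with h1 | h1 | h1
    · rcases lt_trichotomy (t b) (t c) with h2 | h2 | h2
      · exact Or.inl (hl _ _ _ rfl haU hbU hcU h1 h2)
      · exact Or.inr (hr _ _ _ p3 h2)
      · rcases lt_trichotomy (t a) (t c) with h3 | h3 | h3
        · exact Or.inl (hl _ _ _ p1 haU hcU hbU h3 h2)
        · exact Or.inr (hr _ _ _ p1 h3)
        · exact Or.inl (hl _ _ _ p4 hcU haU hbU h3 h1)
    · exact Or.inr (hr _ _ _ rfl h1)
    · rcases lt_trichotomy (t a) (t c) with h2 | h2 | h2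
      · exact Or.inl (hl _ _ _ p2 hbU haU hcU h1 h2)
      · exact Or.inr (hr _ _ _ p1 h2)
      · rcases lt_trichotomy (t b) (t c) with h3 | h3 | h3
        · exact Or.inl (hl _ _ _ p3 hbU hcU haU h3 h2)
        · exact Or.inr (hr _ _ _ p3 h3)
        · exact Or.inl (hl _ _ _ p5 hcU hbU haU h3 h1)
  rw [← card_powersetCard]
  refine (card_le_card hsub).trans ((card_union_le _ _).trans (add_le_add card_image_le ?_))
  refine card_image_le.trans ?_
  rw [card_product, card_univ, Fintype.card_fin]

/-- The triples whose pairs receive the colours `0`, `1`, `2` in the order of the layers. -/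
noncomputable def patternGraph {n : ℕ} (t : Fin n → ℕ) (χ : Fin n → Fin n → Fin 3) :
    H3 (Fin n) where
  edges := ((transversals t univ).filter fun r =>
    χ r.1 r.2.1 = 0 ∧ χ r.1 r.2.2 = 1 ∧ χ r.2.1 r.2.2 = 2).image fun r => {r.1, r.2.1, r.2.2}
  card3 := fun e he => by
    obtain ⟨⟨a, b, c⟩, hr, rfl⟩ := mem_image.1 he
    obtain ⟨-, h1, h2⟩ := (mem_filter.1 (mem_filter.1 hr).1).2
    simp only at h1 h2
    refine card_eq_three.2 ⟨a, b, c, ?_, ?_, ?_, rfl⟩ <;> rintro rfl <;> omega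

theorem exists_uniformlyDense_patternGraph (η : ℝ) (hη : 0 < η) (n₀ : ℕ) :
    ∃ n, n₀ ≤ n ∧ ∃ (t : Fin n → ℕ) (χ : Fin n → Fin n → Fin 3), (∀ a b, χ a b = χ b a) ∧
      (patternGraph t χ).uniformlyDense (1 / 64) η := by
  obtain ⟨n, hn, t, χ, α, hsymm, hα, ht, hq⟩ :=
    exists_quasirandom_colouring (η / 4) (by positivity) n₀
  refine ⟨n, hn, t, χ, hsymm, fun U => ?_⟩
  set w : Fin n → ℝ := fun p => if p ∈ U then 1 else 0 with hw
  set I : ℕ → ℕ → ℝ := fun i j => if i < j then 1 else 0 with hI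
  set f : Fin 3 → Fin n → Fin n → ℝ := fun κ p q => if χ p q = κ then 1 else 0 with hf
  have hS := abs_sum_pattern_sub_le t f α (η / 4)
    (fun κ p q => by simp only [hf]; split_ifs <;> simp)
    (fun κ => abs_le.2 ⟨by linarith [(hα κ).1], (hα κ).2⟩) hq w
    (fun p => by simp only [hw]; split_ifs <;> simp) I
    (fun p q => by simp only [hI]; split_ifs <;> simp)
  have hT : ∑ p, ∑ q, ∑ r, w p * w q * w r * I (t p) (t q) * I (t q) (t r) =
      (transversals t U).card := by
    simp only [transversals, card_filter, Nat.cast_sum, Fintype.sum_prod_type]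
    refine Finset.sum_congr rfl fun p _ => Finset.sum_congr rfl fun q _ =>
      Finset.sum_congr rfl fun r _ => ?_
    simp only [hw, hI]
    by_cases h1 : p ∈ U <;> by_cases h2 : q ∈ U <;> by_cases h3 : r ∈ U <;>
      by_cases h4 : t p < t q <;> by_cases h5 : t q < t r <;> simp [h1, h2, h3, h4, h5]
  set P := (transversals t U).filter fun r =>
    χ r.1 r.2.1 = 0 ∧ χ r.1 r.2.2 = 1 ∧ χ r.2.1 r.2.2 = 2 with hP
  have hSP : ∑ p, ∑ q, ∑ r, w p * w q * w r * I (t p) (t q) * I (t q) (t r) *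
      (f 0 p q * f 1 p r * f 2 q r) = P.card := by
    simp only [hP, transversals, filter_filter, card_filter, Nat.cast_sum, Fintype.sum_prod_type]
    refine Finset.sum_congr rfl fun p _ => Finset.sum_congr rfl fun q _ =>
      Finset.sum_congr rfl fun r _ => ?_
    have hTr : w p * w q * w r * I (t p) (t q) * I (t q) (t r) =
        if (p ∈ U ∧ q ∈ U ∧ r ∈ U) ∧ t p < t q ∧ t q < t r then 1 else 0 := by
      simp only [hw, hI]
      by_cases h1 : p ∈ U <;> by_cases h2 : q ∈ U <;> by_cases h3 : r ∈ U <;>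
        by_cases h4 : t p < t q <;> by_cases h5 : t q < t r <;> simp [h1, h2, h3, h4, h5]
    rw [hTr]
    simp only [hf]
    by_cases h0 : (p ∈ U ∧ q ∈ U ∧ r ∈ U) ∧ t p < t q ∧ t q < t r
    · by_cases h1 : χ p q = 0 <;> by_cases h2 : χ p r = 1 <;> by_cases h3 : χ q r = 2 <;>
        simp [h0, h1, h2, h3]
    · rw [if_neg h0, zero_mul, eq_comm]
      simp only [Nat.cast_ite, Nat.cast_one, Nat.cast_zero, ite_eq_right_iff]
      exact fun h => absurd h.1 h0
  have hPE : P.card ≤ ((patternGraph t χ).edges.filter fun e => e ⊆ U).card := by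
    refine card_le_card_of_injOn (fun r => {r.1, r.2.1, r.2.2}) (fun r hr => ?_)
      ((sorted_triple_injOn t).mono fun r hr => ?_)
    · obtain ⟨h1, h2⟩ := mem_filter.1 (mem_coe.1 hr)
      obtain ⟨-, ⟨h3, h4, h5⟩, h6⟩ := mem_filter.1 h1
      refine mem_coe.2 (mem_filter.2 ⟨mem_image.2 ⟨r, mem_filter.2 ⟨?_, h2⟩, rfl⟩, ?_⟩)
      · exact mem_filter.2 ⟨mem_univ _, ⟨mem_univ _, mem_univ _, mem_univ _⟩, h6⟩
      · intro x hx
        simp only [Finset.mem_insert, Finset.mem_singleton] at hx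
        rcases hx with rfl | rfl | rfl <;> assumption
    · exact (mem_filter.1 (mem_filter.1 (mem_coe.1 hr)).1).2.2
  have hC : (U.card.choose 3 : ℝ) ≤ (transversals t U).card + η / 4 * (n : ℝ) ^ 3 := by
    have h1 : (U.card.choose 3 : ℝ) ≤ (transversals t U).card +
        ((univ : Finset (Fin n × Fin n)).filter fun r => t r.1 = t r.2).card * n := by
      exact_mod_cast choose_three_le_card_transversals t U
    have h2 := mul_le_mul_of_nonneg_right ht (Nat.cast_nonneg (α := ℝ) n)
    nlinarith
  have hαα : 1 / 64 ≤ α 0 * α 1 * α 2 := by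
    calc (1 : ℝ) / 64 = 1 / 4 * (1 / 4) * (1 / 4) := by norm_num
      _ ≤ _ := by
        have h0 := (hα 0).1
        have h1 := (hα 1).1
        have h2 := (hα 2).1
        have h3 : 0 ≤ α 0 := le_trans (by norm_num) h0
        have h4 : 0 ≤ α 1 := le_trans (by norm_num) h1
        gcongr
  rw [hT, hSP, abs_le] at hS
  have hPE' : (P.card : ℝ) ≤ ((patternGraph t χ).edges.filter fun e => e ⊆ U).card := by
    exact_mod_cast hPE
  have h7 := mul_le_mul_of_nonneg_right hαα (Nat.cast_nonneg (α := ℝ) (transversals t U).card)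
  rw [Fintype.card_fin]
  refine le_trans ?_ (hPE'.trans (le_of_eq ?_))
  · have h8 : 0 ≤ η * (n : ℝ) ^ 3 := by positivity
    linarith [hS.1]
  · congr

/-- A 3-graph of vanishing uniform Turán density has a layering and a colouring of the pairs such
that the pairs of every edge receive distinct colours determined by the order of the layers. -/
theorem exists_colouring_of_uniformTuranDensity {V : Type} [DecidableEq V]
    (G : H3 V) (h : ¬0 < uniformTuranDensity G) :
    ∃ (t : V → ℕ) (χ : V → V → Fin 3), (∀ a b, χ a b = χ b a) ∧
      ∀ e ∈ G.edges, ∃ a b c, e = {a, b, c} ∧ t a < t b ∧ t b < t c ∧ χ a b = 0 ∧ χ a c = 1 ∧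
        χ b c = 2 := by
  have h1 : ∃ η : ℝ, 0 < η ∧ ∃ n₀ : ℕ, ∀ n, n₀ ≤ n → ∀ H : H3 (Fin n),
      H.uniformlyDense (1 / 64) η → H.contains G := by
    by_contra! hcon
    refine h (lt_of_lt_of_le (by norm_num : (0 : ℝ) < 1 / 64) (le_csSup ⟨1, fun d hd => hd.2.1⟩ ?_))
    refine ⟨by norm_num, by norm_num, fun η hη n₀ => ?_⟩
    obtain ⟨n, hn, H, hH, hG⟩ := hcon η hη n₀
    exact ⟨n, hn, H, hG, hH⟩
  obtain ⟨η, hη, n₀, hn₀⟩ := h1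
  obtain ⟨n, hn, t, χ, hsymm, hH⟩ := exists_uniformlyDense_patternGraph η hη n₀
  obtain ⟨f, hf, hfe⟩ := hn₀ n hn _ hH
  refine ⟨fun v => t (f v), fun v v' => χ (f v) (f v'), fun _ _ => hsymm _ _, fun e he => ?_⟩
  obtain ⟨⟨a, b, c⟩, hr, hre⟩ := mem_image.1 (hfe e he)
  obtain ⟨hr1, hr2⟩ := mem_filter.1 hr
  have hr3 := (mem_filter.1 hr1).2.2
  simp only at hre hr2 hr3
  have hmem : ∀ x ∈ ({a, b, c} : Finset (Fin n)), ∃ v ∈ e, f v = x := fun x hx => by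
    rw [hre] at hx
    exact mem_image.1 hx
  obtain ⟨a', ha', rfl⟩ := hmem a (by simp)
  obtain ⟨b', hb', rfl⟩ := hmem b (by simp)
  obtain ⟨c', hc', rfl⟩ := hmem c (by simp)
  refine ⟨a', b', c', ?_, hr3.1, hr3.2, hr2⟩
  refine Finset.image_injective hf ?_
  rw [← hre]
  simp

/-- Any function to `ℕ` is refined by an injective enumeration. -/
theorem exists_equiv_fin_of_lt {V : Type} [Fintype V] (t : V → ℕ) :
    ∃ g : V ≃ Fin (card V), ∀ a b, t a < t b → g a < g b := by
  set e := Fintype.equivFin V with he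
  set r : V → ℕ := fun v => t v * card V + e v with hr
  have hr_lt : ∀ a b, t a < t b → r a < r b := fun a b hab => by
    have h1 : (t a + 1) * card V ≤ t b * card V := Nat.mul_le_mul_right _ hab
    have h2 := (e a).2
    simp only [hr]
    linarith
  have hr_inj : Function.Injective r := fun a b hab => by
    have h1 : t a = t b := by
      rcases lt_trichotomy (t a) (t b) with h | h | h
      · exact absurd hab (hr_lt _ _ h).ne
      · exact h
      · exact absurd hab (hr_lt _ _ h).ne'
    refine e.injective (Fin.ext ?_)
    simp only [hr, h1] at hab
    omega
  set g : V → Fin (card V) := fun v => ⟨((univ : Finset V).filter fun u => r u < r v).card,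
    card_lt_card (ssubset_univ_iff.2 fun h => by
      have := h ▸ mem_univ v
      simp at this)⟩ with hg
  have hg_lt : ∀ a b, r a < r b → g a < g b := fun a b hab => by
    refine Fin.mk_lt_mk.2 (card_lt_card ⟨fun u hu => ?_, fun h => ?_⟩)
    · exact mem_filter.2 ⟨mem_univ _, (mem_filter.1 hu).2.trans hab⟩
    · exact lt_irrefl _ (mem_filter.1 (h (mem_filter.2 ⟨mem_univ a, hab⟩))).2
  have hg_inj : Function.Injective g := fun a b hab => by
    rcases lt_trichotomy (r a) (r b) with h | h | h
    · exact absurd hab (hg_lt _ _ h).ne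
    · exact hr_inj h
    · exact absurd hab (hg_lt _ _ h).ne'
  have hg_bij : Function.Bijective g :=
    (Fintype.bijective_iff_injective_and_card g).2 ⟨hg_inj, (Fintype.card_fin _).symm⟩
  exact ⟨Equiv.ofBijective g hg_bij, fun a b hab => hg_lt a b (hr_lt a b hab)⟩

/-- A `(2,1)`-type 3-graph of vanishing uniform Turán density is encoded by an ordering and a
sign pattern between its two parts. -/
theorem exists_sign_pattern {V : Type} [DecidableEq V] (G : H3 V)
    (h : ¬0 < uniformTuranDensity G) (A B : Finset V)
    (hsub : ∀ e ∈ G.edges, e ⊆ A ∪ B) (htype : ∀ e ∈ G.edges, (e ∩ B).card = 1) :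
    ∃ (t : V → ℕ) (s : V → V → Bool), ∀ e ∈ G.edges, ∃ a ∈ A, ∃ a' ∈ A, ∃ b ∈ B,
      e = {a, a', b} ∧ t a < t a' ∧ s a b = true ∧ s a' b = false := by
  obtain ⟨t, χ, hsymm, hχ⟩ := exists_colouring_of_uniformTuranDensity G h
  refine ⟨t, fun a b => decide (if t a < t b then χ a b ≠ 2 else χ a b = 0), fun e he => ?_⟩
  obtain ⟨x, y, z, hxyz, hxy, hyz, h0, h1, h2⟩ := hχ e he
  obtain ⟨b, hb⟩ := card_eq_one.1 (htype e he)
  have hbe : b ∈ e ∩ B := hb ▸ mem_singleton_self b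
  have hbB := (mem_inter.1 hbe).2
  have hA : ∀ v ∈ e, t v ≠ t b → v ∈ A := fun v hv hvb => by
    rcases mem_union.1 (hsub e he hv) with h | h
    · exact h
    · have : v ∈ e ∩ B := mem_inter.2 ⟨hv, h⟩
      rw [hb, mem_singleton] at this
      exact absurd (congrArg t this) hvb
  have hx : x ∈ e := by simp [hxyz]
  have hy : y ∈ e := by simp [hxyz]
  have hz : z ∈ e := by simp [hxyz]
  have hbxyz := (mem_inter.1 hbe).1
  rw [hxyz] at hbxyz
  simp only [Finset.mem_insert, Finset.mem_singleton] at hbxyz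
  have hxz := hxy.trans hyz
  rcases hbxyz with rfl | rfl | rfl
  · refine ⟨y, hA y hy hxy.ne', z, hA z hz hxz.ne', b, hbB, ?_, hyz, ?_, ?_⟩
    · rw [hxyz]
      ext
      simp
      tauto
    · simp [hxy.not_gt, hsymm y b, h0]
    · simp [hxz.not_gt, hsymm z b, h1]
  · refine ⟨x, hA x hx hxy.ne, z, hA z hz hyz.ne', b, hbB, ?_, hxz, ?_, ?_⟩
    · rw [hxyz]
      ext
      simp
      tauto
    · simp [hxy, h0]
    · simp [hyz.not_gt, hsymm z b, h2]
  · refine ⟨x, hA x hx hxz.ne, y, hA y hy hyz.ne, b, hbB, hxyz, hxy, ?_, ?_⟩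
    · simp [hxz, h1]
    · simp [hyz, h2]

/-- Gluing three `(2,1)`-type 3-graphs of vanishing uniform Turán density cyclically yields
vanishing uniform Turán density. -/
theorem not_uniformTuranDensity_pos_of_cyclic {V : Type} [DecidableEq V] [Fintype V] (F : H3 V)
    (P : Fin 3 → Finset V) (hdisj : ∀ k k', k ≠ k' → Disjoint (P k) (P k'))
    (hcover : ∀ v, ∃ k, v ∈ P k)
    (htype : ∀ k, ∀ e ∈ F.edges, e ⊆ P k ∪ P (k + 1) → (e ∩ P (k + 1)).card = 1)
    (hall : ∀ e ∈ F.edges, ∃ k, e ⊆ P k ∪ P (k + 1))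
    (h : ∀ k, ¬0 < uniformTuranDensity (F.restrict (P k ∪ P (k + 1)))) :
    ¬0 < uniformTuranDensity F := by
  intro hpos
  have hts := fun k => exists_sign_pattern (F.restrict (P k ∪ P (k + 1))) (h k) (P k) (P (k + 1))
    (fun e he => (mem_filter.1 he).2)
    fun e he => htype k e (mem_filter.1 he).1 (mem_filter.1 he).2
  choose t s hs using hts
  have hgs := fun k => exists_equiv_fin_of_lt (t k)
  choose g hg using hgs
  choose κ hκ using hcover
  have hκ_eq : ∀ k, ∀ v ∈ P k, κ v = k := fun k v hv => by
    by_contra hne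
    exact Finset.disjoint_left.1 (hdisj _ _ hne) (hκ v) hv
  obtain ⟨d, hd, hd0⟩ : ∃ d ∈ {d : ℝ | 0 ≤ d ∧ d ≤ 1 ∧
      ∀ η : ℝ, 0 < η → ∀ n₀ : ℕ, ∃ n, n₀ ≤ n ∧
        ∃ H : H3 (Fin n), H.free F ∧ H.uniformlyDense d η}, 0 < d := by
    by_contra! hcon
    exact absurd hpos (Real.sSup_nonpos hcon).not_gt
  obtain ⟨η, hη, n₀, hn₀⟩ := exists_cyclic_pattern d hd0 (card V)
    fun k i j => s k ((g k).symm i) ((g (k + 1)).symm j)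
  obtain ⟨n, hn, H, hfree, hH⟩ := hd.2.2 η hη n₀
  obtain ⟨y, hy_inj, hy⟩ := hn₀ n hn H hH
  refine hfree ⟨fun v => y (κ v) (g (κ v) v), fun v v' hv => ?_, fun e he => ?_⟩
  · obtain ⟨h1, h2⟩ := hy_inj _ _ _ _ hv
    rw [← h1] at h2
    exact (g (κ v)).injective h2
  · obtain ⟨k, hk⟩ := hall e he
    obtain ⟨a, ha, a', ha', b, hb, rfl, hlt, h1, h2⟩ := hs k e (mem_filter.2 ⟨he, hk⟩)
    have := hy k (g k a) (g k a') (g (k + 1) b) (hg k _ _ hlt) (by simpa using h1)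
      (by simpa using h2)
    simpa [image_insert, hκ_eq k a ha, hκ_eq k a' ha', hκ_eq _ b hb] using this

end Host

/-- If `π_⋅(F) > 0` and `V(F) = A ∪ B ∪ C` is a good partition (each of
`F[A∪B]`, `F[B∪C]`, `F[C∪A]` is of `(2,1)`-type with respect to the ordered
pair of parts, and `F` has no other edges), then one of the three induced
`(2,1)`-type subhypergraphs has positive uniform Turán density. -/
theorem stmt7 {V : Type} [DecidableEq V] [Fintype V] (F : H3 V)
    (hpos : 0 < uniformTuranDensity F)
    (A B C : Finset V)
    (hAB : Disjoint A B) (hBC : Disjoint B C) (hAC : Disjoint A C)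
    (hcover : A ∪ B ∪ C = Finset.univ)
    (h1 : ∀ e ∈ F.edges, e ⊆ A ∪ B → (e ∩ A).card = 2 ∧ (e ∩ B).card = 1)
    (h2 : ∀ e ∈ F.edges, e ⊆ B ∪ C → (e ∩ B).card = 2 ∧ (e ∩ C).card = 1)
    (h3 : ∀ e ∈ F.edges, e ⊆ C ∪ A → (e ∩ C).card = 2 ∧ (e ∩ A).card = 1)
    (hall : ∀ e ∈ F.edges, e ⊆ A ∪ B ∨ e ⊆ B ∪ C ∨ e ⊆ C ∪ A) :
    0 < uniformTuranDensity (F.restrict (A ∪ B)) ∨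
    0 < uniformTuranDensity (F.restrict (B ∪ C)) ∨
    0 < uniformTuranDensity (F.restrict (C ∪ A)) := by
  by_contra! hcon
  refine not_uniformTuranDensity_pos_of_cyclic F ![A, B, C] ?_ (fun v => ?_) ?_ (fun e he => ?_) ?_
    hpos
  · intro k k' hk
    fin_cases k <;> fin_cases k' <;> simp_all [disjoint_comm]
  · have hv : v ∈ A ∪ B ∪ C := hcover ▸ Finset.mem_univ v
    simp only [Finset.mem_union] at hv
    rcases hv with (hv | hv) | hv
    · exact ⟨0, hv⟩
    · exact ⟨1, hv⟩
    · exact ⟨2, hv⟩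
  · intro k
    fin_cases k
    · exact fun e he hs => (h1 e he hs).2
    · exact fun e he hs => (h2 e he hs).2
    · exact fun e he hs => (h3 e he hs).2
  · rcases hall e he with h | h | h
    · exact ⟨0, h⟩
    · exact ⟨1, h⟩
    · exact ⟨2, h⟩
  · intro k
    fin_cases k
    · exact hcon.1.not_gt
    · exact hcon.2.1.not_gt
    · exact hcon.2.2.not_gt
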